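/- arXiv:1206.1210 — 2 statements merged into one kernel-verified Lean document; each statement's English description precedes it below -/
import Mathlib

section
/- There exists a universal constant c > 0 such that for every n ∈ ℕ and every pair of increasing Borel sets A, B ⊆ ℝ^n, one has μ^{⊗n}(A ∩ B) − μ^{⊗n}(A)·μ^{⊗n}(B) ≥ c·φ(∑_{i=1}^n I_i^G(A)·I_i^G(B)), where φ(x) = x / log(e/x). -/
open MeasureTheory ProbabilityTheory Filter Pointwise

noncomputable section

/-- The standard Gaussian measure on `ℝ`. -/
def stdGaussian : Measure ℝ := gaussianReal 0 1

/-- The `n`-fold product of the standard Gaussian measure on `ℝⁿ`. -/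
def gaussianPi (n : ℕ) : Measure (Fin n → ℝ) := Measure.pi fun _ => stdGaussian

/-- Lower Minkowski content of a set `S ⊆ ℝ` w.r.t. the standard Gaussian measure. -/
def minkContent (S : Set ℝ) : ℝ :=
  Filter.liminf
    (fun r : ℝ =>
      ((stdGaussian (S + Set.Icc (-r) r)).toReal - (stdGaussian S).toReal) / r)
    (nhdsWithin 0 (Set.Ioi 0))

/-- The restriction of `A` along the fiber of `x` in the `i`-th direction. -/
def fiber {n : ℕ} (A : Set (Fin n → ℝ)) (i : Fin n) (x : Fin n → ℝ) : Set ℝ :=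
  {y : ℝ | Function.update x i y ∈ A}

/-- The geometric influence of coordinate `i` on `A`. -/
def geomInfluence {n : ℕ} (A : Set (Fin n → ℝ)) (i : Fin n) : ℝ :=
  ∫ x, minkContent (fiber A i x) ∂(gaussianPi n)

/-- A set is increasing if its indicator is nondecreasing in each coordinate. -/
def IncreasingSet {n : ℕ} (A : Set (Fin n → ℝ)) : Prop :=
  ∀ ⦃x y : Fin n → ℝ⦄, x ≤ y → x ∈ A → y ∈ A

end


set_option linter.unusedSectionVars false

namespace Cube

noncomputable section

def sg (b : Bool) : ℝ := if b then 1 else -1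

variable {ι : Type*} [Fintype ι] [DecidableEq ι]

def ker (ρ : ℝ) (x y : ι → Bool) : ℝ := ∏ j, (1 + ρ * sg (x j) * sg (y j)) / 2

def T (ρ : ℝ) (f : (ι → Bool) → ℝ) (x : ι → Bool) : ℝ := ∑ y, ker ρ x y * f y

def L (σ : ℝ) (i : ι) (f : (ι → Bool) → ℝ) (w : ι → Bool) : ℝ :=
  ∑ z, (ker σ w z * (sg (z i) - σ * sg (w i))) * f z

def Ex (f : (ι → Bool) → ℝ) : ℝ := (1 / 2) ^ (Fintype.card ι) * ∑ x, f x

def B (ρ : ℝ) (f g : (ι → Bool) → ℝ) : ℝ := Ex (fun x => f x * ∑ y, ker ρ x y * g y)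

def M (i : ι) (ρ : ℝ) (x y : ι → Bool) : ℝ :=
  ∏ j, if j = i then sg (x j) * sg (y j) / 2 else (1 + ρ * sg (x j) * sg (y j)) / 2

def D (i : ι) (ρ : ℝ) (f g : (ι → Bool) → ℝ) : ℝ := Ex (fun x => f x * ∑ y, M i ρ x y * g y)

lemma sum_prod (φ : ι → Bool → ℝ) :
    ∑ w : ι → Bool, ∏ j, φ j (w j) = ∏ j, (φ j true + φ j false) := by
  have := (Finset.prod_univ_sum (fun _ : ι => (Finset.univ : Finset Bool)) φ).symm
  rw [Fintype.piFinset_univ] at this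
  rw [this]
  simp

lemma sum_prod2 (φ : ι → Bool → Bool → ℝ) :
    ∑ w : ι → Bool, ∑ w' : ι → Bool, ∏ j, φ j (w j) (w' j)
      = ∏ j, (φ j true true + φ j true false + φ j false true + φ j false false) := by
  have h : ∀ w : ι → Bool, ∑ w' : ι → Bool, ∏ j, φ j (w j) (w' j)
      = ∏ j, (φ j (w j) true + φ j (w j) false) := fun w => sum_prod (fun j b => φ j (w j) b)
  simp_rw [h]
  rw [sum_prod (fun j b => φ j b true + φ j b false)]
  refine Finset.prod_congr rfl fun j _ => by ring

lemma ker_nonneg {ρ : ℝ} (h0 : 0 ≤ ρ) (h1 : ρ ≤ 1) (x y : ι → Bool) : 0 ≤ ker ρ x y := by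
  refine Finset.prod_nonneg fun j _ => ?_
  cases x j <;> cases y j <;> simp [sg] <;> linarith

lemma ker_sum (ρ : ℝ) (x : ι → Bool) : ∑ y, ker ρ x y = 1 := by
  unfold ker
  rw [sum_prod (fun j b => (1 + ρ * sg (x j) * sg b) / 2)]
  refine Finset.prod_eq_one fun j _ => ?_
  simp [sg]; ring

lemma ker_comm (ρ : ℝ) (x y : ι → Bool) : ker ρ x y = ker ρ y x := by
  unfold ker
  refine Finset.prod_congr rfl fun j _ => by ring

lemma ker_comp (σ τ : ℝ) (x y : ι → Bool) :
    ∑ w : ι → Bool, ∑ w' : ι → Bool, ker σ w x * ker τ w w' * ker σ w' y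
      = ker (σ ^ 2 * τ) x y := by
  unfold ker
  simp_rw [← Finset.prod_mul_distrib]
  rw [sum_prod2 (fun j b b' => (1 + σ * sg b * sg (x j)) / 2 * ((1 + τ * sg b * sg b') / 2) *
    ((1 + σ * sg b' * sg (y j)) / 2))]
  refine Finset.prod_congr rfl fun j _ => ?_
  cases x j <;> cases y j <;> simp [sg] <;> ring

lemma eval_prod (i : ι) (c : ℝ) : c = ∏ j : ι, if j = i then c else 1 := by
  simp

lemma ker_compL (σ τ : ℝ) (i : ι) (x y : ι → Bool) :
    ∑ w : ι → Bool, ∑ w' : ι → Bool,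
      (ker σ w x * (sg (x i) - σ * sg (w i))) * ker τ w w' *
        (ker σ w' y * (sg (y i) - σ * sg (w' i)))
      = (1 - σ ^ 2) ^ 2 * M i (σ ^ 2 * τ) x y := by
  have e : ∀ w x : ι → Bool, ker σ w x * (sg (x i) - σ * sg (w i)) =
      ∏ j, ((1 + σ * sg (w j) * sg (x j)) / 2 *
        if j = i then (sg (x j) - σ * sg (w j)) else 1) := by
    intro w x
    rw [Finset.prod_mul_distrib]
    simp [ker]
  simp_rw [e]
  unfold ker M
  simp_rw [← Finset.prod_mul_distrib]
  rw [sum_prod2 (fun j b b' => ((1 + σ * sg b * sg (x j)) / 2 *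
        if j = i then (sg (x j) - σ * sg b) else 1) * ((1 + τ * sg b * sg b') / 2) *
      ((1 + σ * sg b' * sg (y j)) / 2 *
        if j = i then (sg (y j) - σ * sg b') else 1))]
  rw [eval_prod i ((1 - σ ^ 2) ^ 2), ← Finset.prod_mul_distrib]
  refine Finset.prod_congr rfl fun j _ => ?_
  by_cases h : j = i
  · subst h
    simp only [if_true]
    cases x j <;> cases y j <;> simp [sg] <;> ring
  · simp only [h, if_false]
    cases x j <;> cases y j <;> simp [sg] <;> ring

lemma B_comp (p q : (ι → Bool) → (ι → Bool) → ℝ) (τ : ℝ) (f g : (ι → Bool) → ℝ) :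
    B τ (fun w => ∑ z, p w z * f z) (fun w => ∑ z, q w z * g z)
      = Ex (fun x => f x * ∑ y, (∑ w, ∑ w', p w x * ker τ w w' * q w' y) * g y) := by
  unfold B Ex
  congr 1
  calc _ = ∑ w, ∑ x, ∑ w', ∑ y, f x * ((p w x * ker τ w w' * q w' y) * g y) := by
        refine Finset.sum_congr rfl fun w _ => ?_
        beta_reduce
        rw [Finset.sum_mul]
        refine Finset.sum_congr rfl fun x _ => ?_
        rw [Finset.mul_sum]
        refine Finset.sum_congr rfl fun w' _ => ?_
        rw [Finset.mul_sum, Finset.mul_sum]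
        refine Finset.sum_congr rfl fun y _ => by ring
    _ = ∑ x, ∑ w, ∑ w', ∑ y, f x * ((p w x * ker τ w w' * q w' y) * g y) := Finset.sum_comm
    _ = _ := by
        refine Finset.sum_congr rfl fun x _ => ?_
        simp_rw [Finset.sum_mul, Finset.mul_sum]
        calc _ = ∑ w, ∑ y, ∑ w', f x * ((p w x * ker τ w w' * q w' y) * g y) :=
              Finset.sum_congr rfl fun w _ => Finset.sum_comm
          _ = _ := Finset.sum_comm

lemma B_T (σ τ : ℝ) (f g : (ι → Bool) → ℝ) :
    B τ (T σ f) (T σ g) = B (σ ^ 2 * τ) f g := by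
  have := B_comp (ker σ) (ker σ) τ f g
  simp_rw [ker_comp] at this
  exact this

lemma B_L (σ τ : ℝ) (i : ι) (f g : (ι → Bool) → ℝ) :
    B τ (L σ i f) (L σ i g) = (1 - σ ^ 2) ^ 2 * D i (σ ^ 2 * τ) f g := by
  have := B_comp (fun w z => ker σ w z * (sg (z i) - σ * sg (w i)))
    (fun w z => ker σ w z * (sg (z i) - σ * sg (w i))) τ f g
  simp_rw [ker_compL] at this
  refine this.trans ?_
  unfold D Ex
  simp_rw [Finset.mul_sum]
  refine Finset.sum_congr rfl fun x _ => Finset.sum_congr rfl fun y _ => by ring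

lemma ker_one (x y : ι → Bool) : ker 1 x y = if y = x then 1 else 0 := by
  split_ifs with h
  · subst h
    refine Finset.prod_eq_one fun j _ => ?_
    cases y j <;> norm_num [sg]
  · obtain ⟨j, hj⟩ := Function.ne_iff.mp h
    refine Finset.prod_eq_zero (Finset.mem_univ j) ?_
    revert hj
    cases x j <;> cases y j <;> norm_num [sg]

lemma B_one (f g : (ι → Bool) → ℝ) : B 1 f g = Ex (fun x => f x * g x) := by
  unfold B
  simp [ker_one]

lemma ker_zero (x y : ι → Bool) : ker 0 x y = (1 / 2) ^ Fintype.card ι := by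
  simp [ker]

lemma B_zero (f g : (ι → Bool) → ℝ) : B 0 f g = Ex f * Ex g := by
  unfold B Ex
  simp_rw [ker_zero, ← Finset.mul_sum, ← Finset.sum_mul]
  ring

lemma hasDerivAt_ker (ρ : ℝ) (x y : ι → Bool) :
    HasDerivAt (fun ρ => ker ρ x y) (∑ i, M i ρ x y) ρ := by
  unfold ker
  have h : ∀ j ∈ (Finset.univ : Finset ι), HasDerivAt (fun ρ => (1 + ρ * sg (x j) * sg (y j)) / 2)
      (sg (x j) * sg (y j) / 2) ρ := by
    intro j _
    have := ((((hasDerivAt_id ρ).mul_const (sg (x j))).mul_const (sg (y j))).const_add 1).div_const 2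
    simpa using this
  refine (HasDerivAt.fun_finsetProd h).congr_deriv ?_
  refine Finset.sum_congr rfl fun i _ => ?_
  symm
  unfold M
  rw [← Finset.prod_erase_mul _ _ (Finset.mem_univ i)]
  simp only [if_true, smul_eq_mul]
  congr 1
  refine Finset.prod_congr rfl fun j hj => ?_
  simp [Finset.ne_of_mem_erase hj]

lemma hasDerivAt_B (ρ : ℝ) (f g : (ι → Bool) → ℝ) :
    HasDerivAt (fun ρ => B ρ f g) (∑ i, D i ρ f g) ρ := by
  have h : HasDerivAt (fun ρ => B ρ f g)
      ((1 / 2) ^ (Fintype.card ι) * ∑ x, f x * ∑ y, (∑ i, M i ρ x y) * g y) ρ := by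
    unfold B Ex
    refine HasDerivAt.const_mul _ (HasDerivAt.fun_sum fun x _ => HasDerivAt.const_mul _
      (HasDerivAt.fun_sum fun y _ => (hasDerivAt_ker ρ x y).mul_const _))
  convert h using 1
  unfold D Ex
  rw [← Finset.mul_sum, Finset.sum_comm]
  congr 1
  refine Finset.sum_congr rfl fun x _ => ?_
  rw [← Finset.mul_sum, Finset.sum_comm]
  simp_rw [Finset.sum_mul]

end
end Cube

namespace Cube

noncomputable section

lemma sg_true : sg true = 1 := by simp [sg]
lemma sg_false : sg false = -1 := by simp [sg]

lemma hoeffding_two (m t : ℝ) (h1 : -1 ≤ m) (h2 : m ≤ 1) :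
    (1 + m) / 2 * Real.exp (t * (1 - m)) + (1 - m) / 2 * Real.exp (t * (-1 - m))
      ≤ Real.exp (t ^ 2 / 2) := by
  have hp : 0 ≤ (1 + m) / 2 := by linarith
  have hq : 0 ≤ (1 - m) / 2 := by linarith
  let μ : Measure Bool := ENNReal.ofReal ((1 + m) / 2) • Measure.dirac true +
    ENNReal.ofReal ((1 - m) / 2) • Measure.dirac false
  have hμ : IsProbabilityMeasure μ := ⟨by
    simp only [μ, Measure.add_apply, Measure.smul_apply, measure_univ, smul_eq_mul, mul_one]
    rw [← ENNReal.ofReal_add hp hq]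
    simp; ring⟩
  have hint : ∀ f : Bool → ℝ, ∫ b, f b ∂μ = (1 + m) / 2 * f true + (1 - m) / 2 * f false := by
    intro f
    simp only [μ]
    rw [integral_add_measure 
      ((Integrable.of_finite).smul_measure ENNReal.ofReal_ne_top)
      ((Integrable.of_finite).smul_measure ENNReal.ofReal_ne_top),
      integral_smul_measure, integral_smul_measure, integral_dirac, integral_dirac,
      ENNReal.toReal_ofReal hp, ENNReal.toReal_ofReal hq]
    simp
  have := (hasSubgaussianMGF_of_mem_Icc_of_integral_eq_zero (μ := μ)
    (X := fun b => sg b - m) (a := -1 - m) (b := 1 - m) (by fun_prop)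
    (Eventually.of_forall fun b => by cases b <;> simp [sg]) (by rw [hint]; simp [sg]; ring)).mgf_le t
  rw [mgf, hint] at this
  simp only [sg, if_true] at this
  have e : (1 - m - (-1 - m)) = 2 := by ring
  rw [e] at this
  norm_num at this
  convert this using 2

variable {ι : Type*} [Fintype ι] [DecidableEq ι]

lemma mgf_bound {σ : ℝ} (h0 : 0 ≤ σ) (h1 : σ ≤ 1) (w : ι → Bool) (v : ι → ℝ) (t : ℝ) :
    ∑ z, ker σ w z * Real.exp (t * ∑ j, v j * (sg (z j) - σ * sg (w j)))
      ≤ Real.exp (t ^ 2 / 2 * ∑ j, v j ^ 2) := by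
  simp_rw [Finset.mul_sum, Real.exp_sum]
  unfold ker
  simp_rw [← Finset.prod_mul_distrib]
  rw [sum_prod (fun j b => (1 + σ * sg (w j) * sg b) / 2 *
    Real.exp (t * (v j * (sg b - σ * sg (w j)))))]
  refine Finset.prod_le_prod (fun j _ => ?_) (fun j _ => ?_)
  · have : 0 ≤ 1 + σ * sg (w j) ∧ 0 ≤ 1 - σ * sg (w j) := by
      cases w j <;> simp [sg] <;> constructor <;> linarith
    have h3 := this.1
    have h4 := this.2
    have h5 : 0 ≤ 1 + σ * sg (w j) * sg false := by rw [sg_false]; linarith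
    have h6 : 0 ≤ 1 + σ * sg (w j) * sg true := by rw [sg_true]; linarith
    positivity
  · have := hoeffding_two (σ * sg (w j)) (t * v j)
      (by cases w j <;> simp [sg] <;> linarith) (by cases w j <;> simp [sg] <;> linarith)
    refine le_of_eq_of_le ?_ (this.trans_eq ?_)
    · rw [sg_true, sg_false]
      ring_nf
    · congr 1; ring

lemma level1 {σ : ℝ} (h0 : 0 ≤ σ) (h1 : σ ≤ 1) (u : (ι → Bool) → ℝ) (hu : ∀ x, 0 ≤ u x)
    (w : ι → Bool) (ha : 0 < T σ u w) :
    ∑ j, L σ j u w ^ 2 ≤ 2 * (T σ u w) ^ 2 *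
      Real.log (T σ (fun x => u x ^ 2) w / (T σ u w) ^ 2) := by
  set a := T σ u w with hadef
  set A2 := T σ (fun x => u x ^ 2) w with hA2
  set v : ι → ℝ := fun j => L σ j u w with hv
  set N := ∑ j, v j ^ 2 with hN
  set l : (ι → Bool) → ℝ := fun z => ∑ j, v j * (sg (z j) - σ * sg (w j)) with hl
  have hk := ker_nonneg h0 h1 w
  have hul : ∑ z, ker σ w z * u z * l z = N := by
    simp only [hl, hN, Finset.mul_sum]
    rw [Finset.sum_comm]
    refine Finset.sum_congr rfl fun j _ => ?_
    rw [sq]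
    nth_rewrite 3 [hv]
    simp only [L, Finset.mul_sum]
    refine Finset.sum_congr rfl fun z _ => by ring
  have jen := convexOn_exp.map_sum_le (t := Finset.univ) (w := fun z => ker σ w z * u z / a)
    (p := fun z => 1 / (2 * a) * l z) (fun z _ => div_nonneg (mul_nonneg (hk z) (hu z)) ha.le)
    (by rw [← Finset.sum_div]; exact div_self ha.ne') (fun _ _ => Set.mem_univ _)
  simp only [smul_eq_mul] at jen
  have e1 : ∑ z, ker σ w z * u z / a * (1 / (2 * a) * l z) = N / (2 * a ^ 2) := by
    rw [← hul, Finset.sum_div]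
    refine Finset.sum_congr rfl fun z _ => by field_simp
  rw [e1] at jen
  have cs : (∑ z, ker σ w z * u z * Real.exp (1 / (2 * a) * l z)) ^ 2 ≤
      (∑ z, ker σ w z * u z ^ 2) * ∑ z, ker σ w z * Real.exp (1 / a * l z) := by
    refine Finset.sum_sq_le_sum_mul_sum_of_sq_le_mul _ (fun z _ => mul_nonneg (hk z) (sq_nonneg _))
      (fun z _ => mul_nonneg (hk z) (Real.exp_pos _).le) (fun z _ => ?_)
    have : Real.exp (1 / a * l z) = Real.exp (1 / (2 * a) * l z) ^ 2 := by
      rw [← Real.exp_nat_mul]; congr 1; push_cast; field_simp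
    rw [this]; apply le_of_eq; ring
  have mg := mgf_bound h0 h1 w v (1 / a)
  have hA2' : 0 ≤ A2 := Finset.sum_nonneg fun z _ => mul_nonneg (hk z) (sq_nonneg _)
  have jen2 : a * Real.exp (N / (2 * a ^ 2)) ≤
      ∑ z, ker σ w z * u z * Real.exp (1 / (2 * a) * l z) := by
    calc _ ≤ a * _ := mul_le_mul_of_nonneg_left jen ha.le
      _ = _ := by
        rw [Finset.mul_sum]
        refine Finset.sum_congr rfl fun z _ => by field_simp
  have fin : (a * Real.exp (N / (2 * a ^ 2))) ^ 2 ≤ A2 * Real.exp (N / (2 * a ^ 2)) := by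
    calc _ ≤ _ := pow_le_pow_left₀ (by positivity) jen2 2
      _ ≤ _ := cs
      _ ≤ A2 * Real.exp ((1 / a) ^ 2 / 2 * N) := mul_le_mul_of_nonneg_left mg hA2'
      _ = _ := by congr 2; field_simp
  have hE := Real.exp_pos (N / (2 * a ^ 2))
  have fin2 : Real.exp (N / (2 * a ^ 2)) ≤ A2 / a ^ 2 := by
    rw [le_div_iff₀ (by positivity)]
    refine le_of_mul_le_mul_right ?_ hE
    linarith [fin, mul_pow a (Real.exp (N / (2 * a ^ 2))) 2]
  have := (Real.le_log_iff_exp_le (lt_of_lt_of_le hE fin2)).mpr fin2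
  rw [div_le_iff₀ (by positivity)] at this
  linarith

end
end Cube

namespace Cube

noncomputable section
variable {ι : Type*} [Fintype ι] [DecidableEq ι]

lemma Ex_mono {f g : (ι → Bool) → ℝ} (h : ∀ x, f x ≤ g x) : Ex f ≤ Ex g :=
  mul_le_mul_of_nonneg_left (Finset.sum_le_sum fun x _ => h x) (by positivity)

lemma Ex_nonneg {f : (ι → Bool) → ℝ} (h : ∀ x, 0 ≤ f x) : 0 ≤ Ex f :=
  mul_nonneg (by positivity) (Finset.sum_nonneg fun x _ => h x)

lemma Ex_add (f g : (ι → Bool) → ℝ) : Ex (fun x => f x + g x) = Ex f + Ex g := by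
  simp [Ex, Finset.sum_add_distrib, mul_add]

lemma Ex_const_mul (c : ℝ) (f : (ι → Bool) → ℝ) : Ex (fun x => c * f x) = c * Ex f := by
  simp only [Ex, ← Finset.mul_sum]; ring

lemma Ex_sum {κ : Type*} (s : Finset κ) (f : κ → (ι → Bool) → ℝ) :
    Ex (fun x => ∑ i ∈ s, f i x) = ∑ i ∈ s, Ex (f i) := by
  simp only [Ex, ← Finset.mul_sum]; rw [Finset.sum_comm]

lemma Ex_const (c : ℝ) : Ex (fun _ : ι → Bool => c) = c := by
  simp [Ex]

lemma Ex_T (σ : ℝ) (h : (ι → Bool) → ℝ) : Ex (T σ h) = Ex h := by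
  unfold Ex T
  congr 1
  rw [Finset.sum_comm]
  refine Finset.sum_congr rfl fun x _ => ?_
  rw [← Finset.sum_mul]
  simp_rw [ker_comm σ _ x]
  rw [ker_sum, one_mul]

lemma T_nonneg {σ : ℝ} (h0 : 0 ≤ σ) (h1 : σ ≤ 1) {u : (ι → Bool) → ℝ} (hu : ∀ x, 0 ≤ u x)
    (w : ι → Bool) : 0 ≤ T σ u w :=
  Finset.sum_nonneg fun z _ => mul_nonneg (ker_nonneg h0 h1 w z) (hu z)

lemma L_eq_zero {σ : ℝ} (h0 : 0 ≤ σ) (h1 : σ ≤ 1) {u : (ι → Bool) → ℝ} (hu : ∀ x, 0 ≤ u x)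
    (w : ι → Bool) (h : T σ u w = 0) (j : ι) : L σ j u w = 0 := by
  have := (Finset.sum_eq_zero_iff_of_nonneg
    (fun z _ => mul_nonneg (ker_nonneg h0 h1 w z) (hu z))).mp h
  refine Finset.sum_eq_zero fun z hz => ?_
  have := this z hz
  calc _ = (sg (z j) - σ * sg (w j)) * (ker σ w z * u z) := by ring
    _ = 0 := by rw [this, mul_zero]

lemma bessel {σ : ℝ} (h0 : 0 ≤ σ) (h1 : σ ≤ 1) (u : (ι → Bool) → ℝ) (hu : ∀ x, 0 ≤ u x)
    (hu1 : ∀ x, u x ≤ 1) (w : ι → Bool) : ∑ j, L σ j u w ^ 2 ≤ 1 / 2 := by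
  rcases (T_nonneg h0 h1 hu w).eq_or_lt with h | h
  · simp [L_eq_zero h0 h1 hu w h.symm]
  · have hl := level1 h0 h1 u hu w h
    set a := T σ u w with ha
    set A2 := T σ (fun x => u x ^ 2) w with hA
    have hA2 : A2 ≤ a := Finset.sum_le_sum fun z _ =>
      mul_le_mul_of_nonneg_left (by nlinarith [hu z, hu1 z]) (ker_nonneg h0 h1 w z)
    have hA0 : 0 ≤ A2 := T_nonneg h0 h1 (fun x => sq_nonneg _) w
    rcases hA0.eq_or_lt with h' | h'
    · rw [← h'] at hl; simp at hl; linarith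
    · have := Real.log_le_sub_one_of_pos (x := A2 / a ^ 2) (by positivity)
      have h2 : 2 * a ^ 2 * Real.log (A2 / a ^ 2) ≤ 2 * a ^ 2 * (A2 / a ^ 2 - 1) :=
        mul_le_mul_of_nonneg_left this (by positivity)
      have h3 : 2 * a ^ 2 * (A2 / a ^ 2 - 1) = 2 * (A2 - a ^ 2) := by field_simp
      nlinarith [sq_nonneg (a - 1 / 2)]

lemma pair_bound {σ : ℝ} (h0 : 0 ≤ σ) (h1 : σ ≤ 1) (u v : (ι → Bool) → ℝ) (hu : ∀ x, 0 ≤ u x)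
    (hv : ∀ x, 0 ≤ v x) (w : ι → Bool) {c : ℝ} (hc : 0 < c) :
    -(∑ j, L σ j u w * L σ j v w) ≤ 2 * Real.log c * (T σ u w * T σ v w) +
      1 / c * (T σ (fun x => u x ^ 2) w + T σ (fun x => v x ^ 2) w) := by
  have hA0 : 0 ≤ T σ (fun x => u x ^ 2) w := T_nonneg h0 h1 (fun x => sq_nonneg _) w
  have hB0 : 0 ≤ T σ (fun x => v x ^ 2) w := T_nonneg h0 h1 (fun x => sq_nonneg _) w
  rcases (T_nonneg h0 h1 hu w).eq_or_lt with h | ha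
  · simp [L_eq_zero h0 h1 hu w h.symm, ← h]; positivity
  rcases (T_nonneg h0 h1 hv w).eq_or_lt with h | hb
  · simp [L_eq_zero h0 h1 hv w h.symm, ← h]; positivity
  have hX := level1 h0 h1 u hu w ha
  have hY := level1 h0 h1 v hv w hb
  have cs := Finset.sum_mul_sq_le_sq_mul_sq Finset.univ (fun j => L σ j u w) (fun j => L σ j v w)
  have hX0 : 0 ≤ ∑ j, L σ j u w ^ 2 := Finset.sum_nonneg fun j _ => sq_nonneg _
  have hY0 : 0 ≤ ∑ j, L σ j v w ^ 2 := Finset.sum_nonneg fun j _ => sq_nonneg _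
  set a := T σ u w
  set b := T σ v w
  set A := T σ (fun x => u x ^ 2) w
  set B' := T σ (fun x => v x ^ 2) w
  set X := ∑ j, L σ j u w ^ 2
  set Y := ∑ j, L σ j v w ^ 2
  set Z := ∑ j, L σ j u w * L σ j v w
  -- positivity of A, B via Cauchy-Schwarz
  have hpos : ∀ (f : (ι → Bool) → ℝ), 0 < T σ f w → 0 < T σ (fun x => f x ^ 2) w := by
    intro f hf
    have := Finset.sum_sq_le_sum_mul_sum_of_sq_le_mul (Finset.univ : Finset (ι → Bool))
      (r := fun z => ker σ w z * f z) (f := fun z => ker σ w z) (g := fun z => ker σ w z * f z ^ 2)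
      (fun z _ => ker_nonneg h0 h1 w z) (fun z _ => mul_nonneg (ker_nonneg h0 h1 w z) (sq_nonneg _))
      (fun z _ => le_of_eq (by ring))
    rw [ker_sum, one_mul] at this
    exact lt_of_lt_of_le (by exact pow_pos hf 2) this
  have hA := hpos u ha
  have hB := hpos v hb
  have lA : 0 ≤ Real.log (A / a ^ 2) := by
    by_contra hneg
    push Not at hneg
    have : 2 * a ^ 2 * Real.log (A / a ^ 2) < 0 := mul_neg_of_pos_of_neg (by positivity) hneg
    linarith
  have lB : 0 ≤ Real.log (B' / b ^ 2) := by
    by_contra hneg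
    push Not at hneg
    have : 2 * b ^ 2 * Real.log (B' / b ^ 2) < 0 := mul_neg_of_pos_of_neg (by positivity) hneg
    linarith
  set p := Real.log (A / a ^ 2) with hp
  set q := Real.log (B' / b ^ 2) with hq
  have hZ : Z ^ 2 ≤ (a * b * (p + q)) ^ 2 := by
    calc Z ^ 2 ≤ X * Y := cs
      _ ≤ (2 * a ^ 2 * p) * (2 * b ^ 2 * q) := mul_le_mul hX hY hY0 (by positivity)
      _ ≤ _ := by
        have : 0 ≤ a ^ 2 * b ^ 2 * (p - q) ^ 2 := by positivity
        nlinarith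
  have hZ2 : -Z ≤ a * b * (p + q) := by
    have := abs_le_of_sq_le_sq hZ (by positivity)
    linarith [neg_le_abs Z]
  have hpq : p + q = Real.log (A / (c * (a * b))) + Real.log (B' / (c * (a * b))) + 2 * Real.log c := by
    rw [hp, hq, Real.log_div hA.ne' (by positivity), Real.log_div hB.ne' (by positivity),
      Real.log_div hA.ne' (by positivity), Real.log_div hB.ne' (by positivity), Real.log_pow,
      Real.log_pow, Real.log_mul hc.ne' (by positivity), Real.log_mul ha.ne' hb.ne']
    push_cast; ring
  have l1 := Real.log_le_sub_one_of_pos (x := A / (c * (a * b))) (by positivity)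
  have l2 := Real.log_le_sub_one_of_pos (x := B' / (c * (a * b))) (by positivity)
  have hab : 0 < a * b := by positivity
  calc -Z ≤ a * b * (p + q) := hZ2
    _ ≤ a * b * (A / (c * (a * b)) + B' / (c * (a * b)) + 2 * Real.log c) :=
      mul_le_mul_of_nonneg_left (by rw [hpq]; linarith) hab.le
    _ = _ := by field_simp; ring

lemma D_lower {τ : ℝ} (h0 : 0 ≤ τ) (h1 : τ ≤ 1) (u v : (ι → Bool) → ℝ) (hu : ∀ x, 0 ≤ u x)
    (hv : ∀ x, 0 ≤ v x) {c : ℝ} (hc : 0 < c) :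
    -((1 - τ) ^ 2 * ∑ j, D j τ u v) ≤ 2 * Real.log c * B τ u v +
      1 / c * (Ex (fun x => u x ^ 2) + Ex (fun x => v x ^ 2)) := by
  have hs0 := Real.sqrt_nonneg τ
  have hs1 : √τ ≤ 1 := Real.sqrt_le_one.mpr h1
  have hs2 := Real.sq_sqrt h0
  have e1 : (1 - τ) ^ 2 * ∑ j, D j τ u v
      = Ex (fun w => ∑ j, L (√τ) j u w * L (√τ) j v w) := by
    rw [Ex_sum, Finset.mul_sum]
    refine Finset.sum_congr rfl fun j _ => ?_
    have := B_L (√τ) 1 j u v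
    rw [hs2, mul_one, B_one] at this
    exact this.symm
  have e2 : B τ u v = Ex (fun w => T (√τ) u w * T (√τ) v w) := by
    rw [← B_one, B_T, hs2, mul_one]
  rw [e1, e2, ← Ex_T (√τ) (fun x => u x ^ 2), ← Ex_T (√τ) (fun x => v x ^ 2), ← Ex_add,
    ← Ex_const_mul, ← Ex_const_mul, ← Ex_add, neg_eq_neg_one_mul, ← Ex_const_mul]
  refine Ex_mono fun w => ?_
  have := pair_bound hs0 hs1 u v hu hv w hc
  linarith

lemma B_nonneg {τ : ℝ} (h0 : 0 ≤ τ) (h1 : τ ≤ 1) {u v : (ι → Bool) → ℝ} (hu : ∀ x, 0 ≤ u x)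
    (hv : ∀ x, 0 ≤ v x) : 0 ≤ B τ u v :=
  Ex_nonneg fun x => mul_nonneg (hu x) (T_nonneg h0 h1 hv x)

lemma H_lower {κ : Type*} [Fintype κ] (u v : κ → (ι → Bool) → ℝ) (hu : ∀ i x, 0 ≤ u i x)
    (hv : ∀ i x, 0 ≤ v i x) (hu2 : ∑ i, Ex (fun x => u i x ^ 2) ≤ 2)
    (hv2 : ∑ i, Ex (fun x => v i x ^ 2) ≤ 2) {c : ℝ} (hc : 0 < c) (hlc : 1 ≤ Real.log c)
    {τ : ℝ} (h0 : 0 ≤ τ) (h1 : 8 * Real.log c * τ ≤ 1) :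
    Real.exp (-1) * (∑ i, B 0 (u i) (v i)) - 2 / c ≤ ∑ i, B τ (u i) (v i) := by
  set α := 8 * Real.log c with hα
  have hα8 : 8 ≤ α := by linarith
  set H : ℝ → ℝ := fun τ => ∑ i, B τ (u i) (v i) with hH
  have hd : ∀ t, HasDerivAt H (∑ i, ∑ j, D j t (u i) (v i)) t := fun t =>
    HasDerivAt.fun_sum fun i _ => hasDerivAt_B t (u i) (v i)
  set β := 16 / c with hβ
  have hβ0 : 0 < β := by positivity
  have hτ : τ ≤ 1 / 2 := by nlinarith
  have hlow : ∀ t, 0 ≤ t → t ≤ 1 / 2 →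
      0 ≤ (∑ i, ∑ j, D j t (u i) (v i)) + α * H t + β := by
    intro t ht0 ht1
    have hs := Finset.sum_le_sum (s := (Finset.univ : Finset κ)) fun i _ =>
      D_lower ht0 (by linarith) (u i) (v i) (hu i) (hv i) hc
    rw [Finset.sum_neg_distrib, ← Finset.mul_sum, Finset.sum_add_distrib, ← Finset.mul_sum,
      ← Finset.mul_sum, Finset.sum_add_distrib] at hs
    set G := ∑ i, ∑ j, D j t (u i) (v i)
    have hH0 : 0 ≤ H t := Finset.sum_nonneg fun i _ => B_nonneg ht0 (by linarith) (hu i) (hv i)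
    have h4 : 1 / c * (∑ i, Ex (fun x => u i x ^ 2) + ∑ i, Ex (fun x => v i x ^ 2)) ≤ 1 / c * 4 :=
      mul_le_mul_of_nonneg_left (by linarith) (by positivity)
    have h5 : 1 / c * 4 = β / 4 := by rw [hβ]; ring
    have h6 : -((1 - t) ^ 2 * G) ≤ α / 4 * H t + β / 4 := by
      have : 2 * Real.log c = α / 4 := by rw [hα]; ring
      rw [this] at hs
      calc _ ≤ _ := hs
        _ ≤ _ := by rw [← h5]; exact add_le_add_right h4 _
    by_cases hG : 0 ≤ G
    · positivity
    · push Not at hG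
      have : 1 / 4 ≤ (1 - t) ^ 2 := by nlinarith
      nlinarith
  set Φ : ℝ → ℝ := fun t => Real.exp (α * t) * (H t + β / α) with hΦ
  have hΦd : ∀ t, HasDerivAt Φ (Real.exp (α * t) * α * (H t + β / α) +
      Real.exp (α * t) * (∑ i, ∑ j, D j t (u i) (v i))) t := by
    intro t
    have he : HasDerivAt (fun t => Real.exp (α * t)) (Real.exp (α * t) * α) t := by
      have := ((hasDerivAt_id t).const_mul α).exp
      simpa using this
    exact he.mul ((hd t).add_const _)
  have hmono : MonotoneOn Φ (Set.Icc 0 (1 / 2)) := by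
    refine monotoneOn_of_hasDerivWithinAt_nonneg (convex_Icc _ _)
      (fun t _ => (hΦd t).continuousAt.continuousWithinAt)
      (fun t _ => (hΦd t).hasDerivWithinAt) (fun t ht => ?_)
    rw [interior_Icc] at ht
    have := hlow t ht.1.le ht.2.le
    have e : Real.exp (α * t) * α * (H t + β / α) +
      Real.exp (α * t) * (∑ i, ∑ j, D j t (u i) (v i)) = Real.exp (α * t) *
      ((∑ i, ∑ j, D j t (u i) (v i)) + α * H t + β) := by
      have : α ≠ 0 := by linarith
      field_simp; ring
    rw [e]; positivity
  have hfin := hmono ⟨le_rfl, by norm_num⟩ ⟨h0, hτ⟩ h0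
  simp only [hΦ, mul_zero, Real.exp_zero, one_mul] at hfin
  have hb : β / α ≤ 2 / c := by
    rw [hβ, div_div, div_le_div_iff₀ (by positivity) hc]; nlinarith
  have hb0 : 0 < β / α := by positivity
  have hH00 : 0 ≤ H 0 := Finset.sum_nonneg fun i _ => B_nonneg le_rfl zero_le_one (hu i) (hv i)
  have hHτ : 0 ≤ H τ := Finset.sum_nonneg fun i _ => B_nonneg h0 (by linarith) (hu i) (hv i)
  have hexp : Real.exp (α * τ) ≤ Real.exp 1 := Real.exp_le_exp.mpr h1
  have h7 : H 0 ≤ Real.exp 1 * (H τ + β / α) := by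
    calc H 0 ≤ H 0 + β / α := by linarith
      _ ≤ _ := hfin
      _ ≤ _ := mul_le_mul_of_nonneg_right hexp (by positivity)
  have h8 : Real.exp (-1) * H 0 ≤ H τ + β / α := by
    calc _ ≤ Real.exp (-1) * (Real.exp 1 * (H τ + β / α)) :=
          mul_le_mul_of_nonneg_left h7 (Real.exp_pos _).le
      _ = _ := by rw [← mul_assoc, ← Real.exp_add]; simp
  show Real.exp (-1) * H 0 - 2 / c ≤ H τ
  linarith

lemma L_nonneg {σ : ℝ} (h0 : 0 ≤ σ) (h1 : σ ≤ 1) {f : (ι → Bool) → ℝ} (hf : Monotone f) (i : ι)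
    (w : ι → Bool) : 0 ≤ L σ i f w := by
  set W : (ι → Bool) → ℝ := fun z => ker σ w z * (sg (z i) - σ * sg (w i)) with hW
  set P : (ι → Bool) → ℝ := fun z => ∏ j ∈ Finset.univ.erase i,
    (1 + σ * sg (w j) * sg (z j)) / 2 with hP
  have hP0 : ∀ z, 0 ≤ P z := by
    intro z
    refine Finset.prod_nonneg fun j _ => ?_
    cases w j <;> cases z j <;> simp [sg] <;> linarith
  have hWP : ∀ z, W z = P z * ((1 - σ ^ 2) / 2 * sg (z i)) := by
    intro z
    simp only [hW, hP, ker]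
    rw [← Finset.prod_erase_mul _ _ (Finset.mem_univ i), mul_assoc]
    congr 1
    cases w i <;> cases z i <;> simp [sg] <;> ring
  let φ : (ι → Bool) ≃ (ι → Bool) :=
    Function.Involutive.toPerm (fun z => Function.update z i (!z i)) (fun z => by simp)
  have hφ : ∀ z, φ z = Function.update z i (!z i) := fun z => rfl
  have hPφ : ∀ z, P (φ z) = P z := by
    intro z
    refine Finset.prod_congr rfl fun j hj => ?_
    rw [hφ, Function.update_of_ne (Finset.ne_of_mem_erase hj)]
  have hsum : L σ i f w = ∑ z, W (φ z) * f (φ z) := (Equiv.sum_comp φ (fun z => W z * f z)).symm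
  have h2 : 2 * L σ i f w = ∑ z, (W z * f z + W (φ z) * f (φ z)) := by
    rw [Finset.sum_add_distrib, ← hsum, two_mul]; rfl
  have : 0 ≤ 2 * L σ i f w := by
    rw [h2]
    refine Finset.sum_nonneg fun z _ => ?_
    rw [hWP, hWP, hPφ]
    have hs : 0 ≤ 1 - σ ^ 2 := by nlinarith
    cases hz : z i
    · have hle : f z ≤ f (φ z) := by
        apply hf
        rw [hφ]
        intro j
        by_cases hj : j = i
        · subst hj; simp [hz]
        · simp [hj]
      have : φ z i = true := by rw [hφ]; simp [hz]
      rw [this, sg_true, sg_false]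
      have := mul_nonneg (mul_nonneg (hP0 z) hs) (sub_nonneg.mpr hle)
      linarith
    · have hle : f (φ z) ≤ f z := by
        apply hf
        rw [hφ]
        intro j
        by_cases hj : j = i
        · subst hj; simp [hz]
        · simp [hj]
      have : φ z i = false := by rw [hφ]; simp [hz]
      rw [this, sg_true, sg_false]
      have := mul_nonneg (mul_nonneg (hP0 z) hs) (sub_nonneg.mpr hle)
      linarith
  linarith

lemma D_nonneg {ρ : ℝ} (h0 : 0 ≤ ρ) (h1 : ρ < 1) {f g : (ι → Bool) → ℝ} (hf : Monotone f)
    (hg : Monotone g) (i : ι) : 0 ≤ D i ρ f g := by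
  have hs0 := Real.sqrt_nonneg ρ
  have hs1 : √ρ ≤ 1 := Real.sqrt_le_one.mpr h1.le
  have := B_L (√ρ) 1 i f g
  rw [Real.sq_sqrt h0, mul_one] at this
  have h2 := B_nonneg zero_le_one le_rfl (L_nonneg hs0 hs1 hf i) (L_nonneg hs0 hs1 hg i)
  rw [this] at h2
  exact nonneg_of_mul_nonneg_right h2 (by have : 0 < 1 - ρ := by linarith
                                          positivity)

/-- first level coefficient -/
def co (f : (ι → Bool) → ℝ) (i : ι) : ℝ := Ex (fun x => sg (x i) * f x)

lemma L_zero (f : (ι → Bool) → ℝ) (i : ι) (w : ι → Bool) : L 0 i f w = co f i := by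
  simp only [L, co, ker_zero, Ex, Finset.mul_sum]
  refine Finset.sum_congr rfl fun x _ => by ring

lemma D_zero (f g : (ι → Bool) → ℝ) (i : ι) : D i 0 f g = co f i * co g i := by
  have := B_L 0 0 i f g
  simp only [ne_eq, OfNat.ofNat_ne_zero, not_false_eq_true, zero_pow, sub_zero, one_pow, mul_zero,
    one_mul] at this
  rw [← this, B_zero]
  have e : ∀ f : (ι → Bool) → ℝ, L 0 i f = fun _ => co f i := fun f => funext (L_zero f i)
  rw [e, e, Ex_const, Ex_const]

lemma co_nonneg {f : (ι → Bool) → ℝ} (hf : Monotone f) (i : ι) : 0 ≤ co f i := by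
  rw [← L_zero f i (fun _ => true)]
  exact L_nonneg le_rfl zero_le_one hf i _

lemma co_sq {f : (ι → Bool) → ℝ} (h0 : ∀ x, 0 ≤ f x) (h1 : ∀ x, f x ≤ 1) :
    ∑ i, co f i ^ 2 ≤ 1 / 2 := by
  have := bessel le_rfl zero_le_one f h0 h1 (fun _ => true)
  simpa [L_zero] using this

lemma S_le {f g : (ι → Bool) → ℝ} (hf0 : ∀ x, 0 ≤ f x) (hf1 : ∀ x, f x ≤ 1)
    (hg0 : ∀ x, 0 ≤ g x) (hg1 : ∀ x, g x ≤ 1) : ∑ i, co f i * co g i ≤ 1 / 2 := by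
  have h1 := co_sq hf0 hf1
  have h2 := co_sq hg0 hg1
  have : ∑ i, co f i * co g i ≤ ∑ i, (co f i ^ 2 + co g i ^ 2) / 2 :=
    Finset.sum_le_sum fun i _ => by nlinarith [sq_nonneg (co f i - co g i)]
  rw [← Finset.sum_div, Finset.sum_add_distrib] at this
  linarith

lemma B_mono {f g : (ι → Bool) → ℝ} (hf : Monotone f) (hg : Monotone g) :
    MonotoneOn (fun ρ => B ρ f g) (Set.Icc 0 1) := by
  refine monotoneOn_of_hasDerivWithinAt_nonneg (convex_Icc _ _)
      (fun t _ => (hasDerivAt_B t f g).continuousAt.continuousWithinAt)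
      (fun t _ => (hasDerivAt_B t f g).hasDerivWithinAt) (fun t ht => ?_)
  rw [interior_Icc] at ht
  exact Finset.sum_nonneg fun i _ => D_nonneg ht.1.le ht.2 hf hg i

theorem harris {f g : (ι → Bool) → ℝ} (hf : Monotone f) (hg : Monotone g) :
    0 ≤ Ex (fun x => f x * g x) - Ex f * Ex g := by
  rw [← B_one, ← B_zero]
  have := B_mono hf hg ⟨le_rfl, zero_le_one⟩ ⟨zero_le_one, le_rfl⟩ zero_le_one
  simpa using this

theorem cube_talagrand {f g : (ι → Bool) → ℝ} (hf : Monotone f) (hg : Monotone g)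
    (hf0 : ∀ x, 0 ≤ f x) (hf1 : ∀ x, f x ≤ 1) (hg0 : ∀ x, 0 ≤ g x) (hg1 : ∀ x, g x ≤ 1)
    (hS : 0 < ∑ i, co f i * co g i) :
    (∑ i, co f i * co g i) / (80 * Real.log (64 / ∑ i, co f i * co g i)) ≤
      Ex (fun x => f x * g x) - Ex f * Ex g := by
  have hS1 := S_le hf0 hf1 hg0 hg1
  set S := ∑ i, co f i * co g i with hSdef
  set c := 64 / S with hc
  have hc0 : 0 < c := by positivity
  have hc1 : 128 ≤ c := by rw [hc, le_div_iff₀ hS]; linarith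
  have hlc : 1 ≤ Real.log c := by
    rw [Real.le_log_iff_exp_le hc0]
    linarith [Real.exp_one_lt_d9]
  set s := √(1 / 2 : ℝ) with hs
  have hs0 : 0 ≤ s := Real.sqrt_nonneg _
  have hs1 : s ≤ 1 := Real.sqrt_le_one.mpr (by norm_num)
  have hs2 : s ^ 2 = 1 / 2 := Real.sq_sqrt (by norm_num)
  have hsum2 : ∀ f : (ι → Bool) → ℝ, (∀ x, 0 ≤ f x) → (∀ x, f x ≤ 1) →
      ∑ i, Ex (fun x => L s i f x ^ 2) ≤ 2 := by
    intro f h0 h1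
    rw [← Ex_sum]
    calc _ ≤ Ex (fun _ : ι → Bool => (2 : ℝ)) := Ex_mono fun x => by
          linarith [bessel hs0 hs1 f h0 h1 x]
      _ = 2 := Ex_const 2
  have hD : ∀ ρ, 0 ≤ ρ → 16 * Real.log c * ρ ≤ 1 → S / 5 ≤ ∑ i, D i ρ f g := by
    intro ρ h0 h1
    have := H_lower (fun i => L s i f) (fun i => L s i g) (fun i x => L_nonneg hs0 hs1 hf i x)
      (fun i x => L_nonneg hs0 hs1 hg i x) (hsum2 f hf0 hf1) (hsum2 g hg0 hg1) hc0 hlc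
      (τ := 2 * ρ) (by linarith) (by linarith)
    simp only [B_L, hs2, ← Finset.mul_sum, mul_zero, D_zero] at this
    rw [← hSdef] at this
    have e : 1 / 2 * (2 * ρ) = ρ := by ring
    rw [e] at this
    have e2 : 2 / c = S / 32 := by rw [hc]; field_simp; norm_num
    rw [e2] at this
    have he : (0.36 : ℝ) ≤ Real.exp (-1) := by linarith [Real.exp_neg_one_gt_d9]
    have : 0.36 * S ≤ Real.exp (-1) * S := mul_le_mul_of_nonneg_right he hS.le
    norm_num at *
    linarith
  set ρ₁ := 1 / (16 * Real.log c) with hρ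
  have hρ0 : 0 < ρ₁ := by positivity
  have hρ1 : ρ₁ ≤ 1 := by rw [hρ, div_le_one (by positivity)]; linarith
  have h1 : ρ₁ * (S / 5) ≤ B ρ₁ f g - B 0 f g := by
    have hm : MonotoneOn (fun ρ => B ρ f g - ρ * (S / 5)) (Set.Icc 0 ρ₁) := by
      have hd : ∀ t, HasDerivAt (fun ρ => B ρ f g - ρ * (S / 5)) (∑ i, D i t f g - S / 5) t := by
        intro t
        have := (hasDerivAt_B t f g).fun_sub ((hasDerivAt_id t).mul_const (S / 5))
        simpa using this
      refine monotoneOn_of_hasDerivWithinAt_nonneg (convex_Icc _ _)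
        (fun t _ => (hd t).continuousAt.continuousWithinAt)
        (fun t _ => (hd t).hasDerivWithinAt) (fun t ht => ?_)
      rw [interior_Icc] at ht
      have h2 : 16 * Real.log c * t ≤ 1 := by
        have := ht.2.le
        rw [hρ, le_div_iff₀ (by positivity)] at this
        linarith
      linarith [hD t ht.1.le h2]
    have := hm ⟨le_rfl, hρ0.le⟩ ⟨hρ0.le, le_rfl⟩ hρ0.le
    simp only at this
    linarith
  have h2 : B ρ₁ f g ≤ B 1 f g := B_mono hf hg ⟨hρ0.le, hρ1⟩ ⟨zero_le_one, le_rfl⟩ hρ1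
  rw [B_one] at h2
  rw [B_zero] at h1
  have e : S / (80 * Real.log c) = ρ₁ * (S / 5) := by rw [hρ]; field_simp; norm_num
  rw [e]; linarith

end
end Cube

namespace Cube

noncomputable section

/-- Fair coin. -/
def coin : Measure Bool := (1 / 2 : ENNReal) • Measure.dirac true + (1 / 2 : ENNReal) • Measure.dirac false

instance : IsProbabilityMeasure coin := ⟨by simp [coin, ENNReal.inv_two_add_inv_two]⟩

lemma coin_real (b : Bool) : coin.real {b} = 1 / 2 := by
  cases b <;> simp [coin, Measure.real]

/-- Normalised sum. -/
def ns (M : ℕ) (x : Fin M → Bool) : ℝ := (√M)⁻¹ * ∑ m, sg (x m)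

lemma measurable_ns (M : ℕ) : Measurable (ns M) := measurable_of_finite _

def nu (M : ℕ) : Measure ℝ := (Measure.pi fun _ : Fin M => coin).map (ns M)

instance (M : ℕ) : IsProbabilityMeasure (nu M) :=
  Measure.isProbabilityMeasure_map (measurable_ns M).aemeasurable

lemma charFun_nu (M : ℕ) (t : ℝ) :
    charFun (nu M) t = (charFun (coin.map sg) ((√M)⁻¹ * t)) ^ M := by
  rw [charFun_apply_real, charFun_apply_real, nu,
    integral_map (measurable_ns M).aemeasurable (by fun_prop),
    integral_map (measurable_of_finite _).aemeasurable (by fun_prop)]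
  have := integral_fintype_prod_eq_pow (ι := Fin M) (μ := coin)
    (fun x : Bool => Complex.exp (((√M)⁻¹ * t : ℝ) * (sg x : ℝ) * Complex.I))
  rw [Fintype.card_fin] at this
  rw [← this]
  congr 1 with x
  rw [← Complex.exp_sum]
  congr 1
  simp only [ns]
  push_cast
  rw [Finset.mul_sum, Finset.mul_sum, Finset.sum_mul]
  exact Finset.sum_congr rfl fun i _ => by ring

/-- `nu` as a bundled measure. -/
def nuP (M : ℕ) : ProbabilityMeasure ℝ := ⟨nu M, inferInstance⟩

def gaP : ProbabilityMeasure ℝ := ⟨gaussianReal 0 1, inferInstance⟩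

lemma tendsto_nu : Tendsto nuP atTop (nhds gaP) := by
  refine ProbabilityMeasure.tendsto_iff_tendsto_charFun.2 fun t => ?_
  simp only [nuP, gaP, ProbabilityMeasure.coe_mk, charFun_nu, charFun_gaussianReal]
  have := tendsto_charFun_inv_sqrt_mul_pow (P := coin) (X := sg)
    (measurable_of_finite _).aemeasurable
    (by rw [integral_fintype .of_finite]; simp [coin_real, sg])
    (by rw [integral_fintype .of_finite]; simp [coin_real, sg]) t
  convert this using 3
  simp
  ring

lemma tendsto_pi_nu (n : ℕ) :
    Tendsto (fun M => ProbabilityMeasure.pi (fun _ : Fin n => nuP M)) atTop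
      (nhds (ProbabilityMeasure.pi (fun _ : Fin n => gaP))) :=
  (ProbabilityMeasure.continuous_pi.tendsto _).comp
    (tendsto_pi_nhds.2 fun _ => tendsto_nu)

/-- The product of discrete laws. -/
def pnu (n M : ℕ) : Measure (Fin n → ℝ) := Measure.pi (fun _ : Fin n => nu M)

instance (n M : ℕ) : IsProbabilityMeasure (pnu n M) := by unfold pnu; infer_instance

/-- The cube random vector. -/
def X {n M : ℕ} (z : Fin n × Fin M → Bool) (i : Fin n) : ℝ := ns M (fun m => z (i, m))

lemma pnu_eq (n M : ℕ) : pnu n M =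
    (Measure.pi fun _ : Fin n => Measure.pi fun _ : Fin M => coin).map
      (fun z i => ns M (z i)) := by
  rw [pnu, Measure.pi_map_pi fun i => (measurable_ns M).aemeasurable]
  rfl

lemma integrable_pnu {n M : ℕ} {h : (Fin n → ℝ) → ℝ} (hh : Measurable h) :
    Integrable h (pnu n M) := by
  rw [pnu_eq, integrable_map_measure hh.aestronglyMeasurable
    (measurable_of_finite _).aemeasurable]
  exact .of_finite

lemma integral_pnu {n M : ℕ} {h : (Fin n → ℝ) → ℝ} (hh : Measurable h) :
    ∫ x, h x ∂(pnu n M) = Ex (fun z : Fin n × Fin M → Bool => h (X z)) := by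
  rw [pnu_eq, integral_map (measurable_of_finite _).aemeasurable hh.aestronglyMeasurable,
    integral_fintype .of_finite, Ex, Finset.mul_sum]
  rw [← (Equiv.curry (Fin n) (Fin M) Bool).sum_comp]
  refine Finset.sum_congr rfl fun z _ => ?_
  have : (Measure.pi fun _ : Fin n => Measure.pi fun _ : Fin M => coin).real
      {Equiv.curry (Fin n) (Fin M) Bool z} = (1 / 2) ^ (Fintype.card (Fin n × Fin M)) := by
    rw [Measure.real, Measure.pi_singleton]
    simp_rw [Measure.pi_singleton, ENNReal.toReal_prod]
    have : ∀ b, (coin {b}).toReal = 1 / 2 := coin_real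
    simp [this, pow_mul, Finset.prod_const]
    rw [← pow_mul, ← pow_mul, mul_comm]
  rw [this, smul_eq_mul]
  rfl

lemma Ex_sg_sg {ι : Type*} [Fintype ι] [DecidableEq ι] (i j : ι) :
    Ex (fun x : ι → Bool => sg (x i) * sg (x j)) = if i = j then 1 else 0 := by
  have key : ∀ x : ι → Bool, sg (x i) * sg (x j) =
      ∏ k, (if k = i then sg (x k) else 1) * (if k = j then sg (x k) else 1) := by
    intro x
    rw [Finset.prod_mul_distrib]; simp
  simp_rw [key]
  unfold Ex
  rw [sum_prod (fun k b => (if k = i then sg b else 1) * (if k = j then sg b else 1))]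
  split_ifs with h
  · subst h
    have : ∀ k, ((if k = i then sg true else 1) * (if k = i then sg true else 1) +
      (if k = i then sg false else 1) * (if k = i then sg false else 1)) = 2 := by
      intro k; split_ifs <;> simp [sg] <;> norm_num
    simp_rw [this]
    simp
  · rw [Finset.prod_eq_zero (Finset.mem_univ i)]
    · simp
    · simp [h, sg]

lemma Ex_X_sq {n M : ℕ} (hM : 0 < M) (i : Fin n) :
    Ex (fun z : Fin n × Fin M → Bool => X z i ^ 2) = 1 := by
  have key : ∀ z : Fin n × Fin M → Bool, X z i ^ 2 =
      (M : ℝ)⁻¹ * ∑ m, ∑ m', sg (z (i, m)) * sg (z (i, m')) := by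
    intro z
    rw [X, ns, mul_pow, inv_pow, Real.sq_sqrt (by positivity), sq, Finset.sum_mul_sum]
  simp_rw [key, Ex_const_mul, Ex_sum, Ex_sg_sg]
  simp
  field_simp

lemma co_X {n M : ℕ} (h : (Fin n → ℝ) → ℝ) (i : Fin n) (m : Fin M) :
    co (fun z : Fin n × Fin M → Bool => h (X z)) (i, m) =
      (√M)⁻¹ * Ex (fun z : Fin n × Fin M → Bool => X z i * h (X z)) := by
  have hM : 0 < M := m.pos
  have hsym : ∀ m', co (fun z : Fin n × Fin M → Bool => h (X z)) (i, m') =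
      co (fun z : Fin n × Fin M → Bool => h (X z)) (i, m) := by
    intro m'
    unfold co Ex
    congr 1
    let σ : Equiv.Perm (Fin n × Fin M) := (Equiv.refl _).prodCongr (Equiv.swap m m')
    rw [← (Equiv.arrowCongr σ (Equiv.refl Bool)).sum_comp]
    refine Finset.sum_congr rfl fun z _ => ?_
    have h1 : X (Equiv.arrowCongr σ (Equiv.refl Bool) z) = X z := by
      funext k
      simp only [X, ns]
      congr 1
      rw [← Equiv.sum_comp (Equiv.swap m m')]
      refine Finset.sum_congr rfl fun a _ => ?_
      simp [σ, Equiv.arrowCongr]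
    beta_reduce
    rw [h1]
    simp [σ, Equiv.arrowCongr]
  have h2 : Ex (fun z : Fin n × Fin M → Bool => X z i * h (X z)) =
      (√M)⁻¹ * ∑ m', co (fun z : Fin n × Fin M → Bool => h (X z)) (i, m') := by
    unfold co
    rw [← Ex_sum, ← Ex_const_mul]
    congr 1 with z
    rw [← Finset.sum_mul, X, ns]
    ring
  rw [h2]
  simp_rw [hsym]
  have hs : (√M)⁻¹ * (√M)⁻¹ = (M : ℝ)⁻¹ := by
    rw [← mul_inv, Real.mul_self_sqrt (by positivity)]
  have : (M : ℝ) ≠ 0 := by positivity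
  simp only [Finset.sum_const, Finset.card_univ, Fintype.card_fin, nsmul_eq_mul]
  rw [← mul_assoc, hs, ← mul_assoc, inv_mul_cancel₀ this, one_mul]

lemma sum_co_X {n M : ℕ} (hM : 0 < M) (f g : (Fin n → ℝ) → ℝ) :
    ∑ p : Fin n × Fin M, co (fun z : Fin n × Fin M → Bool => f (X z)) p *
        co (fun z : Fin n × Fin M → Bool => g (X z)) p =
      ∑ i, Ex (fun z : Fin n × Fin M → Bool => X z i * f (X z)) *
        Ex (fun z : Fin n × Fin M → Bool => X z i * g (X z)) := by
  rw [Fintype.sum_prod_type]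
  refine Finset.sum_congr rfl fun i _ => ?_
  simp_rw [co_X]
  have hs : (√M)⁻¹ * (√M)⁻¹ = (M : ℝ)⁻¹ := by
    rw [← mul_inv, Real.mul_self_sqrt (by positivity)]
  have : (M : ℝ) ≠ 0 := by positivity
  simp only [Finset.sum_const, Finset.card_univ, Fintype.card_fin, nsmul_eq_mul]
  rw [mul_mul_mul_comm, hs, ← mul_assoc, mul_inv_cancel₀ this, one_mul]

lemma X_mono {n M : ℕ} : Monotone (X : (Fin n × Fin M → Bool) → Fin n → ℝ) := by
  intro z w h i
  simp only [X, ns]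
  refine mul_le_mul_of_nonneg_left (Finset.sum_le_sum fun m _ => ?_) (by positivity)
  have := h (i, m)
  revert this
  cases z (i, m) <;> cases w (i, m) <;> simp [sg]

/-- Convergence of means from convergence of tails. -/
lemma tendsto_integral_of_tails {Ω : Type*} [MeasurableSpace Ω] (P : ℕ → Measure Ω) (Q : Measure Ω)
    [∀ k, IsProbabilityMeasure (P k)] [IsProbabilityMeasure Q] (f : Ω → ℝ)
    (f0 : ∀ x, 0 ≤ f x) (hQi : Integrable f Q)
    (hPi : ∀ k, Integrable f (P k))
    (hPi2 : ∀ k, Integrable (fun x => f x ^ 2) (P k))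
    (hP2 : ∀ᶠ k in atTop, ∫ x, f x ^ 2 ∂(P k) ≤ 1)
    (ht : ∀ t : ℝ, 0 < t → Tendsto (fun k => (P k).real {x | t < f x}) atTop
      (nhds (Q.real {x | t < f x}))) :
    Tendsto (fun k => ∫ x, f x ∂(P k)) atTop (nhds (∫ x, f x ∂Q)) := by
  rw [hQi.integral_eq_integral_meas_lt (Eventually.of_forall f0)]
  simp_rw [fun k => (hPi k).integral_eq_integral_meas_lt (Eventually.of_forall f0)]
  refine tendsto_integral_filter_of_dominated_convergence (fun t => 2 * (1 + t ^ 2)⁻¹) ?_ ?_ ?_ ?_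
  · refine Eventually.of_forall fun k => ?_
    have : Antitone (fun t => (P k).real {x | t < f x}) := fun s t hst =>
      measureReal_mono fun x (hx : t < f x) => lt_of_le_of_lt hst hx
    exact this.measurable.aestronglyMeasurable
  · filter_upwards [hP2] with k hk
    refine (ae_restrict_mem measurableSet_Ioi).mono fun t ht0 => ?_
    rw [Real.norm_of_nonneg (by positivity), ← div_eq_mul_inv, le_div_iff₀ (by positivity), mul_comm]
    have := mul_meas_ge_le_integral_of_nonneg (μ := P k) (f := fun x => 1 + f x ^ 2)
      (Eventually.of_forall fun x => by positivity) ((integrable_const 1).add (hPi2 k)) (1 + t ^ 2)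
    rw [integral_add (integrable_const 1) (hPi2 k)] at this
    simp only [integral_const, probReal_univ, smul_eq_mul, mul_one] at this
    refine le_trans (mul_le_mul_of_nonneg_left (measureReal_mono ?_) (by positivity))
      (this.trans (by linarith))
    intro x (hx : t < f x)
    have h0 : (0 : ℝ) < t := ht0
    change 1 + t ^ 2 ≤ 1 + f x ^ 2
    gcongr
  · exact (integrable_inv_one_add_sq.const_mul 2).integrableOn
  · exact (ae_restrict_mem measurableSet_Ioi).mono fun t ht0 => ht t ht0

end
end Cube

namespace Cube

noncomputable section

instance : IsProbabilityMeasure _root_.stdGaussian := by unfold _root_.stdGaussian; infer_instance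
instance (n : ℕ) : IsProbabilityMeasure (gaussianPi n) := by unfold gaussianPi; infer_instance

lemma gaussianPi_ac (n : ℕ) : gaussianPi n ≪ volume := by
  induction n with
  | zero =>
    intro s hs
    have h1 : s = ∅ := by
      by_contra h
      obtain ⟨x, hx⟩ := Set.nonempty_iff_ne_empty.2 h
      have : s = Set.univ := by
        ext y; simp [Subsingleton.elim y x, hx]
      rw [this] at hs
      simp [volume_pi, Measure.pi_of_empty] at hs
    simp [h1]
  | succ n ih =>
    have h1 := measurePreserving_piFinSuccAbove (fun _ : Fin (n + 1) => _root_.stdGaussian) 0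
    have h2 := measurePreserving_piFinSuccAbove (fun _ : Fin (n + 1) => (volume : Measure ℝ)) 0
    have h3 : _root_.stdGaussian ≪ volume := gaussianReal_absolutelyContinuous 0 one_ne_zero
    have h4 := h3.prod ih
    have h5 := h4.map (MeasurableEquiv.piFinSuccAbove (fun _ : Fin (n + 1) => ℝ) 0).symm.measurable
    have e1 := h1.symm.map_eq
    have e2 := h2.symm.map_eq
    rw [← volume_pi] at e2
    rw [gaussianPi, ← e1, volume_pi, ← e2]
    exact h5

lemma pi_gaP (n : ℕ) : (ProbabilityMeasure.pi (fun _ : Fin n => gaP) : Measure (Fin n → ℝ)) =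
    gaussianPi n := rfl

lemma pi_nuP (n M : ℕ) : (ProbabilityMeasure.pi (fun _ : Fin n => nuP M) : Measure (Fin n → ℝ)) =
    pnu n M := rfl

lemma tendsto_set {n : ℕ} {E : Set (Fin n → ℝ)} (hE : volume (frontier E) = 0) :
    Tendsto (fun M => (pnu n M).real E) atTop (nhds ((gaussianPi n).real E)) := by
  have := ProbabilityMeasure.tendsto_measure_of_null_frontier_of_tendsto' (tendsto_pi_nu n) (E := E)
    (gaussianPi_ac n hE)
  exact (ENNReal.tendsto_toReal (measure_ne_top _ _)).comp this

lemma memLp_coord {n : ℕ} (i : Fin n) : MemLp (fun x : Fin n → ℝ => x i) 2 (gaussianPi n) := by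
  have h := memLp_id_gaussianReal (μ := 0) (v := 1) 2
  exact h.comp_measurePreserving (measurePreserving_eval (fun _ : Fin n => _root_.stdGaussian) i)

lemma tendsto_coord_aux {n : ℕ} {A : Set (Fin n → ℝ)} (hA : MeasurableSet A)
    (hA' : volume (frontier A) = 0) (i : Fin n) (s : ℝ) (hs : s = 1 ∨ s = -1) :
    Tendsto (fun M => ∫ x, A.indicator (fun x => max (s * x i) 0) x ∂(pnu n M)) atTop
      (nhds (∫ x, A.indicator (fun x => max (s * x i) 0) x ∂(gaussianPi n))) := by
  have hm : Measurable (A.indicator (fun x : Fin n → ℝ => max (s * x i) 0)) :=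
    Measurable.indicator (by fun_prop) hA
  have hle : ∀ x, A.indicator (fun x : Fin n → ℝ => max (s * x i) 0) x ^ 2 ≤ x i ^ 2 := by
    intro x
    have hs2 : (s * x i) ^ 2 = x i ^ 2 := by rcases hs with rfl | rfl <;> ring
    by_cases hx : x ∈ A
    · rw [Set.indicator_of_mem hx]
      rcases le_total (s * x i) 0 with h | h
      · rw [max_eq_right h]; nlinarith [sq_nonneg (x i)]
      · rw [max_eq_left h, hs2]
    · rw [Set.indicator_of_notMem hx]; nlinarith [sq_nonneg (x i)]
  have hle1 : ∀ x, ‖A.indicator (fun x : Fin n → ℝ => max (s * x i) 0) x‖ ≤ ‖x i‖ := by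
    intro x
    exact sq_le_sq.1 (hle x)
  refine tendsto_integral_of_tails _ _ _ (fun x => Set.indicator_nonneg (fun _ _ => le_max_right _ _) x)
    ?_ (fun k => integrable_pnu hm) (fun k => integrable_pnu (hm.pow_const 2)) ?_ ?_
  · exact ((memLp_coord i).integrable (by norm_num)).mono hm.aestronglyMeasurable
      (Eventually.of_forall hle1)
  · filter_upwards [eventually_gt_atTop 0] with M hM
    rw [integral_pnu (hm.pow_const 2), ← Ex_X_sq hM i]
    exact Ex_mono fun z => hle _
  · intro t ht
    have : {x | t < A.indicator (fun x : Fin n → ℝ => max (s * x i) 0) x} =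
        A ∩ {x | t < s * x i} := by
      ext x
      by_cases hx : x ∈ A
      · simp [hx, ht.not_gt]
      · simp [hx, ht.le]
    rw [this]
    refine tendsto_set (null_frontier_inter hA' ?_)
    rcases hs with rfl | rfl
    · exact IsUpperSet.null_frontier fun x y hxy (hx : t < 1 * x i) =>
        show t < 1 * y i by linarith [hxy i]
    · exact IsLowerSet.null_frontier fun x y hxy (hx : t < -1 * x i) =>
        show t < -1 * y i by linarith [hxy i]

/-- The first-order coefficient. -/
def inf {n : ℕ} (A : Set (Fin n → ℝ)) (i : Fin n) : ℝ :=
  ∫ x, x i * A.indicator 1 x ∂(gaussianPi n)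

lemma tendsto_coord {n : ℕ} {A : Set (Fin n → ℝ)} (hA : MeasurableSet A)
    (hA' : volume (frontier A) = 0) (i : Fin n) :
    Tendsto (fun M => Ex (fun z : Fin n × Fin M → Bool => X z i * A.indicator 1 (X z))) atTop
      (nhds (inf A i)) := by
  have h1 := tendsto_coord_aux hA hA' i 1 (Or.inl rfl)
  have h2 := tendsto_coord_aux hA hA' i (-1) (Or.inr rfl)
  have hm : ∀ s : ℝ, Measurable (A.indicator (fun x : Fin n → ℝ => max (s * x i) 0)) := fun s =>
    Measurable.indicator (by fun_prop) hA
  have hm1 : Measurable (fun x : Fin n → ℝ => x i * A.indicator 1 x) :=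
    (measurable_pi_apply i).mul (measurable_one.indicator hA)
  have heq : ∀ x : Fin n → ℝ, A.indicator (fun x : Fin n → ℝ => max (1 * x i) 0) x -
      A.indicator (fun x : Fin n → ℝ => max (-1 * x i) 0) x = x i * A.indicator 1 x := by
    intro x
    by_cases hx : x ∈ A
    · simp only [Set.indicator_of_mem hx]
      rcases le_total (x i) 0 with h | h
      · rw [max_eq_right (by linarith), max_eq_left (by linarith)]; simp
      · rw [max_eq_left (by linarith), max_eq_right (by linarith)]; simp
    · simp [hx]
  have h3 := h1.sub h2
  have hint : ∀ s : ℝ, s = 1 ∨ s = -1 →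
      Integrable (A.indicator (fun x : Fin n → ℝ => max (s * x i) 0)) (gaussianPi n) := by
    intro s _
    exact ((((memLp_coord i).integrable (by norm_num)).const_mul s).sup (integrable_const 0)).indicator hA
  rw [← integral_sub (hint 1 (Or.inl rfl)) (hint (-1) (Or.inr rfl))] at h3
  simp_rw [heq] at h3
  refine h3.congr fun M => ?_
  rw [← integral_pnu hm1, ← integral_sub (integrable_pnu (hm 1)) (integrable_pnu (hm (-1)))]
  simp_rw [heq]

lemma Ex_indicator {n M : ℕ} {A : Set (Fin n → ℝ)} (hA : MeasurableSet A) :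
    Ex (fun z : Fin n × Fin M → Bool => A.indicator 1 (X z)) = (pnu n M).real A := by
  rw [← integral_pnu (measurable_one.indicator hA), integral_indicator_one hA]

theorem transfer {n : ℕ} {A B : Set (Fin n → ℝ)} (hA : MeasurableSet A) (hB : MeasurableSet B)
    (iA : IsUpperSet A) (iB : IsUpperSet B) :
    1 / 400 * ((∑ i, inf A i * inf B i) / Real.log (Real.exp 1 / ∑ i, inf A i * inf B i)) ≤
      (gaussianPi n).real (A ∩ B) - (gaussianPi n).real A * (gaussianPi n).real B := by
  set S := ∑ i, inf A i * inf B i with hS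
  let SM : ℕ → ℝ := fun M => ∑ i, Ex (fun z : Fin n × Fin M → Bool => X z i * A.indicator 1 (X z)) *
        Ex (fun z : Fin n × Fin M → Bool => X z i * B.indicator 1 (X z))
  have hlim : Tendsto SM atTop (nhds S) :=
    tendsto_finsetSum _ fun i _ =>
      (tendsto_coord hA iA.null_frontier i).mul (tendsto_coord hB iB.null_frontier i)
  let CM : ℕ → ℝ := fun M => (pnu n M).real (A ∩ B) - (pnu n M).real A * (pnu n M).real B
  have hC : Tendsto CM atTop
      (nhds ((gaussianPi n).real (A ∩ B) - (gaussianPi n).real A * (gaussianPi n).real B)) :=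
    (tendsto_set (null_frontier_inter iA.null_frontier iB.null_frontier)).sub
      ((tendsto_set iA.null_frontier).mul (tendsto_set iB.null_frontier))
  have hmono : ∀ (M : ℕ) {A : Set (Fin n → ℝ)}, IsUpperSet A →
      Monotone (fun z : Fin n × Fin M → Bool => A.indicator (1 : (Fin n → ℝ) → ℝ) (X z)) := by
    intro M A iA z w hzw
    by_cases h : X z ∈ A
    · simp [h, iA (X_mono hzw) h]
    · simp only [Set.indicator_of_notMem h]
      exact Set.indicator_nonneg (fun _ _ => zero_le_one) _
  have h0 : ∀ (M : ℕ) (A : Set (Fin n → ℝ)) (z : Fin n × Fin M → Bool),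
      0 ≤ A.indicator (1 : (Fin n → ℝ) → ℝ) (X z) := fun M A z =>
    Set.indicator_nonneg (fun _ _ => zero_le_one) _
  have h1 : ∀ (M : ℕ) (A : Set (Fin n → ℝ)) (z : Fin n × Fin M → Bool),
      A.indicator (1 : (Fin n → ℝ) → ℝ) (X z) ≤ 1 := fun M A z =>
    Set.indicator_le_self' (fun _ _ => zero_le_one) _
  have hCM : ∀ M, CM M = Ex (fun z : Fin n × Fin M → Bool =>
      A.indicator (1 : (Fin n → ℝ) → ℝ) (X z) * B.indicator (1 : (Fin n → ℝ) → ℝ) (X z)) -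
      Ex (fun z : Fin n × Fin M → Bool => A.indicator (1 : (Fin n → ℝ) → ℝ) (X z)) *
      Ex (fun z : Fin n × Fin M → Bool => B.indicator (1 : (Fin n → ℝ) → ℝ) (X z)) := by
    intro M
    rw [Ex_indicator hA, Ex_indicator hB]
    simp only [CM]
    rw [← Ex_indicator (hA.inter hB)]
    congr 2 with z
    rw [Set.inter_indicator_one]
    rfl
  have hSM : ∀ M, 0 < M → SM M = ∑ p : Fin n × Fin M,
      co (fun z : Fin n × Fin M → Bool => A.indicator (1 : (Fin n → ℝ) → ℝ) (X z)) p *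
        co (fun z : Fin n × Fin M → Bool => B.indicator (1 : (Fin n → ℝ) → ℝ) (X z)) p :=
    fun M hM => (sum_co_X hM _ _).symm
  have hS0 : 0 ≤ S := ge_of_tendsto hlim <| by
    filter_upwards [eventually_gt_atTop 0] with M hM
    rw [hSM M hM]
    exact Finset.sum_nonneg fun p _ => mul_nonneg (co_nonneg (hmono M iA) p) (co_nonneg (hmono M iB) p)
  have hS1 : S ≤ 1 / 2 := le_of_tendsto hlim <| by
    filter_upwards [eventually_gt_atTop 0] with M hM
    rw [hSM M hM]
    exact S_le (h0 M A) (h1 M A) (h0 M B) (h1 M B)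
  rcases hS0.eq_or_lt with h | hpos
  · rw [← h]
    simp only [zero_div, mul_zero]
    refine ge_of_tendsto hC (Eventually.of_forall fun M => ?_)
    rw [hCM]
    exact harris (hmono M iA) (hmono M iB)
  · have hl64 : 0 < Real.log (64 / S) := Real.log_pos (by rw [lt_div_iff₀ hpos]; linarith)
    have key : S / (80 * Real.log (64 / S)) ≤
        (gaussianPi n).real (A ∩ B) - (gaussianPi n).real A * (gaussianPi n).real B := by
      have hl : Tendsto (fun M => SM M / (80 * Real.log (64 / SM M))) atTop
          (nhds (S / (80 * Real.log (64 / S)))) := by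
        refine hlim.div (Tendsto.const_mul _ ((tendsto_const_nhds.div hlim hpos.ne').log ?_)) ?_
        · positivity
        · positivity
      refine le_of_tendsto_of_tendsto hl hC ?_
      filter_upwards [eventually_gt_atTop 0, hlim.eventually (lt_mem_nhds hpos)] with M hM hp
      rw [hCM, hSM M hM]
      rw [hSM M hM] at hp
      exact cube_talagrand (hmono M iA) (hmono M iB) (h0 M A) (h1 M A) (h0 M B) (h1 M B) hp
    refine le_trans ?_ key
    have hlS : Real.log S ≤ 0 := Real.log_nonpos hS0 (by linarith)
    have e1 : Real.log (Real.exp 1 / S) = 1 - Real.log S := by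
      rw [Real.log_div (Real.exp_pos 1).ne' hpos.ne', Real.log_exp]
    have e2 : Real.log (64 / S) ≤ 5 - Real.log S := by
      rw [Real.log_div (by norm_num) hpos.ne']
      have : Real.log 64 = 6 * Real.log 2 := by
        rw [show (64 : ℝ) = 2 ^ 6 by norm_num, Real.log_pow]; norm_num
      have := Real.log_two_lt_d9
      linarith
    rw [e1, one_div_mul_eq_div, div_div]
    refine div_le_div_of_nonneg_left hS0 (by positivity) ?_
    linarith

end
end Cube

namespace Cube

noncomputable section

instance : NullSingletonClass _root_.stdGaussian := by
  unfold _root_.stdGaussian; exact nullSingletonClass_gaussianReal one_ne_zero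

lemma pdf_cont : Continuous (gaussianPDFReal 0 1) := by
  unfold gaussianPDFReal; fun_prop

lemma pdf_deriv (y : ℝ) : HasDerivAt (fun y => -gaussianPDFReal 0 1 y) (gaussianPDFReal 0 1 y * y) y := by
  unfold gaussianPDFReal
  have h : HasDerivAt (fun y : ℝ => -(y - 0) ^ 2 / (2 * ((1 : NNReal) : ℝ))) (-y) y := by
    have := (((hasDerivAt_id' y).sub_const 0).pow 2).neg.div_const (2 * ((1 : NNReal) : ℝ))
    refine this.congr_deriv ?_
    simp
    ring
  have := ((h.exp).const_mul ((√(2 * Real.pi * ((1 : NNReal) : ℝ)))⁻¹)).neg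
  refine this.congr_deriv ?_
  ring

lemma pdf_tendsto : Tendsto (fun y => -gaussianPDFReal 0 1 y) atTop (nhds 0) := by
  rw [← neg_zero]
  refine Tendsto.neg ?_
  unfold gaussianPDFReal
  rw [← mul_zero ((√(2 * Real.pi * ((1 : NNReal) : ℝ)))⁻¹)]
  refine Tendsto.const_mul _ (Real.tendsto_exp_atBot.comp ?_)
  simp only [NNReal.coe_one, mul_one]
  have : Tendsto (fun x : ℝ => x ^ 2 / 2) atTop atTop :=
    (tendsto_pow_atTop two_ne_zero).atTop_div_const two_pos
  refine (tendsto_neg_atTop_atBot.comp this).congr fun x => ?_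
  simp [neg_div]

lemma integrable_id_std : Integrable (fun y : ℝ => y) _root_.stdGaussian := by
  have h := (memLp_id_gaussianReal (μ := 0) (v := 1) 1)
  exact memLp_one_iff_integrable.1 h

lemma integrable_pdf_mul : Integrable (fun y => gaussianPDFReal 0 1 y * y) := by
  have h := integrable_id_std
  rw [_root_.stdGaussian, gaussianReal_of_var_ne_zero 0 one_ne_zero,
    integrable_withDensity_iff_integrable_smul' (measurable_gaussianPDF 0 1)
      (Eventually.of_forall fun x => gaussianPDF_lt_top)] at h
  simpa [toReal_gaussianPDF] using h

lemma integral_Ioi_std (t : ℝ) :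
    ∫ y, y * (Set.Ioi t).indicator 1 y ∂_root_.stdGaussian = gaussianPDFReal 0 1 t := by
  rw [_root_.stdGaussian, integral_gaussianReal_eq_integral_smul one_ne_zero]
  have : ∀ y : ℝ, gaussianPDFReal 0 1 y • (y * (Set.Ioi t).indicator 1 y) =
      (Set.Ioi t).indicator (fun y => gaussianPDFReal 0 1 y * y) y := by
    intro y
    by_cases h : y ∈ Set.Ioi t
    · simp only [Set.indicator_of_mem h]; simp
    · simp only [Set.indicator_of_notMem h]; simp
  simp_rw [this]
  rw [integral_indicator measurableSet_Ioi,
    integral_Ioi_of_hasDerivAt_of_tendsto' (fun x _ => pdf_deriv x) integrable_pdf_mul.integrableOn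
      pdf_tendsto]
  simp

lemma std_diff (t r : ℝ) (hr : 0 < r) :
    (_root_.stdGaussian (Set.Ioi (t - r))).toReal - (_root_.stdGaussian (Set.Ioi t)).toReal =
      ∫ y in (t - r)..t, gaussianPDFReal 0 1 y := by
  have h1 : Set.Ioi (t - r) = Set.Ioc (t - r) t ∪ Set.Ioi t :=
    (Set.Ioc_union_Ioi_eq_Ioi (by linarith)).symm
  rw [h1, measure_union (Set.Ioc_disjoint_Ioi le_rfl) measurableSet_Ioi,
    ENNReal.toReal_add (measure_ne_top _ _) (measure_ne_top _ _), add_sub_cancel_right,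
    intervalIntegral.integral_of_le (by linarith), _root_.stdGaussian,
    gaussianReal_apply_eq_integral 0 one_ne_zero, ENNReal.toReal_ofReal]
  exact integral_nonneg fun _ => gaussianPDFReal_nonneg _ _ _

lemma tendsto_quot (t : ℝ) : Tendsto (fun r : ℝ => ((_root_.stdGaussian (Set.Ioi (t - r))).toReal -
    (_root_.stdGaussian (Set.Ioi t)).toReal) / r) (nhdsWithin 0 (Set.Ioi 0))
    (nhds (gaussianPDFReal 0 1 t)) := by
  have hd : HasDerivAt (fun s => ∫ y in s..t, gaussianPDFReal 0 1 y) (-gaussianPDFReal 0 1 t) t :=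
    intervalIntegral.integral_hasDerivAt_left (pdf_cont.intervalIntegrable _ _)
      pdf_cont.stronglyMeasurable.stronglyMeasurableAtFilter pdf_cont.continuousAt
  have hd2 : HasDerivAt (fun r => ∫ y in (t - r)..t, gaussianPDFReal 0 1 y)
      (gaussianPDFReal 0 1 t) 0 := by
    have h0 : HasDerivAt (fun r : ℝ => t - r) (-1) 0 := by
      simpa using (hasDerivAt_id (0 : ℝ)).const_sub t
    have := HasDerivAt.comp (h₂ := fun s => ∫ y in s..t, gaussianPDFReal 0 1 y) (0 : ℝ)
      (by simpa using hd) h0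
    simpa [Function.comp_def] using this
  have h3 := (hasDerivAt_iff_tendsto_slope.1 hd2).mono_left
    (nhdsWithin_mono 0 (show Set.Ioi (0 : ℝ) ⊆ {0}ᶜ from fun x hx => ne_of_gt hx))
  refine h3.congr' ?_
  filter_upwards [self_mem_nhdsWithin] with r hr
  rw [std_diff t r hr, slope_def_field]
  simp

lemma minkContent_upper {S : Set ℝ} (hS : IsUpperSet S) :
    minkContent S = ∫ y, y * S.indicator 1 y ∂_root_.stdGaussian := by
  have hneb : (nhdsWithin (0 : ℝ) (Set.Ioi 0)).NeBot := inferInstance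
  rcases S.eq_empty_or_nonempty with rfl | hne
  · simp [minkContent]
  by_cases hu : S = Set.univ
  · subst hu
    have h1 : ∀ r : ℝ, r ∈ Set.Ioi (0 : ℝ) → ((_root_.stdGaussian (Set.univ + Set.Icc (-r) r)).toReal -
        (_root_.stdGaussian Set.univ).toReal) / r = 0 := by
      intro r hr
      have h0 : (0 : ℝ) < r := hr
      have : (Set.univ : Set ℝ) + Set.Icc (-r) r = Set.univ := by
        ext y
        simp only [Set.mem_univ, iff_true]
        exact Set.mem_add.2 ⟨y, trivial, 0, ⟨by linarith, by linarith⟩, by ring⟩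
      rw [this]
      simp
    have h2 : minkContent Set.univ = 0 := by
      refine Tendsto.liminf_eq ((tendsto_const_nhds (x := (0 : ℝ))).congr' ?_)
      filter_upwards [self_mem_nhdsWithin] with r hr
      exact (h1 r hr).symm
    rw [h2]
    simp [_root_.stdGaussian, integral_id_gaussianReal]
  · have hbdd : BddBelow S := by
      obtain ⟨a, ha⟩ := (Set.ne_univ_iff_exists_notMem S).1 hu
      exact ⟨a, fun s hs => le_of_not_ge fun h => ha (hS h hs)⟩
    set t := sInf S with ht
    have hsub1 : Set.Ioi t ⊆ S := fun y hy => by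
      obtain ⟨s, hs, hsy⟩ := exists_lt_of_csInf_lt hne hy
      exact hS hsy.le hs
    have hsub2 : S ⊆ Set.Ici t := fun y hy => csInf_le hbdd hy
    have hmeas : ∀ (S : Set ℝ) (t : ℝ), Set.Ioi t ⊆ S → S ⊆ Set.Ici t →
        _root_.stdGaussian S = _root_.stdGaussian (Set.Ioi t) := fun S t h1 h2 =>
      le_antisymm ((measure_mono h2).trans (measure_congr Ioi_ae_eq_Ici).ge) (measure_mono h1)
    have hint : ∫ y, y * S.indicator 1 y ∂_root_.stdGaussian = gaussianPDFReal 0 1 t := by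
      rw [← integral_Ioi_std]
      refine integral_congr_ae ?_
      have : ∀ᵐ y ∂_root_.stdGaussian, y ≠ t := by
        rw [ae_iff]; simp
      filter_upwards [this] with y hy
      have : y ∈ S ↔ y ∈ Set.Ioi t :=
        ⟨fun h => lt_of_le_of_ne (hsub2 h) hy.symm, fun h => hsub1 h⟩
      by_cases h : y ∈ S
      · rw [Set.indicator_of_mem h, Set.indicator_of_mem (this.1 h)]
      · rw [Set.indicator_of_notMem h, Set.indicator_of_notMem (fun h' => h (this.2 h'))]
    rw [hint]
    refine Tendsto.liminf_eq ((tendsto_quot t).congr' ?_)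
    filter_upwards [self_mem_nhdsWithin] with r hr
    have h0 : (0 : ℝ) < r := hr
    rw [hmeas S t hsub1 hsub2, hmeas (S + Set.Icc (-r) r) (t - r)]
    · intro y hy
      refine Set.mem_add.2 ⟨y + r, hsub1 ?_, -r, ⟨le_rfl, by linarith⟩, by ring⟩
      have : t - r < y := hy
      show t < y + r
      linarith
    · intro y hy
      obtain ⟨a, ha, b, hb, rfl⟩ := Set.mem_add.1 hy
      have := hsub2 ha
      have h3 : t ≤ a := this
      have h4 := hb.1
      show t - r ≤ a + b
      linarith

lemma mp_update {n : ℕ} (i : Fin n) :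
    MeasurePreserving (fun p : (Fin n → ℝ) × ℝ => Function.update p.1 i p.2)
      ((gaussianPi n).prod _root_.stdGaussian) (gaussianPi n) := by
  refine ⟨measurable_update', ?_⟩
  symm
  refine Measure.pi_eq fun s hs => ?_
  rw [Measure.map_apply measurable_update' (MeasurableSet.univ_pi hs)]
  have : (fun p : (Fin n → ℝ) × ℝ => Function.update p.1 i p.2) ⁻¹' (Set.univ.pi s) =
      (Set.univ.pi (Function.update s i Set.univ)) ×ˢ (s i) := by
    ext ⟨x, y⟩
    simp only [Set.mem_preimage, Set.mem_univ_pi, Set.mem_prod]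
    constructor
    · intro h
      refine ⟨fun j => ?_, by simpa using h i⟩
      by_cases hj : j = i
      · subst hj; simp
      · simpa [hj] using h j
    · rintro ⟨h1, h2⟩ j
      by_cases hj : j = i
      · subst hj; simpa using h2
      · simpa [hj] using h1 j
  rw [this, Measure.prod_prod, gaussianPi, Measure.pi_pi]
  rw [← Finset.mul_prod_erase Finset.univ (fun j => _root_.stdGaussian (s j)) (Finset.mem_univ i),
    ← Finset.mul_prod_erase Finset.univ
      (fun j => _root_.stdGaussian (Function.update s i Set.univ j)) (Finset.mem_univ i)]
  simp only [Function.update_self, measure_univ, one_mul]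
  rw [mul_comm]
  congr 1
  refine Finset.prod_congr rfl fun j hj => ?_
  rw [Function.update_of_ne (Finset.ne_of_mem_erase hj)]

lemma geomInfluence_eq {n : ℕ} {A : Set (Fin n → ℝ)} (hA : MeasurableSet A) (iA : IsUpperSet A)
    (i : Fin n) : geomInfluence A i = inf A i := by
  have hf : ∀ x, minkContent (fiber A i x) =
      ∫ y, (Function.update x i y) i * A.indicator 1 (Function.update x i y) ∂_root_.stdGaussian := by
    intro x
    rw [minkContent_upper]
    · simp only [Function.update_self]
      rfl
    · intro a b hab ha
      exact iA (update_le_update_iff.2 ⟨hab, fun _ _ => le_rfl⟩) ha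
  have hm1 : Measurable (fun x : Fin n → ℝ => x i * A.indicator 1 x) :=
    (measurable_pi_apply i).mul (measurable_one.indicator hA)
  have hi : Integrable (fun x : Fin n → ℝ => x i * A.indicator 1 x) (gaussianPi n) := by
    refine ((memLp_coord i).integrable (by norm_num)).mono hm1.aestronglyMeasurable
      (Eventually.of_forall fun x => ?_)
    by_cases h : x ∈ A <;> simp [h]
  unfold geomInfluence
  simp_rw [hf]
  have h2 : inf A i = ∫ p : (Fin n → ℝ) × ℝ, Function.update p.1 i p.2 i *
      A.indicator 1 (Function.update p.1 i p.2) ∂((gaussianPi n).prod _root_.stdGaussian) := by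
    rw [inf]
    conv_lhs => rw [← (mp_update i).map_eq]
    rw [integral_map (mp_update i).aemeasurable hm1.aestronglyMeasurable]
  rw [h2, integral_prod]
  exact (mp_update i).integrable_comp_of_integrable hi

end
end Cube

/-- **Theorem (Gaussian Talagrand correlation bound).**
There is a universal constant `c > 0` such that for every `n` and every pair of increasing
Borel sets `A, B ⊆ ℝⁿ`,
`μ⊗ⁿ(A ∩ B) − μ⊗ⁿ(A)·μ⊗ⁿ(B) ≥ c·φ(∑ i, I_i^G(A)·I_i^G(B))` where `φ(x) = x / log(e/x)`. -/
theorem gaussian_talagrand_correlation :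
    ∃ c : ℝ, 0 < c ∧
      ∀ (n : ℕ) (A B : Set (Fin n → ℝ)),
        MeasurableSet A → MeasurableSet B → IncreasingSet A → IncreasingSet B →
        (gaussianPi n (A ∩ B)).toReal - (gaussianPi n A).toReal * (gaussianPi n B).toReal ≥
          c * ((∑ i, geomInfluence A i * geomInfluence B i) /
            Real.log (Real.exp 1 / ∑ i, geomInfluence A i * geomInfluence B i)) := by
  refine ⟨1 / 400, by norm_num, fun n A B hA hB iA iB => ?_⟩
  have jA : IsUpperSet A := fun x y hxy hx => iA hxy hx
  have jB : IsUpperSet B := fun x y hxy hx => iB hxy hx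
  simp_rw [Cube.geomInfluence_eq hA jA, Cube.geomInfluence_eq hB jB]
  exact Cube.transfer hA hB jA jB
end

section
/- There exists a universal constant c > 0 such that for every n ∈ ℕ and every pair of increasing Borel sets A, B ⊆ ℝ^n, one has μ^{⊗n}(A ∩ B) − μ^{⊗n}(A)·μ^{⊗n}(B) ≥ c·∑_{i=1}^n [I_i^G(A)·I_i^G(B)] / √(log(e/I_i^G(A))·log(e/I_i^G(B))). -/
open MeasureTheory ProbabilityTheory Filter Pointwise

namespace GT

open scoped ENNReal NNReal Topology

instance : IsProbabilityMeasure _root_.stdGaussian := by unfold _root_.stdGaussian; infer_instance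

instance (n : ℕ) : IsProbabilityMeasure (gaussianPi n) := by unfold gaussianPi; infer_instance

/-- Standard Gaussian density. -/
noncomputable def phi (x : ℝ) : ℝ := (√(2 * Real.pi))⁻¹ * Real.exp (-(x ^ 2) / 2)

lemma phi_eq : gaussianPDFReal 0 1 = phi := by
  ext x; simp [gaussianPDFReal, phi]

lemma phi_pos (x : ℝ) : 0 < phi x := by unfold phi; positivity

lemma continuous_phi : Continuous phi := by unfold phi; fun_prop

lemma integrable_phi : Integrable phi := by rw [← phi_eq]; exact integrable_gaussianPDFReal 0 1

lemma hasDerivAt_phi (x : ℝ) : HasDerivAt phi (-x * phi x) x := by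
  have h : HasDerivAt (fun x : ℝ => -(x ^ 2) / 2) (-x) x :=
    (((hasDerivAt_pow 2 x).neg).div_const 2).congr_deriv (by simp; ring)
  exact ((h.exp).const_mul (√(2 * Real.pi))⁻¹).congr_deriv (by unfold phi; ring)

lemma lintegral_std (f : ℝ → ℝ≥0∞) (hf : Measurable f) :
    ∫⁻ x, f x ∂_root_.stdGaussian = ∫⁻ x, ENNReal.ofReal (phi x) * f x := by
  unfold _root_.stdGaussian
  rw [gaussianReal_of_var_ne_zero 0 one_ne_zero,
    lintegral_withDensity_eq_lintegral_mul _ (measurable_gaussianPDF 0 1) hf]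
  simp [gaussianPDF, phi_eq]

lemma integral_std (f : ℝ → ℝ) :
    ∫ x, f x ∂_root_.stdGaussian = ∫ x, phi x * f x := by
  unfold _root_.stdGaussian
  rw [integral_gaussianReal_eq_integral_smul one_ne_zero]
  simp [phi_eq]

/-- correlated Gaussian pair -/
noncomputable def bgauss (r : ℝ) : Measure (ℝ × ℝ) :=
  (_root_.stdGaussian.prod _root_.stdGaussian).map (fun z => (z.1, r * z.1 + √(1 - r ^ 2) * z.2))

lemma meas_aux (r : ℝ) :
    Measurable (fun z : ℝ × ℝ => (z.1, r * z.1 + √(1 - r ^ 2) * z.2)) := by fun_prop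

instance (r : ℝ) : IsProbabilityMeasure (bgauss r) := by
  unfold bgauss; exact Measure.isProbabilityMeasure_map (meas_aux r).aemeasurable

lemma bgauss_zero : bgauss 0 = _root_.stdGaussian.prod _root_.stdGaussian := by
  simp [bgauss]

/-- its density -/
noncomputable def bpdf (r x y : ℝ) : ℝ :=
  (2 * Real.pi * √(1 - r ^ 2))⁻¹ * Real.exp (-(x ^ 2 - 2 * r * x * y + y ^ 2) / (2 * (1 - r ^ 2)))

lemma bpdf_symm (r x y : ℝ) : bpdf r x y = bpdf r y x := by
  unfold bpdf; congr 3; ring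

lemma measurable_bpdf (r : ℝ) : Measurable (fun z : ℝ × ℝ => bpdf r z.1 z.2) := by
  unfold bpdf; fun_prop

lemma bpdf_pos {r : ℝ} (hr : r ^ 2 < 1) (x y : ℝ) : 0 < bpdf r x y := by
  have : 0 < √(1 - r ^ 2) := Real.sqrt_pos.2 (by linarith)
  unfold bpdf; positivity

lemma bpdf_eq {r : ℝ} (hr : r ^ 2 < 1) (x y : ℝ) :
    bpdf r x y = phi x * gaussianPDFReal (r * x) (1 - r ^ 2).toNNReal y := by
  have h0 : 0 < 1 - r ^ 2 := by linarith
  unfold bpdf phi gaussianPDFReal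
  rw [Real.coe_toNNReal _ h0.le]
  rw [show ∀ a b c d : ℝ, a * b * (c * d) = (a * c) * (b * d) by intros; ring, ← Real.exp_add]
  congr 1
  · rw [Real.sqrt_mul (by positivity) (1 - r ^ 2), ← mul_inv, ← mul_assoc,
      Real.mul_self_sqrt (by positivity)]
  · congr 1; field_simp; ring

lemma lintegral_bgauss {r : ℝ} (hr : r ^ 2 < 1) (f : ℝ × ℝ → ℝ≥0∞) (hf : Measurable f) :
    ∫⁻ z, f z ∂bgauss r = ∫⁻ x, ∫⁻ y, ENNReal.ofReal (bpdf r x y) * f (x, y) := by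
  have h0 : 0 < 1 - r ^ 2 := by linarith
  have hv : (1 - r ^ 2).toNNReal ≠ 0 := (Real.toNNReal_pos.2 h0).ne'
  unfold bgauss
  rw [lintegral_map hf (meas_aux r), lintegral_prod _ (by fun_prop), lintegral_std]
  swap
  · exact Measurable.lintegral_prod_right' (f := fun z : ℝ × ℝ =>
      f (z.1, r * z.1 + √(1 - r ^ 2) * z.2)) (by fun_prop)
  congr 1; ext x
  have hmap : _root_.stdGaussian.map (fun z => r * x + √(1 - r ^ 2) * z)
      = gaussianReal (r * x) (1 - r ^ 2).toNNReal := by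
    have h1 : _root_.stdGaussian.map (fun z => r * x + √(1 - r ^ 2) * z)
       = (_root_.stdGaussian.map (fun z => √(1 - r ^ 2) * z)).map (fun z => r * x + z) := by
      rw [Measure.map_map (by fun_prop) (by fun_prop)]; rfl
    rw [h1]; unfold _root_.stdGaussian
    rw [gaussianReal_map_const_mul, gaussianReal_map_const_add]
    congr 1
    · simp
    · ext; simp [Real.sq_sqrt h0.le, h0.le]
  have h2 : ∫⁻ z, f (x, r * x + √(1 - r ^ 2) * z) ∂_root_.stdGaussian
      = ∫⁻ y, f (x, y) ∂(gaussianReal (r * x) (1 - r ^ 2).toNNReal) := by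
    rw [← hmap, lintegral_map (by fun_prop) (by fun_prop)]
  simp only
  rw [h2, gaussianReal_of_var_ne_zero _ hv,
    lintegral_withDensity_eq_lintegral_mul _ (measurable_gaussianPDF _ _) (by fun_prop),
    ← lintegral_const_mul _ (by fun_prop)]
  congr 1; ext y
  simp only [Pi.mul_apply, gaussianPDF]
  rw [bpdf_eq hr, ENNReal.ofReal_mul (phi_pos x).le, mul_assoc]

lemma bgauss_swap {r : ℝ} (hr : r ^ 2 < 1) : (bgauss r).map Prod.swap = bgauss r := by
  refine Measure.ext_of_lintegral _ fun f hf => ?_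
  rw [lintegral_map hf measurable_swap, lintegral_bgauss hr (fun z => f z.swap) (hf.comp measurable_swap),
    lintegral_bgauss hr _ hf, lintegral_lintegral_swap]
  · simp only [Prod.swap_prod_mk, bpdf_symm r]
  · have := measurable_bpdf r
    exact ((this.ennreal_ofReal).mul (hf.comp measurable_swap)).aemeasurable

lemma bgauss_fst (r : ℝ) : (bgauss r).map Prod.fst = _root_.stdGaussian := by
  unfold bgauss
  rw [Measure.map_map measurable_fst (meas_aux r)]
  change (_root_.stdGaussian.prod _root_.stdGaussian).map Prod.fst = _
  rw [Measure.map_fst_prod]; simp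

lemma bgauss_snd {r : ℝ} (hr : r ^ 2 < 1) : (bgauss r).map Prod.snd = _root_.stdGaussian := by
  rw [← bgauss_fst r]
  conv_rhs => rw [← bgauss_swap hr]
  rw [Measure.map_map measurable_fst measurable_swap]; rfl

/-- Integrals of `h(x) + k(x) y`. -/
lemma integral_bgauss_lin (r : ℝ) (h k : ℝ → ℝ)
    (hh : Integrable h _root_.stdGaussian) (hk : Integrable k _root_.stdGaussian)
    (hkx : Integrable (fun x => k x * x) _root_.stdGaussian) :
    Integrable (fun z : ℝ × ℝ => h z.1 + k z.1 * z.2) (bgauss r) ∧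
    ∫ z, (h z.1 + k z.1 * z.2) ∂bgauss r =
      ∫ x, h x ∂_root_.stdGaussian + r * ∫ x, k x * x ∂_root_.stdGaussian := by
  have hid : Integrable (fun x : ℝ => x) _root_.stdGaussian := by
    have := (memLp_id_gaussianReal (μ := 0) (v := 1) 1).integrable (by simp)
    exact this
  have hid0 : ∫ x : ℝ, x ∂_root_.stdGaussian = 0 := integral_id_gaussianReal
  have e1 : (fun z : ℝ × ℝ => h z.1 + k z.1 * (r * z.1 + √(1 - r ^ 2) * z.2)) =
      fun z => (h z.1 + r * (k z.1 * z.1)) + √(1 - r ^ 2) * (k z.1 * z.2) := by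
    ext z; ring
  have i1 : Integrable (fun z : ℝ × ℝ => h z.1 + r * (k z.1 * z.1))
      (_root_.stdGaussian.prod _root_.stdGaussian) :=
    (hh.comp_fst _).add ((hkx.comp_fst _).const_mul r)
  have i2 : Integrable (fun z : ℝ × ℝ => k z.1 * z.2) (_root_.stdGaussian.prod _root_.stdGaussian) :=
    hk.mul_prod hid
  have aes : AEStronglyMeasurable (fun z : ℝ × ℝ => h z.1 + k z.1 * z.2) (bgauss r) := by
    have qf : Measure.QuasiMeasurePreserving Prod.fst (bgauss r) _root_.stdGaussian :=
      ⟨measurable_fst, by rw [bgauss_fst]⟩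
    exact (hh.aestronglyMeasurable.comp_quasiMeasurePreserving qf).add
      ((hk.aestronglyMeasurable.comp_quasiMeasurePreserving qf).mul
        measurable_snd.aestronglyMeasurable)
  constructor
  · unfold bgauss at *
    rw [integrable_map_measure aes (meas_aux r).aemeasurable]
    change Integrable (fun z : ℝ × ℝ => h z.1 + k z.1 * (r * z.1 + √(1 - r ^ 2) * z.2)) _
    rw [e1]; exact i1.add (i2.const_mul _)
  · unfold bgauss at *
    rw [integral_map (meas_aux r).aemeasurable aes]
    change ∫ z : ℝ × ℝ, h z.1 + k z.1 * (r * z.1 + √(1 - r ^ 2) * z.2)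
      ∂(_root_.stdGaussian.prod _root_.stdGaussian) = _
    rw [e1, integral_add i1 (i2.const_mul _), integral_const_mul,
      integral_prod_mul k (fun x => x), hid0,
      integral_add (hh.comp_fst _) ((hkx.comp_fst _).const_mul r), integral_const_mul,
      integral_fun_fst (μ := _root_.stdGaussian) (ν := _root_.stdGaussian) (f := h),
      integral_fun_fst (μ := _root_.stdGaussian) (ν := _root_.stdGaussian) (f := fun x => k x * x)]
    simp

end GT


namespace GT

open scoped ENNReal NNReal Topology

lemma integral_phi : ∫ x, phi x = 1 := by
  rw [← phi_eq]; exact integral_gaussianPDFReal_eq_one 0 one_ne_zero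

lemma exists_transport (f : ℝ → ℝ) (hf : Continuous f) (hpos : ∀ x, 0 < f x) (R : ℝ) (hR : 0 < R)
    (hout : ∀ x, R ≤ |x| → f x = 1) (hmean : ∫ x, phi x * f x = 1) :
    ∃ T T' : ℝ → ℝ, (∀ u, HasDerivAt T (T' u) u) ∧ Continuous T' ∧ (∀ u, 0 < T' u) ∧
      Function.Injective T ∧ Function.Surjective T ∧ (∀ u, R ≤ |u| → T u = u) ∧
      ∀ u, f (T u) * phi (T u) * T' u = phi u := by
  have hcont : Continuous (fun x => phi x * f x) := continuous_phi.mul hf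
  have hppos : ∀ x, 0 < phi x * f x := fun x => mul_pos (phi_pos x) (hpos x)
  have hphif : Integrable (fun x => phi x * f x) := by
    by_contra h; rw [integral_undef h] at hmean; norm_num at hmean
  set K : ℝ → ℝ := fun x => ∫ t in (-R)..x, phi t * f t with hK
  set Lf : ℝ → ℝ := fun x => ∫ t in (-R)..x, phi t with hL
  have dK : ∀ x, HasDerivAt K (phi x * f x) x := fun x =>
    intervalIntegral.integral_hasDerivAt_right (hcont.intervalIntegrable _ _)
      (hcont.stronglyMeasurableAtFilter _ _) hcont.continuousAt
  have dL : ∀ x, HasDerivAt Lf (phi x) x := fun x =>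
    intervalIntegral.integral_hasDerivAt_right (continuous_phi.intervalIntegrable _ _)
      (continuous_phi.stronglyMeasurableAtFilter _ _) continuous_phi.continuousAt
  have mK : StrictMono K := strictMono_of_hasDerivAt_pos dK hppos
  have mL : StrictMono Lf := strictMono_of_hasDerivAt_pos dL phi_pos
  have cK : Continuous K := continuous_iff_continuousAt.2 fun x => (dK x).continuousAt
  have cL : Continuous Lf := continuous_iff_continuousAt.2 fun x => (dL x).continuousAt
  have hKL : ∀ x, K x - Lf x = ∫ t in (-R)..x, phi t * (f t - 1) := by
    intro x
    rw [hK, hL]; simp only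
    rw [← intervalIntegral.integral_sub (hcont.intervalIntegrable _ _)
      (continuous_phi.intervalIntegrable _ _)]
    congr 1; ext t; ring
  have hzero : ∀ t, R ≤ |t| → phi t * (f t - 1) = 0 := by
    intro t ht; rw [hout t ht]; ring
  have hEq : ∀ x, R ≤ |x| → K x = Lf x := by
    intro x hx
    have : K x - Lf x = 0 := by
      rw [hKL]
      rcases le_abs'.1 hx with h | h
      · rw [intervalIntegral.integral_zero_ae]
        refine Filter.Eventually.of_forall fun t ht => hzero t ?_
        rw [Set.uIoc_of_ge h] at ht
        exact le_abs'.2 (Or.inl ht.2)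
      · rw [intervalIntegral.integral_of_le (by linarith),
          setIntegral_eq_integral_of_forall_compl_eq_zero]
        · have : (fun t => phi t * (f t - 1)) = fun t => phi t * f t - phi t := by ext t; ring
          rw [this, integral_sub hphif integrable_phi, hmean, integral_phi]; norm_num
        · intro t ht
          apply hzero
          rw [Set.mem_Ioc, not_and_or] at ht
          rw [le_abs']
          rcases ht with h1 | h1
          · left; linarith
          · right; linarith
    linarith
  have hnR : R ≤ |-R| := by rw [abs_neg]; exact le_abs_self R
  have hpR : R ≤ |R| := le_abs_self R
  have ex1 : ∀ u, ∃ v, K v = Lf u := by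
    intro u
    by_cases hu : R ≤ |u|
    · exact ⟨u, hEq u hu⟩
    · rw [not_le, abs_lt] at hu
      have := intermediate_value_Icc (show -R ≤ R by linarith) cK.continuousOn
      obtain ⟨v, -, hv⟩ := this (show Lf u ∈ Set.Icc (K (-R)) (K R) by
        rw [hEq _ hnR, hEq _ hpR]; exact ⟨mL.monotone hu.1.le, mL.monotone hu.2.le⟩)
      exact ⟨v, hv⟩
  have ex2 : ∀ v, ∃ u, K v = Lf u := by
    intro u
    by_cases hu : R ≤ |u|
    · exact ⟨u, hEq u hu⟩
    · rw [not_le, abs_lt] at hu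
      have := intermediate_value_Icc (show -R ≤ R by linarith) cL.continuousOn
      obtain ⟨v, -, hv⟩ := this (show K u ∈ Set.Icc (Lf (-R)) (Lf R) by
        rw [← hEq _ hnR, ← hEq _ hpR]; exact ⟨mK.monotone hu.1.le, mK.monotone hu.2.le⟩)
      exact ⟨v, hv.symm⟩
  choose T hT using ex1
  have mT : StrictMono T := by
    intro u v huv
    rw [← mK.lt_iff_lt, hT, hT]; exact mL huv
  have sT : Function.Surjective T := by
    intro v
    obtain ⟨u, hu⟩ := ex2 v
    exact ⟨u, mK.injective (by rw [hT, hu])⟩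
  have cT : Continuous T := mT.monotone.continuous_of_surjective sT
  refine ⟨T, fun u => phi u / (phi (T u) * f (T u)), ?_, ?_, ?_, mT.injective, sT, ?_, ?_⟩
  · intro u
    rw [hasDerivAt_iff_tendsto_slope]
    have h1 := (hasDerivAt_iff_tendsto_slope.1 (dL u))
    have h2 := (hasDerivAt_iff_tendsto_slope.1 (dK (T u)))
    have h3 : Tendsto T (𝓝[≠] u) (𝓝[≠] (T u)) :=
      tendsto_nhdsWithin_of_tendsto_nhds_of_eventually_within _
        (cT.continuousAt.tendsto.mono_left nhdsWithin_le_nhds)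
        (by filter_upwards [self_mem_nhdsWithin] with v hv
            exact fun h => hv (mT.injective h))
    refine (h1.div (h2.comp h3) (hppos _).ne').congr' ?_
    filter_upwards [self_mem_nhdsWithin] with v hv
    have hne : T v - T u ≠ 0 := sub_ne_zero.2 fun h => hv (mT.injective h)
    have hne2 : v - u ≠ 0 := sub_ne_zero.2 hv
    have hne3 : Lf v - Lf u ≠ 0 := sub_ne_zero.2 fun h => hv (mL.injective h)
    simp only [Function.comp, slope_def_field, Pi.div_apply, hT]
    field_simp
  · exact continuous_phi.div (hcont.comp cT) fun u => (hppos _).ne'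
  · intro u; exact div_pos (phi_pos u) (hppos _)
  · intro u hu; exact mK.injective (by rw [hT, hEq u hu])
  · intro u; have := (hppos (T u)).ne'; have h1 := phi_pos (T u); have h2 := hpos (T u); field_simp

lemma lintegral_comp_transport (T T' : ℝ → ℝ) (hd : ∀ u, HasDerivAt T (T' u) u)
    (hp : ∀ u, 0 < T' u) (hi : Function.Injective T) (hs : Function.Surjective T)
    (g : ℝ → ℝ≥0∞) : ∫⁻ x, g x = ∫⁻ u, ENNReal.ofReal (T' u) * g (T u) := by
  have := lintegral_image_eq_lintegral_abs_deriv_mul MeasurableSet.univ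
    (fun x _ => (hd x).hasDerivWithinAt) hi.injOn g
  rw [Set.image_univ, hs.range_eq] at this
  simpa [abs_of_pos (hp _)] using this

end GT


namespace GT

open scoped ENNReal NNReal Topology

lemma hcs_of (a : ℝ → ℝ) (R : ℝ) (h : ∀ u, R ≤ |u| → a u = 0) : HasCompactSupport a := by
  refine HasCompactSupport.intro (isCompact_Icc (a := -R) (b := R)) fun x hx => h x ?_
  by_contra hc
  rw [not_le, abs_lt] at hc
  exact hx ⟨hc.1.le, hc.2.le⟩

lemma one_side (r P R : ℝ) (hr : r ^ 2 < 1) (T T' : ℝ → ℝ) (hd : ∀ u, HasDerivAt T (T' u) u)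
    (hc : Continuous T') (h1 : ∀ u, R ≤ |u| → T u = u) (h2 : ∀ u, R ≤ |u| → T' u = 1) :
    Integrable (fun z : ℝ × ℝ => (P * (z.1 * (T z.1 - z.1)) - (P - 1) * (T' z.1 - 1)
      - z.1 * (T z.1 - z.1) / (1 - r ^ 2)) + r * (T z.1 - z.1) / (1 - r ^ 2) * z.2) (bgauss r) ∧
    ∫ z, ((P * (z.1 * (T z.1 - z.1)) - (P - 1) * (T' z.1 - 1)
      - z.1 * (T z.1 - z.1) / (1 - r ^ 2)) + r * (T z.1 - z.1) / (1 - r ^ 2) * z.2) ∂bgauss r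
      = 0 := by
  have cT : Continuous T := continuous_iff_continuousAt.2 fun x => (hd x).continuousAt
  have h0 : (1 - r ^ 2) ≠ 0 := by nlinarith
  have ia : ∀ (μ : Measure ℝ) [IsFiniteMeasureOnCompacts μ],
      Integrable (fun u => u * (T u - u)) μ := fun μ _ =>
    (by fun_prop : Continuous (fun u => u * (T u - u))).integrable_of_hasCompactSupport
      (hcs_of _ R fun u hu => by rw [h1 u hu]; ring)
  have ib : ∀ (μ : Measure ℝ) [IsFiniteMeasureOnCompacts μ],
      Integrable (fun u => (T' u - 1)) μ := fun μ _ =>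
    (by fun_prop : Continuous (fun u => (T' u - 1))).integrable_of_hasCompactSupport
      (hcs_of _ R fun u hu => by rw [h2 u hu]; ring)
  have ic : Integrable (fun u => (T u - u)) _root_.stdGaussian :=
    (by fun_prop : Continuous (fun u => (T u - u))).integrable_of_hasCompactSupport
      (hcs_of _ R fun u hu => by rw [h1 u hu]; ring)
  have ibp : ∫ u, u * (T u - u) ∂_root_.stdGaussian = ∫ u, (T' u - 1) ∂_root_.stdGaussian := by
    rw [integral_std, integral_std]
    have := integral_mul_deriv_eq_deriv_mul_of_integrable (u := fun u => T u - u)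
      (u' := fun u => T' u - 1) (v := phi) (v' := fun u => -u * phi u)
      (fun x _ => (hd x).sub (hasDerivAt_id x)) (fun x _ => hasDerivAt_phi x)
      ((by have := continuous_phi; fun_prop :
        Continuous ((fun u => T u - u) * fun u => -u * phi u)).integrable_of_hasCompactSupport
        (hcs_of _ R fun u hu => by simp [h1 u hu]))
      ((by have := continuous_phi; fun_prop :
        Continuous ((fun u => T' u - 1) * phi)).integrable_of_hasCompactSupport
        (hcs_of _ R fun u hu => by simp [h2 u hu]))
      ((by have := continuous_phi; fun_prop :
        Continuous ((fun u => T u - u) * phi)).integrable_of_hasCompactSupport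
        (hcs_of _ R fun u hu => by simp [h1 u hu]))
    have e : (fun u => phi u * (u * (T u - u))) = fun u => -((T u - u) * (-u * phi u)) := by
      ext u; ring
    rw [e, integral_neg, this, neg_neg]
    congr 1; ext u; ring
  have ih1 : Integrable (fun u => P * (u * (T u - u)) - (P - 1) * (T' u - 1))
      _root_.stdGaussian := ((ia _).const_mul P).sub ((ib _).const_mul (P - 1))
  have ih2 : Integrable (fun u => u * (T u - u) / (1 - r ^ 2)) _root_.stdGaussian :=
    (ia _).div_const _
  have ek : (fun u => r * (T u - u) / (1 - r ^ 2) * u) =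
      fun u => (r / (1 - r ^ 2)) * (u * (T u - u)) := by ext u; ring
  obtain ⟨H1, H2⟩ := integral_bgauss_lin r
    (fun u => P * (u * (T u - u)) - (P - 1) * (T' u - 1) - u * (T u - u) / (1 - r ^ 2))
    (fun u => r * (T u - u) / (1 - r ^ 2)) (ih1.sub ih2)
    ((ic.const_mul r).div_const _) (by rw [ek]; exact (ia _).const_mul _)
  refine ⟨H1, H2.trans ?_⟩
  rw [ek, integral_sub ih1 ih2,
    integral_sub ((ia _).const_mul P) ((ib _).const_mul (P - 1)), integral_const_mul,
    integral_const_mul, integral_div, integral_const_mul, ibp]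
  field_simp; ring

lemma pointwise_bound (r P Q : ℝ) (hr : r ^ 2 < 1) (hP : 1 ≤ P) (hQ : 1 ≤ Q)
    (hquad : ∀ a b : ℝ, (a ^ 2 - 2 * r * a * b + b ^ 2) / (1 - r ^ 2) ≤ P * a ^ 2 + Q * b ^ 2)
    (u v T S T' S' f g : ℝ) (hT' : 0 < T') (hS' : 0 < S') (hf : 0 < f) (hg : 0 < g)
    (h1 : f * phi T * T' = phi u) (h2 : g * phi S * S' = phi v) :
    bpdf r u v * (1 + (((P * (u * (T - u)) - (P - 1) * (T' - 1)
      - u * (T - u) / (1 - r ^ 2)) + r * (T - u) / (1 - r ^ 2) * v) +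
      ((Q * (v * (S - v)) - (Q - 1) * (S' - 1)
      - v * (S - v) / (1 - r ^ 2)) + r * (S - v) / (1 - r ^ 2) * u))) ≤
    T' * (S' * (bpdf r T S * (f ^ P * g ^ Q))) := by
  have h0 : 0 < (1 - r ^ 2) := by linarith
  have key : ∀ (u T T' f P : ℝ), 0 < T' → 0 < f → f * phi T * T' = phi u →
      T' * f ^ P = Real.exp (P * ((T ^ 2 - u ^ 2) / 2) - (P - 1) * Real.log T') := by
    intro u T T' f P hT' hf h1
    have e1 : Real.log f = (T ^ 2 - u ^ 2) / 2 - Real.log T' := by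
      have := congrArg Real.log h1
      rw [Real.log_mul (mul_pos hf (phi_pos T)).ne' hT'.ne', Real.log_mul hf.ne' (phi_pos T).ne']
        at this
      have el : ∀ x, Real.log (phi x) = Real.log (√(2 * Real.pi))⁻¹ + (-(x ^ 2) / 2) := by
        intro x; unfold phi
        rw [Real.log_mul (by positivity) (Real.exp_pos _).ne', Real.log_exp]
      rw [el, el] at this
      linarith
    rw [Real.rpow_def_of_pos hf, e1]
    nth_rewrite 1 [← Real.exp_log hT']
    rw [← Real.exp_add]; congr 1; ring
  have k1 := key u T T' f P hT' hf h1
  have k2 := key v S S' g Q hS' hg h2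
  rw [show T' * (S' * (bpdf r T S * (f ^ P * g ^ Q))) =
    bpdf r T S * ((T' * f ^ P) * (S' * g ^ Q)) by ring, k1, k2, ← Real.exp_add]
  unfold bpdf
  rw [mul_assoc (2 * Real.pi * √(1 - r ^ 2))⁻¹, mul_assoc (2 * Real.pi * √(1 - r ^ 2))⁻¹]
  refine mul_le_mul_of_nonneg_left ?_ (inv_nonneg.2 (by positivity))
  rw [← Real.exp_add]
  have l1 := Real.log_le_sub_one_of_pos hT'
  have l2 := Real.log_le_sub_one_of_pos hS'
  have q := hquad (T - u) (S - v)
  set B := -(u ^ 2 - 2 * r * u * v + v ^ 2) / (2 * (1 - r ^ 2)) with hB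
  set X := -(T ^ 2 - 2 * r * T * S + S ^ 2) / (2 * (1 - r ^ 2)) +
    (P * ((T ^ 2 - u ^ 2) / 2) - (P - 1) * Real.log T' +
      (Q * ((S ^ 2 - v ^ 2) / 2) - (Q - 1) * Real.log S')) with hX
  have hx : Real.exp X = Real.exp B * Real.exp (X - B) := by rw [← Real.exp_add]; congr 1; ring
  rw [hx]
  refine mul_le_mul_of_nonneg_left ?_ (Real.exp_pos _).le
  have hexp := Real.add_one_le_exp (X - B)
  have m1 := mul_le_mul_of_nonneg_left l1 (by linarith : 0 ≤ P - 1)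
  have m2 := mul_le_mul_of_nonneg_left l2 (by linarith : 0 ≤ Q - 1)
  refine le_trans ?_ hexp
  have hXB : X - B = P * (u * (T - u)) + Q * (v * (S - v)) - u * (T - u) / (1 - r ^ 2)
      + r * (T - u) / (1 - r ^ 2) * v - v * (S - v) / (1 - r ^ 2) + r * (S - v) / (1 - r ^ 2) * u
      - (P - 1) * Real.log T' - (Q - 1) * Real.log S'
      + (P * (T - u) ^ 2 + Q * (S - v) ^ 2 -
        ((T - u) ^ 2 - 2 * r * (T - u) * (S - v) + (S - v) ^ 2) / (1 - r ^ 2)) / 2 := by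
    rw [hX, hB]; field_simp; ring
  rw [hXB]; linarith

lemma rhc_core (r P Q R : ℝ) (hR : 0 < R) (hr : r ^ 2 < 1) (hP : 1 ≤ P) (hQ : 1 ≤ Q)
    (hquad : ∀ a b : ℝ, (a ^ 2 - 2 * r * a * b + b ^ 2) / (1 - r ^ 2) ≤ P * a ^ 2 + Q * b ^ 2)
    (f g : ℝ → ℝ) (hf : Continuous f) (hfp : ∀ x, 0 < f x) (hfo : ∀ x, R ≤ |x| → f x = 1)
    (hfm : ∫ x, phi x * f x = 1)
    (hg : Continuous g) (hgp : ∀ x, 0 < g x) (hgo : ∀ x, R ≤ |x| → g x = 1)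
    (hgm : ∫ x, phi x * g x = 1) :
    1 ≤ ∫⁻ z, ENNReal.ofReal (f z.1 ^ P * g z.2 ^ Q) ∂bgauss r := by
  obtain ⟨T, T', dT, cT', pT, iT, sT, oT, eT⟩ := exists_transport f hf hfp R hR hfo hfm
  obtain ⟨S, S', dS, cS', pS, iS, sS, oS, eS⟩ := exists_transport g hg hgp R hR hgo hgm
  have cT : Continuous T := continuous_iff_continuousAt.2 fun x => (dT x).continuousAt
  have cS : Continuous S := continuous_iff_continuousAt.2 fun x => (dS x).continuousAt
  have oT' : ∀ u, R ≤ |u| → T' u = 1 := by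
    intro u hu
    have := eT u
    rw [oT u hu, hfo u hu, one_mul] at this
    exact (mul_eq_left₀ (phi_pos u).ne').1 this
  have oS' : ∀ u, R ≤ |u| → S' u = 1 := by
    intro u hu
    have := eS u
    rw [oS u hu, hgo u hu, one_mul] at this
    exact (mul_eq_left₀ (phi_pos u).ne').1 this
  obtain ⟨iA, vA⟩ := one_side r P R hr T T' dT cT' oT oT'
  obtain ⟨iB, vB⟩ := one_side r Q R hr S S' dS cS' oS oS'
  set HA : ℝ × ℝ → ℝ := fun z => (P * (z.1 * (T z.1 - z.1)) - (P - 1) * (T' z.1 - 1)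
      - z.1 * (T z.1 - z.1) / (1 - r ^ 2)) + r * (T z.1 - z.1) / (1 - r ^ 2) * z.2 with hHA
  set HB : ℝ × ℝ → ℝ := fun z => (Q * (z.1 * (S z.1 - z.1)) - (Q - 1) * (S' z.1 - 1)
      - z.1 * (S z.1 - z.1) / (1 - r ^ 2)) + r * (S z.1 - z.1) / (1 - r ^ 2) * z.2 with hHB
  have cHA : Continuous HA := by rw [hHA]; fun_prop
  have cHB : Continuous HB := by rw [hHB]; fun_prop
  have iB' : Integrable (fun z : ℝ × ℝ => HB z.swap) (bgauss r) := by
    have h := iB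
    rw [← bgauss_swap hr, integrable_map_measure (by exact cHB.aestronglyMeasurable)
      measurable_swap.aemeasurable] at h
    exact h
  have vB' : ∫ z : ℝ × ℝ, HB z.swap ∂(bgauss r) = 0 := by
    have h := vB
    rw [← bgauss_swap hr, integral_map measurable_swap.aemeasurable
      (by exact cHB.aestronglyMeasurable)] at h
    exact h
  have i1 : Integrable (fun z : ℝ × ℝ => 1 + (HA z + HB z.swap)) (bgauss r) :=
    (integrable_const 1).add (iA.add iB')
  have v1 : ∫ z : ℝ × ℝ, (1 + (HA z + HB z.swap)) ∂(bgauss r) = 1 := by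
    rw [integral_add (f := fun _ => (1:ℝ)) (g := fun z : ℝ × ℝ => HA z + HB z.swap)
      (integrable_const 1) (iA.add iB'), integral_add iA iB', vA, vB']; simp
  have step1 : 1 ≤ ∫⁻ z, ENNReal.ofReal (1 + (HA z + HB z.swap)) ∂(bgauss r) := by
    have h2 := integral_mono i1 i1.pos_part (fun z => le_max_left _ 0)
    rw [v1, integral_eq_lintegral_of_nonneg_ae (f := fun z => max (1 + (HA z + HB z.swap)) 0) (Eventually.of_forall fun z => le_max_right _ _)
      i1.pos_part.aestronglyMeasurable] at h2
    have h3 := ENNReal.ofReal_le_of_le_toReal h2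
    simpa [ENNReal.ofReal_max] using h3
  refine step1.trans ?_
  have cG : Continuous (fun z : ℝ × ℝ => f z.1 ^ P * g z.2 ^ Q) :=
    ((hf.comp continuous_fst).rpow_const fun z => Or.inl (hfp _).ne').mul
      ((hg.comp continuous_snd).rpow_const fun z => Or.inl (hgp _).ne')
  rw [lintegral_bgauss hr _ (by fun_prop), lintegral_bgauss hr _ (by fun_prop),
    lintegral_comp_transport T T' dT pT iT sT (fun x => ∫⁻ y, ENNReal.ofReal (bpdf r x y) *
      ENNReal.ofReal (f (x, y).1 ^ P * g (x, y).2 ^ Q))]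
  refine lintegral_mono fun u => ?_
  rw [lintegral_comp_transport S S' dS pS iS sS (fun y => ENNReal.ofReal (bpdf r (T u) y) *
      ENNReal.ofReal (f (T u, y).1 ^ P * g (T u, y).2 ^ Q)), ← lintegral_const_mul']
  swap
  · exact ENNReal.ofReal_ne_top
  refine lintegral_mono fun v => ?_
  simp only
  rw [← ENNReal.ofReal_mul (bpdf_pos hr _ _).le, ← ENNReal.ofReal_mul (bpdf_pos hr _ _).le,
    ← ENNReal.ofReal_mul (pS _).le, ← ENNReal.ofReal_mul (pT _).le]
  exact ENNReal.ofReal_le_ofReal (pointwise_bound r P Q hr hP hQ hquad u v (T u) (S v) (T' u) (S' v)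
    (f (T u)) (g (S v)) (pT u) (pS v) (hfp _) (hgp _) (eT u) (eS v))

end GT


namespace GT

open scoped ENNReal NNReal Topology

lemma approx_cont (F : ℝ → ℝ) (hF : Measurable F) (h0 : ∀ x, 0 ≤ F x) (h1 : ∀ x, F x ≤ 1) :
    ∃ h : ℕ → ℝ → ℝ, (∀ k, Continuous (h k)) ∧ (∀ k x, 0 ≤ h k x) ∧ (∀ k x, h k x ≤ 1) ∧
      ∀ᵐ x ∂_root_.stdGaussian, Tendsto (fun k => h k x) atTop (𝓝 (F x)) := by
  have hm : MemLp F 1 _root_.stdGaussian := by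
    refine MemLp.of_bound hF.aestronglyMeasurable 1 (Eventually.of_forall fun x => ?_)
    rw [Real.norm_eq_abs, abs_of_nonneg (h0 x)]; exact h1 x
  have ex : ∀ k : ℕ, ∃ g : BoundedContinuousFunction ℝ ℝ,
      eLpNorm (F - (g : ℝ → ℝ)) 1 _root_.stdGaussian ≤ ((k : ℝ≥0∞) + 1)⁻¹ := fun k => by
    obtain ⟨g, hg, -⟩ := hm.exists_boundedContinuous_eLpNorm_sub_le (by simp)
      (ε := ((k : ℝ≥0∞) + 1)⁻¹) (by simp)
    exact ⟨g, hg⟩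
  choose g hg using ex
  have ht : TendstoInMeasure _root_.stdGaussian (fun k => (g k : ℝ → ℝ)) atTop F := by
    refine tendstoInMeasure_of_tendsto_eLpNorm one_ne_zero
      (fun k => (g k).continuous.aestronglyMeasurable) hF.aestronglyMeasurable ?_
    refine tendsto_of_tendsto_of_tendsto_of_le_of_le tendsto_const_nhds
      (h := fun k : ℕ => ((k : ℝ≥0∞) + 1)⁻¹) ?_ (fun k => by simp)
      (fun k => by rw [eLpNorm_sub_comm]; exact hg k)
    have := (tendsto_add_atTop_iff_nat (f := fun k : ℕ => (k : ℝ≥0∞)⁻¹) 1).2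
      ENNReal.tendsto_inv_nat_nhds_zero
    simpa using this
  obtain ⟨ns, -, hns⟩ := ht.exists_seq_tendsto_ae
  refine ⟨fun k x => max 0 (min 1 (g (ns k) x)), fun k => ?_, fun k x => le_max_left _ _,
    fun k x => max_le zero_le_one (min_le_left _ _), ?_⟩
  · have := (g (ns k)).continuous
    fun_prop
  · filter_upwards [hns] with x hx
    have : F x = max 0 (min 1 (F x)) := by rw [min_eq_right (h1 x), max_eq_right (h0 x)]
    rw [this]
    exact tendsto_const_nhds.max (tendsto_const_nhds.min hx)

lemma approx (F : ℝ → ℝ) (hF : Measurable F) (h0 : ∀ x, 0 ≤ F x) (h1 : ∀ x, F x ≤ 1) :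
    ∃ (f : ℕ → ℝ → ℝ) (c : ℕ → ℝ), (∀ k, Continuous (f k)) ∧ (∀ k x, 0 < f k x) ∧
      (∀ k x, f k x ≤ 2) ∧ (∀ k, 0 < c k) ∧ (∀ (k : ℕ) (x : ℝ), ((k : ℝ) + 1) ≤ |x| → f k x = c k) ∧
      (∀ k, ∫ x, phi x * f k x = c k) ∧
      ∀ᵐ x ∂_root_.stdGaussian, Tendsto (fun k => f k x) atTop (𝓝 (F x)) := by
  obtain ⟨h, hc, hh0, hh1, hlim⟩ := approx_cont F hF h0 h1
  set χ : ℕ → ℝ → ℝ := fun k x => max 0 (min 1 ((k : ℝ) + 1 - |x|)) with hχ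
  have cχ : ∀ k, Continuous (χ k) := fun k => by rw [hχ]; fun_prop
  have χ0 : ∀ k x, 0 ≤ χ k x := fun k x => le_max_left _ _
  have χ1 : ∀ k x, χ k x ≤ 1 := fun k x => max_le zero_le_one (min_le_left _ _)
  have χout : ∀ (k : ℕ) x, (k : ℝ) + 1 ≤ |x| → χ k x = 0 := fun k x hx => by
    rw [hχ]; simp only
    rw [max_eq_left]; exact (min_le_right _ _).trans (by linarith)
  set h' : ℕ → ℝ → ℝ := fun k x => h k x + 1 / ((k : ℝ) + 1) with hh'
  have ch' : ∀ k, Continuous (h' k) := fun k => (hc k).add continuous_const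
  have h'0 : ∀ k x, 0 < h' k x := fun k x => add_pos_of_nonneg_of_pos (hh0 k x) (by positivity)
  have h'2 : ∀ k x, h' k x ≤ 2 := fun k x => by
    have : 1 / ((k : ℝ) + 1) ≤ 1 := by
      rw [div_le_one (by positivity)]; linarith [(Nat.cast_nonneg k : (0:ℝ) ≤ k)]
    have h3 := hh1 k x
    simp only [hh']; linarith
  have iχ : ∀ k, Integrable (fun x => phi x * χ k x) := fun k =>
    (continuous_phi.mul (cχ k)).integrable_of_hasCompactSupport
      (hcs_of _ (k + 1) fun u hu => by simp [χout k u hu])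
  have iχh : ∀ k, Integrable (fun x => phi x * (χ k x * h' k x)) := fun k =>
    (continuous_phi.mul ((cχ k).mul (ch' k))).integrable_of_hasCompactSupport
      (hcs_of _ (k + 1) fun u hu => by simp [χout k u hu])
  have pos1 : ∀ k, 0 < ∫ x, phi x * χ k x := fun k => by
    refine (continuous_phi.mul (cχ k)).integral_pos_of_hasCompactSupport_nonneg_nonzero
      (x := 0) (hcs_of _ (k + 1) fun u hu => by simp [χout k u hu])
      (fun x => mul_nonneg (phi_pos x).le (χ0 k x)) ?_
    have : (0:ℝ) < k + 1 := by positivity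
    have : χ k 0 ≠ 0 := by
      simp only [hχ]; exact (lt_max_of_lt_right (lt_min one_pos (by simpa using this))).ne'
    exact mul_ne_zero (phi_pos 0).ne' this
  have pos2 : ∀ k, 0 < ∫ x, phi x * (χ k x * h' k x) := fun k => by
    refine (continuous_phi.mul ((cχ k).mul (ch' k))).integral_pos_of_hasCompactSupport_nonneg_nonzero
      (x := 0) (hcs_of _ (k + 1) fun u hu => by simp [χout k u hu])
      (fun x => mul_nonneg (phi_pos x).le (mul_nonneg (χ0 k x) (h'0 k x).le)) ?_
    have : (0:ℝ) < k + 1 := by positivity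
    have : χ k 0 ≠ 0 := by
      simp only [hχ]; exact (lt_max_of_lt_right (lt_min one_pos (by simpa using this))).ne'
    exact mul_ne_zero (phi_pos 0).ne' (mul_ne_zero this (h'0 k 0).ne')
  set c : ℕ → ℝ := fun k => (∫ x, phi x * (χ k x * h' k x)) / ∫ x, phi x * χ k x with hcdef
  have c0 : ∀ k, 0 < c k := fun k => div_pos (pos2 k) (pos1 k)
  have c2 : ∀ k, c k ≤ 2 := fun k => by
    simp only [hcdef]
    rw [div_le_iff₀ (pos1 k), ← integral_const_mul]
    refine integral_mono (iχh k) ((iχ k).const_mul 2) fun x => ?_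
    have := mul_le_mul_of_nonneg_left (h'2 k x) (mul_nonneg (phi_pos x).le (χ0 k x))
    simp only; linarith
  refine ⟨fun k x => χ k x * h' k x + (1 - χ k x) * c k, c, fun k => ?_, fun k x => ?_,
    fun k x => ?_, c0, fun k x hx => ?_, fun k => ?_, ?_⟩
  · have := cχ k; have := ch' k; fun_prop
  · have a1 := χ0 k x; have a2 := χ1 k x; have a3 := h'0 k x; have a4 := c0 k
    rcases a1.eq_or_lt with e | e
    · show 0 < χ k x * h' k x + (1 - χ k x) * c k
      rw [← e]; linarith
    · exact add_pos_of_pos_of_nonneg (mul_pos e a3) (mul_nonneg (by linarith) a4.le)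
  · have a1 := χ0 k x; have a2 := χ1 k x; have a3 := h'2 k x; have a4 := c2 k
    nlinarith
  · simp only [χout k x hx]; ring
  · have e : (fun x => phi x * (χ k x * h' k x + (1 - χ k x) * c k)) =
      fun x => phi x * (χ k x * h' k x) + (c k * phi x - c k * (phi x * χ k x)) := by
      ext x; ring
    have i3 : Integrable (fun x => c k * phi x - c k * (phi x * χ k x)) :=
      (integrable_phi.const_mul _).sub ((iχ k).const_mul _)
    rw [e, integral_add (iχh k) i3, integral_sub (integrable_phi.const_mul _) ((iχ k).const_mul _),
      integral_const_mul, integral_const_mul, integral_phi]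
    have : c k * ∫ x, phi x * χ k x = ∫ x, phi x * (χ k x * h' k x) := by
      simp only [hcdef]; rw [div_mul_cancel₀ _ (pos1 k).ne']
    rw [this]; ring
  · filter_upwards [hlim] with x hx
    have t1 : Tendsto (fun k => h' k x) atTop (𝓝 (F x)) := by
      have := hx.add tendsto_one_div_add_atTop_nhds_zero_nat
      simpa [hh'] using this
    refine t1.congr' ?_
    filter_upwards [eventually_ge_atTop ⌈|x|⌉₊] with k hk
    have : |x| ≤ k := (Nat.le_ceil _).trans (by exact_mod_cast hk)
    have : χ k x = 1 := by
      simp only [hχ]; rw [min_eq_left (by linarith), max_eq_right zero_le_one]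
    rw [this]; ring

lemma rhc_one (r P Q : ℝ) (hr : r ^ 2 < 1) (hP : 1 ≤ P) (hQ : 1 ≤ Q)
    (hquad : ∀ a b : ℝ, (a ^ 2 - 2 * r * a * b + b ^ 2) / (1 - r ^ 2) ≤ P * a ^ 2 + Q * b ^ 2)
    (F G : ℝ → ℝ≥0∞) (hF : Measurable F) (hG : Measurable G) (hF1 : ∀ x, F x ≤ 1)
    (hG1 : ∀ x, G x ≤ 1) :
    (∫⁻ x, F x ∂_root_.stdGaussian) ^ P * (∫⁻ x, G x ∂_root_.stdGaussian) ^ Q ≤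
      ∫⁻ z, F z.1 ^ P * G z.2 ^ Q ∂bgauss r := by
  have toR1 : ∀ {a : ℝ≥0∞}, a ≤ 1 → a.toReal ≤ 1 := fun h => by
    simpa using ENNReal.toReal_mono ENNReal.one_ne_top h
  have hFt : ∀ x, F x ≠ ∞ := fun x => ((hF1 x).trans_lt ENNReal.one_lt_top).ne
  have hGt : ∀ x, G x ≠ ∞ := fun x => ((hG1 x).trans_lt ENNReal.one_lt_top).ne
  obtain ⟨f, c, cf, fp, f2, cp, fo, fm, fl⟩ := approx (fun x => (F x).toReal) hF.ennreal_toReal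
    (fun x => ENNReal.toReal_nonneg) (fun x => toR1 (hF1 x))
  obtain ⟨g, d, cg, gp, g2, dp, go, gm, gl⟩ := approx (fun x => (G x).toReal) hG.ennreal_toReal
    (fun x => ENNReal.toReal_nonneg) (fun x => toR1 (hG1 x))
  have P0 : 0 ≤ P := by linarith
  have Q0 : 0 ≤ Q := by linarith
  have key : ∀ k, ENNReal.ofReal (c k ^ P * d k ^ Q) ≤
      ∫⁻ z, ENNReal.ofReal (f k z.1 ^ P * g k z.2 ^ Q) ∂bgauss r := by
    intro k
    have h := rhc_core r P Q (k + 1) (by positivity) hr hP hQ hquad (fun x => f k x / c k)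
      (fun x => g k x / d k) ((cf k).div_const _) (fun x => div_pos (fp k x) (cp k))
      (fun x hx => by rw [fo k x hx, div_self (cp k).ne'])
      (by simp_rw [mul_div_assoc']; rw [integral_div, fm k, div_self (cp k).ne'])
      ((cg k).div_const _) (fun x => div_pos (gp k x) (dp k))
      (fun x hx => by rw [go k x hx, div_self (dp k).ne'])
      (by simp_rw [mul_div_assoc']; rw [integral_div, gm k, div_self (dp k).ne'])
    have h2 := mul_le_mul_right h (ENNReal.ofReal (c k ^ P * d k ^ Q))
    rw [mul_one, ← lintegral_const_mul' _ _ ENNReal.ofReal_ne_top] at h2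
    refine h2.trans_eq ?_
    congr 1; ext z
    have c1 := Real.rpow_pos_of_pos (cp k) P
    have d1 := Real.rpow_pos_of_pos (dp k) Q
    rw [← ENNReal.ofReal_mul (mul_pos c1 d1).le]
    congr 1
    rw [Real.div_rpow (fp k _).le (cp k).le, Real.div_rpow (gp k _).le (dp k).le]
    field_simp
  have lc : ∀ (f : ℕ → ℝ → ℝ) (c : ℕ → ℝ) (F : ℝ → ℝ≥0∞), Measurable F → (∀ x, F x ≠ ∞) →
      (∀ k, Continuous (f k)) → (∀ k x, 0 < f k x) → (∀ k x, f k x ≤ 2) →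
      (∀ k, ∫ x, phi x * f k x = c k) →
      (∀ᵐ x ∂_root_.stdGaussian, Tendsto (fun k => f k x) atTop (𝓝 (F x).toReal)) →
      Tendsto (fun k => ENNReal.ofReal (c k)) atTop (𝓝 (∫⁻ x, F x ∂_root_.stdGaussian)) := by
    intro f c F hF hFt cf fp f2 fm fl
    have e : ∀ k, ENNReal.ofReal (c k) = ∫⁻ x, ENNReal.ofReal (f k x) ∂_root_.stdGaussian := by
      intro k
      rw [← fm k, ← integral_std, ofReal_integral_eq_lintegral_ofReal]
      · refine Integrable.of_bound (cf k).aestronglyMeasurable 2 (Eventually.of_forall fun x => ?_)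
        rw [Real.norm_eq_abs, abs_of_pos (fp k x)]; exact f2 k x
      · exact Eventually.of_forall fun x => (fp k x).le
    simp_rw [e]
    refine tendsto_lintegral_of_dominated_convergence (fun _ => ENNReal.ofReal 2)
      (fun k => (cf k).measurable.ennreal_ofReal)
      (fun k => Eventually.of_forall fun x => ENNReal.ofReal_le_ofReal (f2 k x)) (by simp) ?_
    filter_upwards [fl] with x hx
    have := ENNReal.tendsto_ofReal hx
    rwa [ENNReal.ofReal_toReal (hFt x)] at this
  have lcF := lc f c F hF hFt cf fp f2 fm fl
  have lcG := lc g d G hG hGt cg gp g2 gm gl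
  have IF : (∫⁻ x, F x ∂_root_.stdGaussian) ≠ ∞ := by
    refine ((lintegral_mono hF1).trans_lt ?_).ne; simp
  have IG : (∫⁻ x, G x ∂_root_.stdGaussian) ≠ ∞ := by
    refine ((lintegral_mono hG1).trans_lt ?_).ne; simp
  have L1 : Tendsto (fun k => ENNReal.ofReal (c k ^ P * d k ^ Q)) atTop
      (𝓝 ((∫⁻ x, F x ∂_root_.stdGaussian) ^ P * (∫⁻ x, G x ∂_root_.stdGaussian) ^ Q)) := by
    have e : ∀ k, ENNReal.ofReal (c k ^ P * d k ^ Q) =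
        ENNReal.ofReal (c k) ^ P * ENNReal.ofReal (d k) ^ Q := fun k => by
      rw [ENNReal.ofReal_mul (Real.rpow_nonneg (cp k).le _),
        ENNReal.ofReal_rpow_of_nonneg (cp k).le P0, ENNReal.ofReal_rpow_of_nonneg (dp k).le Q0]
    simp_rw [e]
    exact ENNReal.Tendsto.mul (lcF.ennrpow_const P)
      (Or.inr (ENNReal.rpow_ne_top_of_nonneg Q0 IG)) (lcG.ennrpow_const Q)
      (Or.inr (ENNReal.rpow_ne_top_of_nonneg P0 IF))
  have L2 : Tendsto (fun k => ∫⁻ z, ENNReal.ofReal (f k z.1 ^ P * g k z.2 ^ Q) ∂bgauss r) atTop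
      (𝓝 (∫⁻ z, F z.1 ^ P * G z.2 ^ Q ∂bgauss r)) := by
    refine tendsto_lintegral_of_dominated_convergence (fun _ => ENNReal.ofReal (2 ^ P * 2 ^ Q))
      (fun k => ?_)
      (fun k => Eventually.of_forall fun z => ENNReal.ofReal_le_ofReal ?_) (by simp) ?_
    · have := (cf k).measurable; have := (cg k).measurable
      fun_prop
    · exact mul_le_mul (Real.rpow_le_rpow (fp k _).le (f2 k _) P0)
        (Real.rpow_le_rpow (gp k _).le (g2 k _) Q0) (Real.rpow_nonneg (gp k _).le _)
        (by positivity)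
    · have qf : Measure.QuasiMeasurePreserving Prod.fst (bgauss r) _root_.stdGaussian :=
        ⟨measurable_fst, by rw [bgauss_fst]⟩
      have qs : Measure.QuasiMeasurePreserving Prod.snd (bgauss r) _root_.stdGaussian :=
        ⟨measurable_snd, by rw [bgauss_snd hr]⟩
      filter_upwards [qf.ae fl, qs.ae gl] with z h1 h2
      have e : ∀ k, ENNReal.ofReal (f k z.1 ^ P * g k z.2 ^ Q) =
          ENNReal.ofReal (f k z.1) ^ P * ENNReal.ofReal (g k z.2) ^ Q := fun k => by
        rw [ENNReal.ofReal_mul (Real.rpow_nonneg (fp k _).le _),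
          ENNReal.ofReal_rpow_of_nonneg (fp k _).le P0,
          ENNReal.ofReal_rpow_of_nonneg (gp k _).le Q0]
      simp_rw [e]
      have h1' := ENNReal.tendsto_ofReal h1
      have h2' := ENNReal.tendsto_ofReal h2
      rw [ENNReal.ofReal_toReal (hFt _)] at h1'
      rw [ENNReal.ofReal_toReal (hGt _)] at h2'
      exact ENNReal.Tendsto.mul (h1'.ennrpow_const P)
        (Or.inr (ENNReal.rpow_ne_top_of_nonneg Q0 (hGt _))) (h2'.ennrpow_const Q)
        (Or.inr (ENNReal.rpow_ne_top_of_nonneg P0 (hFt _)))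
  exact le_of_tendsto_of_tendsto' L1 L2 key

end GT


namespace GT

open scoped ENNReal NNReal Topology

lemma lintegral_cons {n : ℕ} {X : Type} [MeasurableSpace X] (μ : Fin (n + 1) → Measure X)
    [∀ i, SigmaFinite (μ i)] (f : (Fin (n + 1) → X) → ℝ≥0∞) (hf : Measurable f) :
    ∫⁻ x, f x ∂Measure.pi μ =
      ∫⁻ x, ∫⁻ y, f (Fin.cons x y) ∂Measure.pi (fun j : Fin n => μ j.succ) ∂μ 0 := by
  have h := (measurePreserving_piFinSuccAbove μ 0).symm
  rw [← h.lintegral_comp hf, lintegral_prod (fun a => f ((MeasurableEquiv.piFinSuccAbove (fun _ => X) 0).symm a)) (hf.comp h.measurable).aemeasurable]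
  simp [MeasurableEquiv.piFinSuccAbove_symm_apply, Fin.insertNthEquiv, Fin.insertNth_zero]

lemma measurable_cons {n : ℕ} {X : Type} [MeasurableSpace X] :
    Measurable (fun z : X × (Fin n → X) => (Fin.cons z.1 z.2 : Fin (n + 1) → X)) := by
  rw [measurable_pi_iff]
  intro i
  refine Fin.cases ?_ (fun j => ?_) i
  · simpa using measurable_fst
  · simp only [Fin.cons_succ]; fun_prop

lemma rhc_pi (P Q : ℝ) (hP : 1 ≤ P) (hQ : 1 ≤ Q) (n : ℕ) (ρ : Fin n → ℝ)
    (hr : ∀ j, ρ j ^ 2 < 1)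
    (hquad : ∀ j, ∀ a b : ℝ,
      (a ^ 2 - 2 * ρ j * a * b + b ^ 2) / (1 - ρ j ^ 2) ≤ P * a ^ 2 + Q * b ^ 2)
    (F G : (Fin n → ℝ) → ℝ≥0∞) (hF : Measurable F) (hG : Measurable G) (hF1 : ∀ x, F x ≤ 1)
    (hG1 : ∀ x, G x ≤ 1) :
    (∫⁻ x, F x ∂gaussianPi n) ^ P * (∫⁻ x, G x ∂gaussianPi n) ^ Q ≤
      ∫⁻ z, F (fun j => (z j).1) ^ P * G (fun j => (z j).2) ^ Q
        ∂Measure.pi (fun j => bgauss (ρ j)) := by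
  induction n with
  | zero =>
    unfold gaussianPi
    rw [Measure.pi_of_empty, Measure.pi_of_empty]
    rw [lintegral_dirac' _ hF, lintegral_dirac' _ hG, lintegral_dirac']
    · refine le_of_eq ?_
      congr 3 <;> exact Subsingleton.elim _ _
    · fun_prop
  | succ n ih =>
    have mF : ∀ x : ℝ, Measurable fun y : Fin n → ℝ => F (Fin.cons x y : Fin (n+1) → ℝ) := fun x =>
      hF.comp (measurable_cons.comp measurable_prodMk_left)
    have mG : ∀ x : ℝ, Measurable fun y : Fin n → ℝ => G (Fin.cons x y : Fin (n+1) → ℝ) := fun x =>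
      hG.comp (measurable_cons.comp measurable_prodMk_left)
    have eF : ∫⁻ x, F x ∂gaussianPi (n + 1) =
        ∫⁻ x, ∫⁻ y, F (Fin.cons x y : Fin (n+1) → ℝ) ∂gaussianPi n ∂_root_.stdGaussian := by
      unfold gaussianPi; exact lintegral_cons _ F hF
    have eG : ∫⁻ x, G x ∂gaussianPi (n + 1) =
        ∫⁻ x, ∫⁻ y, G (Fin.cons x y : Fin (n+1) → ℝ) ∂gaussianPi n ∂_root_.stdGaussian := by
      unfold gaussianPi; exact lintegral_cons _ G hG
    rw [eF, eG]
    refine (rhc_one (ρ 0) P Q (hr 0) hP hQ (hquad 0) _ _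
      ((hF.comp measurable_cons).lintegral_prod_right') ((hG.comp measurable_cons).lintegral_prod_right')
      (fun x => ?_) (fun x => ?_)).trans ?_
    · refine (lintegral_mono (g := fun _ => 1) fun y => hF1 _).trans_eq ?_
      simp
    · refine (lintegral_mono (g := fun _ => 1) fun y => hG1 _).trans_eq ?_
      simp
    rw [lintegral_cons _ _ (by fun_prop)]
    refine lintegral_mono fun z => ?_
    refine (ih (fun j => ρ j.succ) (fun j => hr _) (fun j => hquad _) _ _ (mF z.1) (mG z.2)
      (fun x => hF1 _) (fun x => hG1 _)).trans_eq ?_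
    congr 1; ext y
    congr 3
    · ext j; refine Fin.cases ?_ (fun j => ?_) j <;> simp
    · ext j; refine Fin.cases ?_ (fun j => ?_) j <;> simp

end GT


namespace GT

open scoped ENNReal NNReal Topology

/-- Gaussian tail. -/
noncomputable def tail (u : ℝ) : ℝ := (_root_.stdGaussian).real (Set.Ioi u)

lemma setIntegral_std (s : Set ℝ) (hs : MeasurableSet s) (f : ℝ → ℝ) :
    ∫ x in s, f x ∂_root_.stdGaussian = ∫ x in s, phi x * f x := by
  rw [← integral_indicator hs, integral_std, ← integral_indicator hs]
  congr 1; ext x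
  by_cases h : x ∈ s <;> simp [h]

lemma tail_eq (u : ℝ) : tail u = ∫ x in Set.Ioi u, phi x := by
  have := setIntegral_std (Set.Ioi u) measurableSet_Ioi (fun _ => 1)
  simpa [tail] using this

lemma hasDerivAt_tail (u : ℝ) : HasDerivAt tail (-phi u) u := by
  have e : tail = fun v => tail 0 - ∫ x in (0:ℝ)..v, phi x := by
    ext v
    rw [tail_eq, tail_eq, ← intervalIntegral.integral_Ioi_sub_Ioi' (a := 0) (b := v)
      integrable_phi.integrableOn integrable_phi.integrableOn]
    ring
  rw [e]
  have := intervalIntegral.integral_hasDerivAt_right (f := phi) (a := 0) (b := u)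
    (continuous_phi.intervalIntegrable _ _) (continuous_phi.stronglyMeasurableAtFilter _ _)
    continuous_phi.continuousAt
  simpa using this.const_sub (tail 0)

lemma continuous_tail : Continuous tail :=
  continuous_iff_continuousAt.2 fun u => (hasDerivAt_tail u).continuousAt

lemma tail_nonneg (u : ℝ) : 0 ≤ tail u := measureReal_nonneg
lemma tail_le_one (u : ℝ) : tail u ≤ 1 := measureReal_le_one

lemma integrable_id_std : Integrable (fun x : ℝ => x) _root_.stdGaussian := by
  unfold _root_.stdGaussian
  exact (memLp_id_gaussianReal 1).integrable (by simp)

/-- quadrant probabilities -/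
noncomputable def quad (s t r : ℝ) : ℝ :=
  ∫ x in Set.Ioi s, tail ((t - r * x) / √(1 - r ^ 2)) ∂_root_.stdGaussian

lemma bgauss_quad {r : ℝ} (hr : r ^ 2 < 1) (s t : ℝ) :
    (bgauss r (Set.Ioi s ×ˢ Set.Ioi t)).toReal = quad s t r := by
  have hσ : 0 < √(1 - r ^ 2) := Real.sqrt_pos.2 (by linarith)
  have hm : MeasurableSet (Set.Ioi s ×ˢ Set.Ioi t) := measurableSet_Ioi.prod measurableSet_Ioi
  unfold bgauss quad
  rw [Measure.map_apply (meas_aux r) hm, Measure.prod_apply (meas_aux r hm)]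
  have e : ∀ x : ℝ, _root_.stdGaussian (Prod.mk x ⁻¹'
      ((fun z : ℝ × ℝ => (z.1, r * z.1 + √(1 - r ^ 2) * z.2)) ⁻¹' (Set.Ioi s ×ˢ Set.Ioi t))) =
      (Set.Ioi s).indicator
        (fun x => ENNReal.ofReal (tail ((t - r * x) / √(1 - r ^ 2)))) x := by
    intro x
    by_cases h : x ∈ Set.Ioi s
    · rw [Set.indicator_of_mem h]
      unfold tail
      rw [ofReal_measureReal]
      congr 1; ext z
      simp only [Set.mem_preimage, Set.mem_prod, h, true_and, Set.mem_Ioi]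
      rw [div_lt_iff₀ hσ]
      constructor <;> intro h <;> linarith
    · rw [Set.indicator_of_notMem h]
      have : (Prod.mk x ⁻¹'
      ((fun z : ℝ × ℝ => (z.1, r * z.1 + √(1 - r ^ 2) * z.2)) ⁻¹' (Set.Ioi s ×ˢ Set.Ioi t))) = ∅ := by
        ext z
        simp only [Set.mem_preimage, Set.mem_prod, h, false_and, Set.mem_empty_iff_false]
      rw [this]; simp
  simp_rw [e]
  rw [lintegral_indicator measurableSet_Ioi, integral_eq_lintegral_of_nonneg_ae]
  · exact Eventually.of_forall fun x => tail_nonneg _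
  · exact (continuous_tail.comp (by fun_prop)).aestronglyMeasurable

lemma hasDerivAt_bpdf {r : ℝ} (hr : r ^ 2 < 1) (x t : ℝ) :
    HasDerivAt (fun x => - bpdf r x t) (bpdf r x t * ((x - r * t) / (1 - r ^ 2))) x := by
  have h0 : 1 - r ^ 2 ≠ 0 := by linarith
  have h : HasDerivAt (fun x : ℝ => -(x ^ 2 - 2 * r * x * t + t ^ 2) / (2 * (1 - r ^ 2)))
      (-(x - r * t) / (1 - r ^ 2)) x := by
    have h1 : HasDerivAt (fun x : ℝ => x ^ 2 - 2 * r * x * t + t ^ 2) (2 * x - 2 * r * t) x := by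
      have := (((hasDerivAt_pow 2 x).sub (((hasDerivAt_id x).const_mul (2 * r)).mul_const t)).add_const (t ^ 2))
      refine this.congr_deriv ?_
      simp
    refine (h1.neg.div_const (2 * (1 - r ^ 2))).congr_deriv ?_
    field_simp
  unfold bpdf
  refine ((h.exp).const_mul ((2 * Real.pi * √(1 - r ^ 2))⁻¹)).neg.congr_deriv ?_
  ring

lemma tendsto_bpdf {r : ℝ} (hr : r ^ 2 < 1) (t : ℝ) :
    Tendsto (fun x => - bpdf r x t) atTop (𝓝 0) := by
  have h0 : 0 < 1 - r ^ 2 := by linarith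
  have h1 : Tendsto (fun x : ℝ => (x ^ 2 - 2 * r * x * t + t ^ 2) / (2 * (1 - r ^ 2))) atTop atTop := by
    refine Tendsto.atTop_div_const (by linarith) ?_
    have h2 : Tendsto (fun x : ℝ => x - r * t - 1) atTop atTop := by
      have := tendsto_atTop_add_const_right atTop (- r * t - 1) (tendsto_id (α := ℝ))
      refine this.congr fun x => by simp only [id]; ring
    refine tendsto_atTop_mono (fun x => ?_) h2
    nlinarith [sq_nonneg (x - r * t - 1/2), mul_nonneg h0.le (sq_nonneg t)]
  have h3 := (Real.tendsto_exp_atBot.comp (tendsto_neg_atTop_atBot.comp h1)).const_mul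
    (-(2 * Real.pi * √(1 - r ^ 2))⁻¹)
  rw [mul_zero] at h3
  refine h3.congr fun x => ?_
  simp only [bpdf, Function.comp]
  rw [neg_div]; ring

lemma phi_phi {r : ℝ} (hr : r ^ 2 < 1) (x t : ℝ) :
    phi x * phi ((t - r * x) / √(1 - r ^ 2)) = √(1 - r ^ 2) * bpdf r x t := by
  have h0 : 0 < 1 - r ^ 2 := by linarith
  have hσ : 0 < √(1 - r ^ 2) := Real.sqrt_pos.2 h0
  have hπ := Real.pi_pos
  unfold phi bpdf
  have e : Real.exp (-(x ^ 2) / 2) * Real.exp (-(((t - r * x) / √(1 - r ^ 2)) ^ 2) / 2) =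
      Real.exp (-(x ^ 2 - 2 * r * x * t + t ^ 2) / (2 * (1 - r ^ 2))) := by
    rw [← Real.exp_add, div_pow, Real.sq_sqrt h0.le]
    congr 1; field_simp; ring
  rw [← e]
  have e2 : (√(2 * Real.pi))⁻¹ * (√(2 * Real.pi))⁻¹ = (2 * Real.pi)⁻¹ := by
    rw [← mul_inv, Real.mul_self_sqrt (by positivity)]
  calc _ = ((√(2 * Real.pi))⁻¹ * (√(2 * Real.pi))⁻¹) * (Real.exp (-(x ^ 2) / 2) * Real.exp (-(((t - r * x) / √(1 - r ^ 2)) ^ 2) / 2)) := by ring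
    _ = _ := by rw [e2]; field_simp

lemma phi_le_one (x : ℝ) : phi x ≤ 1 := by
  unfold phi
  have h1 : 1 ≤ √(2 * Real.pi) := by
    rw [Real.one_le_sqrt]; linarith [Real.pi_gt_three]
  have h2 : Real.exp (-(x ^ 2) / 2) ≤ 1 := Real.exp_le_one_iff.2 (by nlinarith [sq_nonneg x])
  exact mul_le_one₀ (inv_le_one_of_one_le₀ h1) (Real.exp_pos _).le h2

lemma hasDerivAt_quad (s t r : ℝ) (hr : |r| < 1 / 2) :
    HasDerivAt (quad s t) (bpdf r s t) r := by
  have bd : ∀ r : ℝ, r ∈ Set.Ioo (-(1/2) : ℝ) (1/2) → 3 / 4 < 1 - r ^ 2 := fun r h => by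
    nlinarith [h.1, h.2]
  have hr' : r ∈ Set.Ioo (-(1/2) : ℝ) (1/2) := abs_lt.1 hr
  have hr2 : r ^ 2 < 1 := by linarith [bd r hr']
  have B1 : ∀ x r : ℝ, r ∈ Set.Ioo (-(1/2) : ℝ) (1/2) → ‖phi ((t - r * x) / √(1 - r ^ 2)) * ((x - r * t) / (√(1 - r ^ 2)) ^ 3)‖ ≤ 2 * (|x| + |t|) := by
    intro x r hr
    have hb := bd r hr
    have h0 : 0 < 1 - r ^ 2 := by linarith
    have hσ : 0 < √(1 - r ^ 2) := Real.sqrt_pos.2 h0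
    have hσ1 : 1 / 2 ≤ √(1 - r ^ 2) ^ 3 := by
      have : (3/4 : ℝ) ≤ √(1 - r ^ 2) := by
        rw [Real.le_sqrt' (by norm_num)]; linarith
      rw [pow_succ (√(1 - r ^ 2)) 2, Real.sq_sqrt h0.le]
      nlinarith
    have hr3 : |r| ≤ 1 := (abs_lt.2 hr).le.trans (by norm_num)
    rw [norm_mul, Real.norm_eq_abs,
      abs_of_pos (phi_pos _)]
    refine (mul_le_of_le_one_left (norm_nonneg _) (phi_le_one _)).trans ?_
    rw [norm_div, Real.norm_eq_abs, Real.norm_eq_abs, abs_of_pos (pow_pos hσ 3),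
      div_le_iff₀ (pow_pos hσ 3)]
    have : |x - r * t| ≤ |x| + |t| := by
      refine (abs_sub _ _).trans ?_
      rw [abs_mul]
      nlinarith [abs_nonneg t]
    nlinarith [abs_nonneg t, abs_nonneg x]
  have B2 : Integrable (fun x : ℝ => 2 * (|x| + |t|)) (_root_.stdGaussian.restrict (Set.Ioi s)) := by
    exact ((integrable_id_std.abs.add (integrable_const |t|)).const_mul 2).integrableOn
  have B3 : ∀ x r : ℝ, r ∈ Set.Ioo (-(1/2) : ℝ) (1/2) → HasDerivAt (fun r => tail ((t - r * x) / √(1 - r ^ 2))) (phi ((t - r * x) / √(1 - r ^ 2)) * ((x - r * t) / (√(1 - r ^ 2)) ^ 3)) r := by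
    intro x r hr
    have hb := bd r hr
    have h0 : 0 < 1 - r ^ 2 := by linarith
    have hσ : 0 < √(1 - r ^ 2) := Real.sqrt_pos.2 h0
    have d1 : HasDerivAt (fun r : ℝ => √(1 - r ^ 2)) (-(2 * r) / (2 * √(1 - r ^ 2))) r := by
      refine HasDerivAt.sqrt ?_ h0.ne'
      exact ((hasDerivAt_pow 2 r).const_sub 1).congr_deriv (by simp)
    have d2 : HasDerivAt (fun r : ℝ => t - r * x) (-x) r := by
      exact (((hasDerivAt_id r).mul_const x).const_sub t).congr_deriv (by simp)
    refine ((hasDerivAt_tail _).comp r (d2.div d1 hσ.ne')).congr_deriv ?_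
    have e2 : -x * √(1 - r ^ 2) - (t - r * x) * (-(2 * r) / (2 * √(1 - r ^ 2))) =
        (r * t - x) / √(1 - r ^ 2) := by
      have := Real.mul_self_sqrt h0.le
      field_simp
      rw [Real.sq_sqrt h0.le]; ring
    rw [e2]
    simp only [Pi.div_apply]
    generalize phi ((t - r * x) / √(1 - r ^ 2)) = q
    field_simp
    ring
  obtain ⟨hi, hd⟩ := hasDerivAt_integral_of_dominated_loc_of_deriv_le
    (μ := _root_.stdGaussian.restrict (Set.Ioi s))
    (F := fun r x => tail ((t - r * x) / √(1 - r ^ 2)))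
    (F' := fun r x => phi ((t - r * x) / √(1 - r ^ 2)) * ((x - r * t) / (√(1 - r ^ 2)) ^ 3))
    (bound := fun x => 2 * (|x| + |t|)) (x₀ := r) (s := Set.Ioo (-(1/2) : ℝ) (1/2))
    (isOpen_Ioo.mem_nhds hr')
    (Eventually.of_forall fun r => (continuous_tail.comp (by fun_prop)).aestronglyMeasurable)
    (Integrable.of_bound (continuous_tail.comp (by fun_prop)).aestronglyMeasurable 1
      (Eventually.of_forall fun x => by
        rw [Real.norm_eq_abs, abs_of_nonneg (tail_nonneg _)]; exact tail_le_one _))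
    (((continuous_phi.comp (by fun_prop)).mul (by fun_prop)).aestronglyMeasurable)
    (Eventually.of_forall fun x r hr => B1 x r hr)
    B2
    (Eventually.of_forall fun x r hr => B3 x r hr)
  · refine hd.congr_deriv ?_
    rw [setIntegral_std _ measurableSet_Ioi]
    have e : ∀ x : ℝ, phi x * (phi ((t - r * x) / √(1 - r ^ 2)) * ((x - r * t) / (√(1 - r ^ 2)) ^ 3)) =
        bpdf r x t * ((x - r * t) / (1 - r ^ 2)) := fun x => by
      have h0 : 0 < 1 - r ^ 2 := by linarith
      have hσ : 0 < √(1 - r ^ 2) := Real.sqrt_pos.2 h0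
      rw [← mul_assoc, phi_phi hr2, pow_succ (√(1 - r ^ 2)) 2, Real.sq_sqrt h0.le]
      field_simp
    simp_rw [e]
    have hi2 : IntegrableOn (fun x => bpdf r x t * ((x - r * t) / (1 - r ^ 2))) (Set.Ioi s) := by
      have h3 : IntegrableOn (fun x : ℝ => phi x * (2 * (|x| + |t|))) (Set.Ioi s) := by
        refine Integrable.integrableOn ?_
        have i1 : Integrable (fun x : ℝ => phi x * |x|) := by
          have := (integrable_mul_exp_neg_mul_sq (b := 1/2) (by norm_num)).abs.const_mul ((√(2 * Real.pi))⁻¹)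
          refine this.congr (Eventually.of_forall fun x => ?_)
          simp only [phi, abs_mul, Real.abs_exp]
          rw [show -(x ^ 2) / 2 = -(1/2) * x ^ 2 by ring]; ring
        refine ((i1.const_mul 2).add (integrable_phi.const_mul (2 * |t|))).congr
          (Eventually.of_forall fun x => ?_)
        simp only [Pi.add_apply]; ring
      refine h3.mono' ?_ (Eventually.of_forall fun x => ?_)
      · refine Continuous.aestronglyMeasurable ?_
        unfold bpdf; fun_prop
      · have hb := bd r hr'
        have h0 : 0 < 1 - r ^ 2 := by linarith
        have hσ : 0 < √(1 - r ^ 2) := Real.sqrt_pos.2 h0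
        have hσ1 : 1 / 2 ≤ √(1 - r ^ 2) ^ 3 := by
          have : (3/4 : ℝ) ≤ √(1 - r ^ 2) := by
            rw [Real.le_sqrt' (by norm_num)]; linarith
          have := pow_le_pow_left₀ (by norm_num) this 3
          rw [pow_succ (√(1 - r ^ 2)) 2, Real.sq_sqrt h0.le]
          nlinarith
        rw [← e, norm_mul, Real.norm_eq_abs, abs_of_pos (phi_pos x), norm_mul, Real.norm_eq_abs,
          abs_of_pos (phi_pos _)]
        refine mul_le_mul_of_nonneg_left ?_ (phi_pos x).le
        refine (mul_le_of_le_one_left (norm_nonneg _) (phi_le_one _)).trans ?_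
        rw [norm_div, Real.norm_eq_abs, Real.norm_eq_abs, abs_of_pos (pow_pos hσ 3),
          div_le_iff₀ (pow_pos hσ 3)]
        have : |x - r * t| ≤ |x| + |t| := by
          refine (abs_sub _ _).trans ?_
          rw [abs_mul]
          nlinarith [abs_nonneg t]
        nlinarith [abs_nonneg t, abs_nonneg x]
    rw [integral_Ioi_of_hasDerivAt_of_tendsto' (fun x _ => hasDerivAt_bpdf hr2 x t) hi2
      (tendsto_bpdf hr2 t)]
    ring

lemma quad_bound {r x y : ℝ} (hx : 0 ≤ x) (hx4 : x ≤ 1 / 4) (hy : 0 ≤ y) (hy4 : y ≤ 1 / 4)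
    (h : r ^ 2 ≤ x * y) (a b : ℝ) :
    (a ^ 2 - 2 * r * a * b + b ^ 2) / (1 - r ^ 2) ≤ (1 + 2 * x) * a ^ 2 + (1 + 2 * y) * b ^ 2 := by
  have r1 : r ^ 2 ≤ x / 4 := h.trans (by nlinarith)
  have r2 : r ^ 2 ≤ y / 4 := h.trans (by nlinarith)
  have h0 : 0 < 1 - r ^ 2 := by linarith
  rw [div_le_iff₀ h0]
  have h1 : |2 * r * a * b| ≤ x * a ^ 2 + y * b ^ 2 := by
    refine abs_le_of_sq_le_sq ?_ (by positivity)
    have := mul_le_mul_of_nonneg_right h (mul_nonneg (sq_nonneg a) (sq_nonneg b))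
    nlinarith [sq_nonneg (x * a ^ 2 - y * b ^ 2)]
  have h2 := (abs_le.1 h1).1
  have h3 : 1 + x ≤ (1 + 2 * x) * (1 - r ^ 2) := by nlinarith
  have h4 : 1 + y ≤ (1 + 2 * y) * (1 - r ^ 2) := by nlinarith
  have h5 := mul_le_mul_of_nonneg_right h3 (sq_nonneg a)
  have h6 := mul_le_mul_of_nonneg_right h4 (sq_nonneg b)
  nlinarith

lemma bpdf_lower {r x y : ℝ} (hx : 0 ≤ x) (hx4 : x ≤ 1 / 4) (hy : 0 ≤ y) (hy4 : y ≤ 1 / 4)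
    (h : r ^ 2 ≤ x * y) (s t : ℝ) :
    (2 * Real.pi)⁻¹ * (Real.exp (-(s ^ 2) / 2) ^ (1 + 2 * x) * Real.exp (-(t ^ 2) / 2) ^ (1 + 2 * y))
      ≤ bpdf r s t := by
  have hq := quad_bound hx hx4 hy hy4 h s t
  have r1 : r ^ 2 ≤ x / 4 := h.trans (by nlinarith)
  have h0 : 0 < 1 - r ^ 2 := by linarith
  have hσ : 0 < √(1 - r ^ 2) := Real.sqrt_pos.2 h0
  have hσ1 : √(1 - r ^ 2) ≤ 1 := Real.sqrt_le_one.2 (by nlinarith [sq_nonneg r])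
  have hπ := Real.pi_pos
  unfold bpdf
  rw [← Real.exp_mul, ← Real.exp_mul, ← Real.exp_add]
  refine mul_le_mul ?_ (Real.exp_le_exp.2 ?_) (Real.exp_pos _).le (by positivity)
  · refine inv_anti₀ (by positivity) ?_
    exact mul_le_of_le_one_right (by positivity) hσ1
  · have : -(s ^ 2 - 2 * r * s * t + t ^ 2) / (2 * (1 - r ^ 2)) =
      -((s ^ 2 - 2 * r * s * t + t ^ 2) / (1 - r ^ 2)) / 2 := by field_simp
    rw [this]; linarith

lemma plackett {r x y : ℝ} (hr : 0 ≤ r) (hx : 0 ≤ x) (hx4 : x ≤ 1 / 4) (hy : 0 ≤ y) (hy4 : y ≤ 1 / 4)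
    (h : r ^ 2 ≤ x * y) (s t : ℝ) :
    r / (2 * Real.pi) *
      (Real.exp (-(s ^ 2) / 2) ^ (1 + 2 * x) * Real.exp (-(t ^ 2) / 2) ^ (1 + 2 * y))
      ≤ (bgauss r (Set.Ioi s ×ˢ Set.Ioi t)).toReal -
        (_root_.stdGaussian (Set.Ioi s)).toReal * (_root_.stdGaussian (Set.Ioi t)).toReal := by
  have r4 : r ≤ 1 / 4 := by
    have : x * y ≤ 1 / 16 := by nlinarith
    nlinarith
  have e0 : (_root_.stdGaussian (Set.Ioi s)).toReal * (_root_.stdGaussian (Set.Ioi t)).toReal =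
      quad s t 0 := by
    rw [← bgauss_quad (by norm_num), bgauss_zero, Measure.prod_prod, ENNReal.toReal_mul]
  rw [e0, bgauss_quad (by nlinarith)]
  have hd : ∀ q ∈ Set.Icc 0 r, HasDerivAt (quad s t) (bpdf q s t) q := fun q hq =>
    hasDerivAt_quad s t q (by rw [abs_of_nonneg hq.1]; linarith [hq.2])
  have := (convex_Icc 0 r).mul_sub_le_image_sub_of_le_deriv (f := quad s t)
    (C := (2 * Real.pi)⁻¹ * (Real.exp (-(s ^ 2) / 2) ^ (1 + 2 * x) * Real.exp (-(t ^ 2) / 2) ^ (1 + 2 * y)))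
    (fun q hq => (hd q hq).continuousAt.continuousWithinAt)
    (fun q hq => (hd q (interior_subset hq)).differentiableAt.differentiableWithinAt)
    (fun q hq => by
      have hq' := interior_subset hq
      rw [(hd q hq').deriv]
      refine bpdf_lower hx hx4 hy hy4 (le_trans ?_ h) s t
      exact pow_le_pow_left₀ hq'.1 hq'.2 2) 0 (Set.left_mem_Icc.2 hr) r (Set.right_mem_Icc.2 hr) hr
  refine le_trans (le_of_eq ?_) this
  rw [div_eq_mul_inv]; ring

end GT


namespace GT

open scoped ENNReal NNReal Topology

instance : NullSingletonClass _root_.stdGaussian := by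
  unfold _root_.stdGaussian; exact nullSingletonClass_gaussianReal one_ne_zero

lemma upper_cases (S : Set ℝ) (hS : IsUpperSet S) :
    S = ∅ ∨ S = Set.univ ∨ ∃ s, Set.Ioi s ⊆ S ∧ S ⊆ Set.Ici s := by
  rcases S.eq_empty_or_nonempty with h | h
  · exact Or.inl h
  right
  by_cases hb : BddBelow S
  · right
    refine ⟨sInf S, fun x hx => ?_, fun x hx => csInf_le hb hx⟩
    obtain ⟨y, hy, hyx⟩ := exists_lt_of_csInf_lt h hx
    exact hS hyx.le hy
  · left
    ext x
    simp only [Set.mem_univ, iff_true]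
    rw [not_bddBelow_iff] at hb
    obtain ⟨y, hy, hyx⟩ := hb x
    exact hS hyx.le hy

lemma std_between {S : Set ℝ} {s : ℝ} (h1 : Set.Ioi s ⊆ S) (h2 : S ⊆ Set.Ici s) :
    _root_.stdGaussian S = _root_.stdGaussian (Set.Ioi s) := by
  refine le_antisymm ?_ (measure_mono h1)
  rw [measure_congr (Ioi_ae_eq_Ici (a := s) (μ := _root_.stdGaussian))]
  exact measure_mono h2

lemma add_Icc {S : Set ℝ} (hS : IsUpperSet S) {r : ℝ} (hr : 0 ≤ r) :
    S + Set.Icc (-r) r = {y | y + r ∈ S} := by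
  ext y
  constructor
  · rintro ⟨a, ha, b, hb, rfl⟩
    exact hS (by have := hb.1; simp only; linarith) ha
  · intro hy
    exact ⟨y + r, hy, -r, ⟨le_rfl, by linarith⟩, by simp⟩

lemma upper_struct (S : Set ℝ) (hS : IsUpperSet S) :
    Tendsto (fun r : ℝ => ((_root_.stdGaussian {y | y + r ∈ S}).toReal -
      (_root_.stdGaussian S).toReal) / r) (𝓝[>] 0) (𝓝 (minkContent S)) ∧
    ((S = ∅ ∧ minkContent S = 0) ∨ (S = Set.univ ∧ minkContent S = 0) ∨
      ∃ s, Set.Ioi s ⊆ S ∧ S ⊆ Set.Ici s ∧ minkContent S = phi s) := by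
  have key : ∀ m : ℝ, Tendsto (fun r : ℝ => ((_root_.stdGaussian {y | y + r ∈ S}).toReal -
      (_root_.stdGaussian S).toReal) / r) (𝓝[>] 0) (𝓝 m) → minkContent S = m := by
    intro m hm
    unfold minkContent
    refine Tendsto.liminf_eq (hm.congr' ?_)
    filter_upwards [self_mem_nhdsWithin] with r hr
    rw [add_Icc hS (le_of_lt hr)]
  rcases upper_cases S hS with h | h | ⟨s, h1, h2⟩
  · have : Tendsto (fun r : ℝ => ((_root_.stdGaussian {y | y + r ∈ S}).toReal -
      (_root_.stdGaussian S).toReal) / r) (𝓝[>] 0) (𝓝 0) := by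
      subst h; simp
    have e := key 0 this
    rw [e]; exact ⟨this, Or.inl ⟨h, rfl⟩⟩
  · have : Tendsto (fun r : ℝ => ((_root_.stdGaussian {y | y + r ∈ S}).toReal -
      (_root_.stdGaussian S).toReal) / r) (𝓝[>] 0) (𝓝 0) := by
      subst h; simp
    have e := key 0 this
    rw [e]; exact ⟨this, Or.inr (Or.inl ⟨h, rfl⟩)⟩
  · have : Tendsto (fun r : ℝ => ((_root_.stdGaussian {y | y + r ∈ S}).toReal -
      (_root_.stdGaussian S).toReal) / r) (𝓝[>] 0) (𝓝 (phi s)) := by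
      have e : ∀ r : ℝ, (_root_.stdGaussian {y | y + r ∈ S}).toReal = tail (s - r) := fun r => by
        rw [std_between (S := {y | y + r ∈ S}) (s := s - r)]
        · rfl
        · intro y hy; exact h1 (by have := Set.mem_Ioi.1 hy; simp only [Set.mem_Ioi]; linarith)
        · intro y hy
          have := Set.mem_Ici.1 (h2 hy)
          simp only [Set.mem_Ici]; linarith
      have e0 : (_root_.stdGaussian S).toReal = tail s := by rw [std_between h1 h2]; rfl
      simp_rw [e, e0]
      have d : HasDerivAt (fun r => tail (s - r)) (phi s) 0 := by
        have h3 : HasDerivAt (fun r : ℝ => s - r) (-1) 0 := by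
          exact (hasDerivAt_id (0:ℝ)).const_sub s
        have h4 : HasDerivAt tail (-phi s) (s - 0) := by simpa using hasDerivAt_tail s
        refine (h4.comp (0:ℝ) h3).congr_deriv (by ring)
      have d2 := (hasDerivAt_iff_tendsto_slope.1 d).mono_left
        (nhdsWithin_mono (0:ℝ) (s := Set.Ioi 0) (fun y hy => by
          simp only [Set.mem_compl_iff, Set.mem_singleton_iff]; exact (ne_of_gt hy)))
      refine d2.congr fun r => ?_
      simp [slope_def_field]
    have e := key _ this
    rw [e]; exact ⟨this, Or.inr (Or.inr ⟨s, h1, h2, rfl⟩)⟩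

lemma sqrt_phi (s : ℝ) : √(2 * Real.pi) * phi s = Real.exp (-(s ^ 2) / 2) := by
  have : 0 < √(2 * Real.pi) := Real.sqrt_pos.2 (by positivity)
  unfold phi; field_simp

/-- normalized Minkowski content -/
noncomputable def fm (S : Set ℝ) : ℝ≥0∞ := ENNReal.ofReal (√(2 * Real.pi) * minkContent S)

lemma mink_nonneg {S : Set ℝ} (hS : IsUpperSet S) : 0 ≤ minkContent S := by
  rcases (upper_struct S hS).2 with ⟨-, h⟩ | ⟨-, h⟩ | ⟨s, -, -, h⟩ <;> rw [h]
  exact (phi_pos s).le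

lemma fm_le_one {S : Set ℝ} (hS : IsUpperSet S) : fm S ≤ 1 := by
  unfold fm
  rcases (upper_struct S hS).2 with ⟨-, h⟩ | ⟨-, h⟩ | ⟨s, -, -, h⟩ <;> rw [h]
  · simp
  · simp
  · rw [sqrt_phi, ENNReal.ofReal_le_one]
    exact Real.exp_le_one_iff.2 (by nlinarith [sq_nonneg s])

lemma bgauss_univ_prod {r : ℝ} (hr : r ^ 2 < 1) {T : Set ℝ} (hT : MeasurableSet T) :
    bgauss r (Set.univ ×ˢ T) = _root_.stdGaussian T := by
  rw [← bgauss_snd hr, Measure.map_apply measurable_snd hT, Set.univ_prod]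

lemma bgauss_prod_univ {r : ℝ} {T : Set ℝ} (hT : MeasurableSet T) :
    bgauss r (T ×ˢ Set.univ) = _root_.stdGaussian T := by
  rw [← bgauss_fst r, Measure.map_apply measurable_fst hT, Set.prod_univ]

lemma bgauss_le_inter {r : ℝ} (hr : r ^ 2 < 1) {S T : Set ℝ} (hS : IsUpperSet S) (hT : IsUpperSet T) :
    bgauss r (S ×ˢ T) ≤ _root_.stdGaussian (S ∩ T) := by
  have mS : MeasurableSet S := hS.ordConnected.measurableSet
  have mT : MeasurableSet T := hT.ordConnected.measurableSet
  rcases hS.total hT with h | h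
  · rw [Set.inter_eq_left.2 h, ← bgauss_prod_univ (r := r) mS]
    exact measure_mono (Set.prod_mono_right (Set.subset_univ _))
  · rw [Set.inter_eq_right.2 h, ← bgauss_univ_prod hr mT]
    exact measure_mono (Set.prod_mono_left (Set.subset_univ _))

lemma gain {r x y : ℝ} (hr : 0 ≤ r) (hx : 0 ≤ x) (hx4 : x ≤ 1 / 4) (hy : 0 ≤ y) (hy4 : y ≤ 1 / 4)
    (h : r ^ 2 ≤ x * y) {S T : Set ℝ} (hS : IsUpperSet S) (hT : IsUpperSet T) :
    _root_.stdGaussian S * _root_.stdGaussian T +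
      ENNReal.ofReal (r / (2 * Real.pi)) * (fm S ^ (1 + 2 * x) * fm T ^ (1 + 2 * y)) ≤
      bgauss r (S ×ˢ T) := by
  have hr1 : r ^ 2 < 1 := h.trans_lt (by nlinarith)
  have mS : MeasurableSet S := hS.ordConnected.measurableSet
  have mT : MeasurableSet T := hT.ordConnected.measurableSet
  have zS : minkContent S = 0 → fm S ^ (1 + 2 * x) = 0 := fun h => by
    unfold fm; rw [h]; simp; linarith
  have zT : minkContent T = 0 → fm T ^ (1 + 2 * y) = 0 := fun h => by
    unfold fm; rw [h]; simp; linarith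
  rcases (upper_struct S hS).2 with ⟨e, h0⟩ | ⟨e, h0⟩ | ⟨s, s1, s2, es⟩
  · rw [zS h0, e]; simp
  · rw [zS h0, e, bgauss_univ_prod hr1 mT]; simp
  rcases (upper_struct T hT).2 with ⟨e, h0⟩ | ⟨e, h0⟩ | ⟨t, t1, t2, et⟩
  · rw [zT h0, e]; simp
  · rw [zT h0, e, bgauss_prod_univ mS]; simp
  refine le_trans ?_ (measure_mono (Set.prod_mono s1 t1))
  rw [std_between s1 s2, std_between t1 t2]
  have hp := plackett hr hx hx4 hy hy4 h s t
  unfold fm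
  rw [es, et, sqrt_phi, sqrt_phi, ENNReal.ofReal_rpow_of_pos (Real.exp_pos _),
    ENNReal.ofReal_rpow_of_pos (Real.exp_pos _), ← ENNReal.ofReal_mul (by positivity),
    ← ENNReal.ofReal_mul (by positivity), ← ENNReal.ofReal_toReal (measure_ne_top _ (Set.Ioi s)),
    ← ENNReal.ofReal_toReal (measure_ne_top _ (Set.Ioi t)),
    ← ENNReal.ofReal_mul ENNReal.toReal_nonneg, ← ENNReal.ofReal_add (by positivity) (by positivity)]
  refine ENNReal.ofReal_le_of_le_toReal ?_
  linarith

lemma fiber_upper {n : ℕ} {A : Set (Fin n → ℝ)} (hA : IncreasingSet A) (i : Fin n) (x : Fin n → ℝ) :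
    IsUpperSet (fiber A i x) := fun a b hab ha =>
  hA (update_le_update_iff'.2 hab) ha

lemma measurable_mink {n : ℕ} {A : Set (Fin n → ℝ)} (hA : IncreasingSet A) (mA : MeasurableSet A)
    (i : Fin n) : Measurable (fun x => minkContent (fiber A i x)) := by
  have hm : ∀ r : ℝ, Measurable fun x => (_root_.stdGaussian {y | y + r ∈ fiber A i x}).toReal := by
    intro r
    have h1 : Measurable fun z : (Fin n → ℝ) × ℝ => Function.update z.1 i (z.2 + r) := by
      have := (measurable_update' (a := i) (X := fun _ : Fin n => ℝ)).comp
        (measurable_fst.prodMk (measurable_snd.add_const r) :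
          Measurable fun z : (Fin n → ℝ) × ℝ => (z.1, z.2 + r))
      exact this
    exact (measurable_measure_prodMk_left (h1 mA)).ennreal_toReal
  have hm0 : Measurable fun x => (_root_.stdGaussian (fiber A i x)).toReal := by
    simpa using hm 0
  refine measurable_of_tendsto_metrizable (f := fun (k : ℕ) x =>
    ((_root_.stdGaussian {y | y + 1 / ((k:ℝ) + 1) ∈ fiber A i x}).toReal -
      (_root_.stdGaussian (fiber A i x)).toReal) / (1 / ((k:ℝ) + 1))) (fun k => ?_) ?_
  · exact ((hm _).sub hm0).div_const _
  · rw [tendsto_pi_nhds]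
    intro x
    refine (upper_struct _ (fiber_upper hA i x)).1.comp ?_
    exact tendsto_nhdsWithin_iff.2 ⟨tendsto_one_div_add_atTop_nhds_zero_nat,
      Eventually.of_forall fun k => by simp only [Set.mem_Ioi]; positivity⟩

lemma lintegral_swap {n : ℕ} {X : Type} [MeasurableSpace X] [Nonempty X] (μ μ' : Fin n → Measure X)
    [∀ i, IsProbabilityMeasure (μ i)] [∀ i, IsProbabilityMeasure (μ' i)] (i : Fin n)
    (h : ∀ j, j ≠ i → μ j = μ' j) (f : (Fin n → X) → ℝ≥0∞) (hf : Measurable f) :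
    ∫⁻ x, f x ∂Measure.pi μ = ∫⁻ x, ∫⁻ w, f (Function.update x i w) ∂μ i ∂Measure.pi μ' := by
  obtain ⟨x0⟩ : Nonempty (Fin n → X) := inferInstance
  set g : (Fin n → X) → ℝ≥0∞ := fun x => ∫⁻ w, f (Function.update x i w) ∂μ i with hg
  have mg : Measurable g := by
    have h1 : Measurable fun z : (Fin n → X) × X => f (Function.update z.1 i z.2) :=
      hf.comp (measurable_update' (a := i) (X := fun _ : Fin n => X))
    exact h1.lintegral_prod_right'
  rw [lintegral_eq_lmarginal_univ x0, lintegral_eq_lmarginal_univ x0,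
    lmarginal_erase' f hf (Finset.mem_univ i), lmarginal_erase' g mg (Finset.mem_univ i)]
  have e : (fun x => ∫⁻ w, g (Function.update x i w) ∂μ' i) = g := by
    ext x
    simp [hg]
  rw [e]
  change lmarginal μ (Finset.univ.erase i) g x0 = _
  unfold lmarginal
  congr 2
  ext j
  rw [h j (Finset.ne_of_mem_erase j.2)]

end GT


namespace GT

open scoped ENNReal NNReal Topology

/-- The coupling event. -/
def cpl {n : ℕ} (A B : Set (Fin n → ℝ)) : Set (Fin n → ℝ × ℝ) :=
  {z | (fun j => (z j).1) ∈ A ∧ (fun j => (z j).2) ∈ B}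

lemma measurableSet_cpl {n : ℕ} {A B : Set (Fin n → ℝ)} (mA : MeasurableSet A)
    (mB : MeasurableSet B) : MeasurableSet (cpl A B) := by
  have h1 : Measurable fun z : Fin n → ℝ × ℝ => fun j => (z j).1 := by fun_prop
  have h2 : Measurable fun z : Fin n → ℝ × ℝ => fun j => (z j).2 := by fun_prop
  exact (h1 mA).inter (h2 mB)

lemma measure_swap {n : ℕ} {A B : Set (Fin n → ℝ)} (mA : MeasurableSet A) (mB : MeasurableSet B)
    (μ μ' : Fin n → Measure (ℝ × ℝ))
    [∀ i, IsProbabilityMeasure (μ i)] [∀ i, IsProbabilityMeasure (μ' i)] (i : Fin n)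
    (h : ∀ j, j ≠ i → μ j = μ' j) :
    Measure.pi μ (cpl A B) = ∫⁻ z, μ i (fiber A i (fun j => (z j).1) ×ˢ fiber B i (fun j => (z j).2))
      ∂Measure.pi μ' := by
  have mC := measurableSet_cpl mA mB
  rw [← lintegral_indicator_one mC, lintegral_swap μ μ' i h _ (measurable_one.indicator mC)]
  congr 1; ext z
  have e : ∀ w : ℝ × ℝ, (cpl A B).indicator (1 : (Fin n → ℝ × ℝ) → ℝ≥0∞) (Function.update z i w) =
      ((fun w => Function.update z i w) ⁻¹' cpl A B).indicator 1 w := fun w => by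
    simp only [Set.indicator]; rfl
  simp_rw [e]
  rw [lintegral_indicator_one ((measurable_update z) mC)]
  congr 1; ext w
  simp only [Set.mem_preimage, cpl, Set.mem_setOf_eq, Set.mem_prod, fiber]
  have e1 : (fun j => (Function.update z i w j).1) = Function.update (fun j => (z j).1) i w.1 := by
    ext j; by_cases h : j = i
    · subst h; simp
    · simp [h]
  have e2 : (fun j => (Function.update z i w j).2) = Function.update (fun j => (z j).2) i w.2 := by
    ext j; by_cases h : j = i
    · subst h; simp
    · simp [h]
  rw [e1, e2]

lemma measurable_fm {n : ℕ} {A : Set (Fin n → ℝ)} (hA : IncreasingSet A) (mA : MeasurableSet A)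
    (i : Fin n) : Measurable (fun x => fm (fiber A i x)) :=
  ((measurable_mink hA mA i).const_mul _).ennreal_ofReal

lemma step {n : ℕ} {A B : Set (Fin n → ℝ)} (mA : MeasurableSet A) (mB : MeasurableSet B)
    (hA : IncreasingSet A) (hB : IncreasingSet B) (i : Fin n) (ρ0 ρ1 : Fin n → ℝ)
    (h01 : ∀ j, j ≠ i → ρ1 j = ρ0 j) (h0 : ρ0 i = 0) {x y : ℝ} (hr : 0 ≤ ρ1 i)
    (hx : 0 ≤ x) (hx4 : x ≤ 1 / 4) (hy : 0 ≤ y) (hy4 : y ≤ 1 / 4)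
    (h : ∀ j, ρ0 j ^ 2 ≤ x * y) (hi : ρ1 i ^ 2 ≤ x * y) :
    Measure.pi (fun j => bgauss (ρ0 j)) (cpl A B) +
      ENNReal.ofReal (ρ1 i / (2 * Real.pi)) *
        ((∫⁻ x, fm (fiber A i x) ∂gaussianPi n) ^ (1 + 2 * x) *
          (∫⁻ x, fm (fiber B i x) ∂gaussianPi n) ^ (1 + 2 * y)) ≤
      Measure.pi (fun j => bgauss (ρ1 j)) (cpl A B) := by
  have hxy : x * y < 1 := by nlinarith
  have rh := rhc_pi (1 + 2 * x) (1 + 2 * y) (by linarith) (by linarith) n ρ0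
    (fun j => (h j).trans_lt hxy) (fun j => quad_bound hx hx4 hy hy4 (h j))
    (fun x => fm (fiber A i x)) (fun x => fm (fiber B i x)) (measurable_fm hA mA i)
    (measurable_fm hB mB i) (fun x => fm_le_one (fiber_upper hA i x))
    (fun x => fm_le_one (fiber_upper hB i x))
  rw [measure_swap mA mB (fun j => bgauss (ρ1 j)) (fun j => bgauss (ρ0 j)) i
      (fun j hj => by rw [h01 j hj]),
    measure_swap mA mB (fun j => bgauss (ρ0 j)) (fun j => bgauss (ρ0 j)) i (fun j hj => rfl), h0]
  refine (add_le_add_right (mul_le_mul_right rh _) _).trans ?_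
  rw [← lintegral_const_mul' _ _ ENNReal.ofReal_ne_top, ← lintegral_add_right]
  · refine lintegral_mono fun z => ?_
    simp only [bgauss_zero, Measure.prod_prod]
    exact gain hr hx hx4 hy hy4 hi (fiber_upper hA i _) (fiber_upper hB i _)
  · have m1 := measurable_fm hA mA i
    have m2 := measurable_fm hB mB i
    have h1 : Measurable fun z : Fin n → ℝ × ℝ => fun j => (z j).1 := by fun_prop
    have h2 : Measurable fun z : Fin n → ℝ × ℝ => fun j => (z j).2 := by fun_prop
    exact (((m1.comp h1).pow_const _).mul ((m2.comp h2).pow_const _)).const_mul _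

lemma start {n : ℕ} {A B : Set (Fin n → ℝ)} (mA : MeasurableSet A) (mB : MeasurableSet B) :
    Measure.pi (fun _ => bgauss 0) (cpl A B) = gaussianPi n A * gaussianPi n B := by
  rw [bgauss_zero]
  have := measurePreserving_arrowProdEquivProdArrow ℝ ℝ (Fin n) (fun _ => _root_.stdGaussian)
    (fun _ => _root_.stdGaussian)
  unfold gaussianPi
  rw [← Measure.prod_prod, ← this.measure_preimage (mA.prod mB).nullMeasurableSet]
  rfl

/-- Diagonal Gaussian measure. -/
noncomputable def dgauss : Measure (ℝ × ℝ) := _root_.stdGaussian.map (fun x => (x, x))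

lemma meas_diag : Measurable (fun x : ℝ => (x, x)) := by fun_prop

instance : IsProbabilityMeasure dgauss := by
  unfold dgauss; exact Measure.isProbabilityMeasure_map meas_diag.aemeasurable

lemma finish {n : ℕ} {A B : Set (Fin n → ℝ)} (mA : MeasurableSet A) (mB : MeasurableSet B)
    (hA : IncreasingSet A) (hB : IncreasingSet B) (ρ : Fin n → ℝ) (hr : ∀ j, ρ j ^ 2 < 1) :
    Measure.pi (fun j => bgauss (ρ j)) (cpl A B) ≤ gaussianPi n (A ∩ B) := by
  classical
  let m : Finset (Fin n) → Fin n → Measure (ℝ × ℝ) := fun S j => if j ∈ S then dgauss else bgauss (ρ j)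
  haveI hp : ∀ S j, IsProbabilityMeasure (m S j) := fun S j => by
    simp only [m]; split_ifs <;> infer_instance
  have key : ∀ S : Finset (Fin n), Measure.pi (m ∅) (cpl A B) ≤ Measure.pi (m S) (cpl A B) := by
    intro S
    induction S using Finset.induction_on with
    | empty => exact le_rfl
    | insert i S hi ih =>
      refine ih.trans ?_
      rw [measure_swap mA mB (m S) (m S) i (fun j hj => rfl),
        measure_swap mA mB (m (insert i S)) (m S) i (fun j hj => by simp [m, hj])]
      refine lintegral_mono fun z => ?_
      have e1 : m S i = bgauss (ρ i) := by simp [m, hi]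
      have e2 : m (insert i S) i = dgauss := by simp [m]
      simp only [e1, e2]
      have u1 := fiber_upper hA i (fun j => (z j).1)
      have u2 := fiber_upper hB i (fun j => (z j).2)
      refine (bgauss_le_inter (hr i) u1 u2).trans_eq ?_
      unfold dgauss
      rw [Measure.map_apply meas_diag (u1.ordConnected.measurableSet.prod u2.ordConnected.measurableSet)]
      rfl
  have e0 : m ∅ = fun j => bgauss (ρ j) := by ext1 j; simp [m]
  have e1 : m Finset.univ = fun _ => dgauss := by ext1 j; simp [m]
  have k := key Finset.univ
  rw [e0, e1] at k
  refine k.trans_eq ?_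
  haveI : SigmaFinite (_root_.stdGaussian.map (fun x : ℝ => (x, x))) := by
    change SigmaFinite dgauss; infer_instance
  have h := Measure.pi_map_pi (ι := Fin n) (μ := fun _ => _root_.stdGaussian)
    (f := fun _ (x : ℝ) => (x, x)) (fun i => meas_diag.aemeasurable)
  unfold dgauss gaussianPi
  rw [← h, Measure.map_apply (by fun_prop) (measurableSet_cpl mA mB)]
  rfl

lemma integrable_mink {n : ℕ} {A : Set (Fin n → ℝ)} (hA : IncreasingSet A) (mA : MeasurableSet A)
    (i : Fin n) : Integrable (fun x => minkContent (fiber A i x)) (gaussianPi n) := by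
  refine Integrable.of_bound (measurable_mink hA mA i).aestronglyMeasurable 1
    (Eventually.of_forall fun x => ?_)
  have hu := fiber_upper hA i x
  rw [Real.norm_eq_abs, abs_of_nonneg (mink_nonneg hu)]
  rcases (upper_struct _ hu).2 with ⟨-, h⟩ | ⟨-, h⟩ | ⟨s, -, -, h⟩ <;> rw [h]
  · exact zero_le_one
  · exact zero_le_one
  · exact phi_le_one s

lemma infl_nonneg {n : ℕ} {A : Set (Fin n → ℝ)} (hA : IncreasingSet A) (i : Fin n) :
    0 ≤ geomInfluence A i :=
  integral_nonneg fun x => mink_nonneg (fiber_upper hA i x)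

lemma lintegral_fm {n : ℕ} {A : Set (Fin n → ℝ)} (hA : IncreasingSet A) (mA : MeasurableSet A)
    (i : Fin n) : ∫⁻ x, fm (fiber A i x) ∂gaussianPi n =
      ENNReal.ofReal (√(2 * Real.pi) * geomInfluence A i) := by
  unfold geomInfluence fm
  rw [← integral_const_mul, ofReal_integral_eq_lintegral_ofReal ((integrable_mink hA mA i).const_mul _)]
  exact Eventually.of_forall fun x => mul_nonneg (Real.sqrt_nonneg _)
    (mink_nonneg (fiber_upper hA i x))

lemma infl_le {n : ℕ} {A : Set (Fin n → ℝ)} (hA : IncreasingSet A) (mA : MeasurableSet A)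
    (i : Fin n) : √(2 * Real.pi) * geomInfluence A i ≤ 1 := by
  rw [← ENNReal.ofReal_le_one, ← lintegral_fm hA mA i]
  refine (lintegral_mono (g := fun _ => 1) fun x => fm_le_one (fiber_upper hA i x)).trans_eq ?_
  simp

lemma one_le_s2p : 1 ≤ √(2 * Real.pi) := by
  rw [Real.one_le_sqrt]; linarith [Real.pi_gt_three]

lemma log_ge {I : ℝ} (h0 : 0 < I) (h1 : √(2 * Real.pi) * I ≤ 1) :
    1 ≤ Real.log (Real.exp 1 / I) := by
  have : I ≤ 1 := by nlinarith [one_le_s2p]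
  rw [Real.log_div (Real.exp_pos 1).ne' h0.ne', Real.log_exp]
  linarith [Real.log_nonpos h0.le this]

lemma pow_ge {I : ℝ} (h0 : 0 < I) (h1 : √(2 * Real.pi) * I ≤ 1) :
    (√(2 * Real.pi) * I) * Real.exp (-1/2) ≤
      (√(2 * Real.pi) * I) ^ (1 + 2 * (1 / (4 * Real.log (Real.exp 1 / I)))) := by
  have ha := log_ge h0 h1
  set a := Real.log (Real.exp 1 / I) with hadef
  have e : Real.log I = 1 - a := by
    rw [hadef, Real.log_div (Real.exp_pos 1).ne' h0.ne', Real.log_exp]; ring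
  have hp : 0 < √(2 * Real.pi) * I := mul_pos (by linarith [one_le_s2p]) h0
  rw [Real.rpow_add hp, Real.rpow_one]
  refine mul_le_mul_of_nonneg_left ?_ hp.le
  have h2 : I ^ (2 * (1 / (4 * a))) ≤ (√(2 * Real.pi) * I) ^ (2 * (1 / (4 * a))) := by
    refine Real.rpow_le_rpow h0.le ?_ (by positivity)
    nlinarith [one_le_s2p]
  refine le_trans ?_ h2
  rw [Real.rpow_def_of_pos h0, e]
  refine Real.exp_le_exp.2 ?_
  have : (1 - a) * (2 * (1 / (4 * a))) = -1/2 + 1 / (2 * a) := by field_simp; ring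
  rw [this]
  have : 0 ≤ 1 / (2 * a) := by positivity
  linarith

/-- correlation parameter -/
noncomputable def rho (I J : ℝ) : ℝ :=
  1 / (4 * √(Real.log (Real.exp 1 / I) * Real.log (Real.exp 1 / J)))

lemma rho_nonneg (I J : ℝ) : 0 ≤ rho I J := by unfold rho; positivity

lemma rho_zero {I J : ℝ} (h : I = 0 ∨ J = 0) : rho I J = 0 := by
  unfold rho; rcases h with rfl | rfl <;> simp

lemma rho_sq {I J : ℝ} (h0 : 0 < I) (h1 : √(2 * Real.pi) * I ≤ 1)
    (h2 : 0 < J) (h3 : √(2 * Real.pi) * J ≤ 1) :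
    rho I J ^ 2 = (1 / (4 * Real.log (Real.exp 1 / I))) * (1 / (4 * Real.log (Real.exp 1 / J))) := by
  have ha := log_ge h0 h1
  have hb := log_ge h2 h3
  unfold rho
  rw [div_pow, mul_pow, Real.sq_sqrt (by positivity)]
  field_simp

lemma quarter {a : ℝ} (h : 1 ≤ a) : 1 / (4 * a) ≤ 1 / 4 := by
  apply one_div_le_one_div_of_le <;> linarith

theorem main_aux (n : ℕ) (A B : Set (Fin n → ℝ)) (mA : MeasurableSet A) (mB : MeasurableSet B)
    (hA : IncreasingSet A) (hB : IncreasingSet B) :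
    (gaussianPi n A).toReal * (gaussianPi n B).toReal +
      ∑ i, (Real.exp (-1) / 4) * (geomInfluence A i * geomInfluence B i /
            Real.sqrt (Real.log (Real.exp 1 / geomInfluence A i) *
              Real.log (Real.exp 1 / geomInfluence B i))) ≤ (gaussianPi n (A ∩ B)).toReal := by
  classical
  set ρ : Fin n → ℝ := fun i => rho (geomInfluence A i) (geomInfluence B i) with hρ
  have ρ0 : ∀ i, 0 ≤ ρ i := fun i => rho_nonneg _ _
  have ρ1 : ∀ i, ρ i ^ 2 < 1 := fun i => by
    by_cases h : geomInfluence A i = 0 ∨ geomInfluence B i = 0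
    · simp only [hρ, rho_zero h]; norm_num
    · push Not at h
      have pA := lt_of_le_of_ne (infl_nonneg hA i) h.1.symm
      have pB := lt_of_le_of_ne (infl_nonneg hB i) h.2.symm
      have lA := infl_le hA mA i
      have lB := infl_le hB mB i
      simp only [hρ]
      rw [rho_sq pA lA pB lB]
      have qa := quarter (log_ge pA lA)
      have qb := quarter (log_ge pB lB)
      have ga := log_ge pA lA
      have gb := log_ge pB lB
      have := mul_le_mul qa qb (by positivity) (by norm_num)
      linarith
  have key : ∀ S : Finset (Fin n), (gaussianPi n A).toReal * (gaussianPi n B).toReal +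
      ∑ i ∈ S, (Real.exp (-1) / 4) * (geomInfluence A i * geomInfluence B i /
            Real.sqrt (Real.log (Real.exp 1 / geomInfluence A i) *
              Real.log (Real.exp 1 / geomInfluence B i))) ≤
      (Measure.pi (fun j => bgauss (if j ∈ S then ρ j else 0)) (cpl A B)).toReal := by
    intro S
    induction S using Finset.induction_on_max_value ρ with
    | empty => simp [start mA mB]
    | insert i S hi hmax ih =>
      rw [Finset.sum_insert hi]
      by_cases h : geomInfluence A i = 0 ∨ geomInfluence B i = 0
      · have e : (fun j => bgauss (if j ∈ insert i S then ρ j else 0)) =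
            (fun j => bgauss (if j ∈ S then ρ j else 0)) := by
          ext1 j
          by_cases hj : j = i
          · subst hj; simp [hi, hρ, rho_zero h]
          · simp [hj]
        rw [e]
        have : geomInfluence A i * geomInfluence B i = 0 := mul_eq_zero.2 h
        rw [this, zero_div, mul_zero, zero_add]; exact ih
      · push Not at h
        have pA := lt_of_le_of_ne (infl_nonneg hA i) h.1.symm
        have pB := lt_of_le_of_ne (infl_nonneg hB i) h.2.symm
        have lA := infl_le hA mA i
        have lB := infl_le hB mB i
        have ga := log_ge pA lA
        have gb := log_ge pB lB
        have sq := rho_sq pA lA pB lB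
        have st := step mA mB hA hB i (fun j => if j ∈ S then ρ j else 0)
          (fun j => if j ∈ insert i S then ρ j else 0) (fun j hj => by simp [hj]) (by simp [hi])
          (x := 1 / (4 * Real.log (Real.exp 1 / geomInfluence A i)))
          (y := 1 / (4 * Real.log (Real.exp 1 / geomInfluence B i)))
          (by simp [ρ0 i]) (by positivity) (quarter ga) (by positivity) (quarter gb)
          (fun j => by
            rw [← sq]
            by_cases hj : j ∈ S
            · simp only [hj, if_true]; exact pow_le_pow_left₀ (ρ0 j) (hmax j hj) 2
            · simp only [hj, if_false]; rw [zero_pow two_ne_zero]; positivity)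
          (by rw [← sq]; simp [hρ])
        have st2 := ENNReal.toReal_mono (measure_ne_top _ _) st
        rw [lintegral_fm hA mA, lintegral_fm hB mB] at st2
        have s0 : 0 < √(2 * Real.pi) := by linarith [one_le_s2p]
        have fA : 0 < √(2 * Real.pi) * geomInfluence A i := mul_pos s0 pA
        have fB : 0 < √(2 * Real.pi) * geomInfluence B i := mul_pos s0 pB
        rw [ENNReal.ofReal_rpow_of_pos fA, ENNReal.ofReal_rpow_of_pos fB,
          ← ENNReal.ofReal_mul (by positivity), ← ENNReal.ofReal_mul (by
            simp only [Finset.mem_insert_self, if_true]; have := ρ0 i; positivity),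
          ENNReal.toReal_add (measure_ne_top _ _) ENNReal.ofReal_ne_top, ENNReal.toReal_ofReal (by
            simp only [Finset.mem_insert_self, if_true]; have := ρ0 i; positivity)] at st2
        simp only [Finset.mem_insert_self, if_true] at st2
        have q : Real.exp (-1) / 4 * (geomInfluence A i * geomInfluence B i /
            Real.sqrt (Real.log (Real.exp 1 / geomInfluence A i) *
              Real.log (Real.exp 1 / geomInfluence B i))) ≤
            ρ i / (2 * Real.pi) * ((√(2 * Real.pi) * geomInfluence A i) ^
              (1 + 2 * (1 / (4 * Real.log (Real.exp 1 / geomInfluence A i)))) *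
              (√(2 * Real.pi) * geomInfluence B i) ^
              (1 + 2 * (1 / (4 * Real.log (Real.exp 1 / geomInfluence B i))))) := by
          have m := mul_le_mul (pow_ge pA lA) (pow_ge pB lB) (by positivity) (by positivity)
          have hρi : 0 ≤ ρ i / (2 * Real.pi) := by have := ρ0 i; positivity
          refine le_trans (le_of_eq ?_) (mul_le_mul_of_nonneg_left m hρi)
          have e1 : Real.exp (-1) = Real.exp (-1/2) * Real.exp (-1/2) := by
            rw [← Real.exp_add]; norm_num
          have e2 : √(2 * Real.pi) * √(2 * Real.pi) = 2 * Real.pi := Real.mul_self_sqrt (by positivity)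
          have e3 : (√(2 * Real.pi) * geomInfluence A i * Real.exp (-1/2)) *
              (√(2 * Real.pi) * geomInfluence B i * Real.exp (-1/2)) =
              (2 * Real.pi) * Real.exp (-1) * (geomInfluence A i * geomInfluence B i) := by
            rw [e1]
            linear_combination (geomInfluence A i * geomInfluence B i * Real.exp (-1/2) ^ 2) * e2
          rw [e3]
          simp only [hρ, rho]
          have : √(Real.log (Real.exp 1 / geomInfluence A i) *
              Real.log (Real.exp 1 / geomInfluence B i)) ≠ 0 := by positivity
          field_simp
        linarith
  have k := key Finset.univ
  refine k.trans (ENNReal.toReal_mono (measure_ne_top _ _) ?_)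
  simp only [Finset.mem_univ, if_true]
  exact finish mA mB hA hB ρ ρ1

end GT

/-- **Theorem (alternative Gaussian Talagrand correlation bound).**
There is a universal constant `c > 0` such that for every `n` and every pair of increasing
Borel sets `A, B ⊆ ℝⁿ`,
`μ⊗ⁿ(A ∩ B) − μ⊗ⁿ(A)·μ⊗ⁿ(B) ≥
  c·∑ i, I_i^G(A)·I_i^G(B) / √(log(e/I_i^G(A))·log(e/I_i^G(B)))`. -/
theorem gaussian_talagrand_correlation_alt :
    ∃ c : ℝ, 0 < c ∧
      ∀ (n : ℕ) (A B : Set (Fin n → ℝ)),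
        MeasurableSet A → MeasurableSet B → IncreasingSet A → IncreasingSet B →
        (gaussianPi n (A ∩ B)).toReal - (gaussianPi n A).toReal * (gaussianPi n B).toReal ≥
          c * ∑ i, geomInfluence A i * geomInfluence B i /
            Real.sqrt (Real.log (Real.exp 1 / geomInfluence A i) *
              Real.log (Real.exp 1 / geomInfluence B i)) := by
  refine ⟨Real.exp (-1) / 4, by positivity, fun n A B mA mB hA hB => ?_⟩
  have h := GT.main_aux n A B mA mB hA hB
  rw [← Finset.mul_sum] at h
  linarith
end
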